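/- arXiv:2510.11252 — 3 statements merged into one kernel-verified Lean document; each statement's English description precedes it below -/
import Mathlib

section
/- Let N ≥ 2 be an integer, and let q_1 < q_2 < ⋯ be the first coordinates of all N-solutions (x, m) in which x is a prime number. Then Π_{i ≥ 2} q_i/(q_i − 1) < 2.07913, i.e., the product of q/(q − 1) over all prime N-solutions (q, m) with q > q_1 is strictly less than 2.07913. -/
/-- For an integer `N ≥ 2`, a pair `(x, m)` with `x ≥ 2`, `m ≥ 2` is an `N`-solution if
`(x^m - 1)/(x - 1) = 1 + x + ⋯ + x^(m-1) = N`. -/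
def IsNSol (N x m : ℕ) : Prop :=
  2 ≤ x ∧ 2 ≤ m ∧ ∑ i ∈ Finset.range m, x ^ i = N

/-! ### Elementary facts on `N`-solutions -/

theorem IsNSol.exists_sum {N x m : ℕ} (h : IsNSol N x m) :
    ∃ S : ℕ, N = x * S + 1 ∧ S * (x - 1) + 1 = x ^ (m - 1) ∧ S ≡ 1 [MOD x] := by
  obtain ⟨hx, hm, hs⟩ := h
  obtain ⟨i, rfl⟩ : ∃ i, m = i + 2 := ⟨m - 2, by omega⟩
  refine ⟨∑ k ∈ Finset.range (i + 1), x ^ k, ?_, ?_, ?_⟩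
  · rw [← hs, Finset.sum_range_succ', Finset.mul_sum]
    simp [pow_succ, mul_comm]
  · obtain ⟨y, rfl⟩ : ∃ y, x = y + 1 := ⟨x - 1, by omega⟩
    have := geom_sum_mul_add y (i + 1)
    simpa using this
  · rw [Finset.sum_range_succ']
    have : x ∣ ∑ k ∈ Finset.range i, x ^ (k + 1) :=
      Finset.dvd_sum fun k _ => dvd_pow_self x (Nat.succ_ne_zero k)
    simpa using ((Nat.modEq_zero_iff_dvd.2 this).add_right 1)

theorem IsNSol.mul_add_one {N x m : ℕ} (h : IsNSol N x m) : N * (x - 1) + 1 = x ^ m := by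
  obtain ⟨hx, hm, hs⟩ := h
  obtain ⟨y, rfl⟩ : ∃ y, x = y + 1 := ⟨x - 1, by omega⟩
  have := geom_sum_mul_add y m
  rw [← hs]
  simpa using this

theorem IsNSol.dvd_sub_one {N x m : ℕ} (h : IsNSol N x m) : x ∣ N - 1 := by
  obtain ⟨S, h1, -, -⟩ := h.exists_sum
  simp [h1]

theorem IsNSol.not_sq_dvd {N x m : ℕ} (h : IsNSol N x m) : ¬ x ^ 2 ∣ N - 1 := by
  obtain ⟨S, h1, -, h3⟩ := h.exists_sum
  have hx := h.1
  intro hd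
  rw [h1, Nat.add_sub_cancel, pow_two] at hd
  have hd := (Nat.modEq_zero_iff_dvd.2 (Nat.dvd_of_mul_dvd_mul_left (by omega) hd))
  have := h3.symm.trans hd
  rw [Nat.modEq_zero_iff_dvd, Nat.dvd_one] at this
  omega

theorem IsNSol.dvd_sub_one_iff {N x m M : ℕ} (h : IsNSol N x m) (hM : M.Coprime x) :
    M ∣ N - 1 ↔ x ^ (m - 1) ≡ 1 [MOD M * (x - 1)] := by
  obtain ⟨S, h1, h2, -⟩ := h.exists_sum
  have hx := h.1
  have hpos : 0 < x - 1 := by omega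
  rw [h1, Nat.add_sub_cancel, hM.dvd_mul_left, ← h2, Nat.ModEq.comm,
    Nat.modEq_iff_dvd' (by omega), Nat.add_sub_cancel]
  exact (Nat.mul_dvd_mul_iff_right hpos).symm

theorem IsNSol.lt_pow {N x m : ℕ} (h : IsNSol N x m) : N < x ^ m := by
  have := h.mul_add_one
  have hx := h.1
  have : N * 1 ≤ N * (x - 1) := Nat.mul_le_mul_left _ (by omega)
  omega

theorem IsNSol.pow_lt {N x m : ℕ} (h : IsNSol N x m) : x ^ (m - 1) < N := by
  obtain ⟨S, h1, h2, -⟩ := h.exists_sum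
  have hx := h.1
  have hS : S * x = S * (x - 1) + S := by
    obtain ⟨y, rfl⟩ : ∃ y, x = y + 1 := ⟨x - 1, by omega⟩
    simp; ring
  have : 0 < S := by
    rcases Nat.eq_zero_or_pos S with rfl | h0
    · have := Nat.one_lt_pow (n := m - 1) (by have := h.2.1; omega) hx
      omega
    · exact h0
  rw [h1, mul_comm]
  omega

theorem IsNSol.exponent_lt {N x y m n : ℕ} (hx : IsNSol N x m) (hy : IsNSol N y n) (hxy : x < y) :
    n < m := by
  by_contra! hmn
  have h1 := hx.2.2
  have h2 := hy.2.2
  have : ∑ i ∈ Finset.range m, x ^ i < ∑ i ∈ Finset.range m, y ^ i := by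
    apply Finset.sum_lt_sum
    · intro i _
      exact Nat.pow_le_pow_left hxy.le i
    · exact ⟨1, Finset.mem_range.2 hx.2.1, by simpa using hxy⟩
  have h3 : ∑ i ∈ Finset.range m, y ^ i ≤ ∑ i ∈ Finset.range n, y ^ i :=
    Finset.sum_le_sum_of_subset (Finset.range_mono hmn)
  omega

/-! ### Excluding pairs of small primes by congruences -/

/-- Modular exponentiation, processing the exponent five bits at a time. -/
def powMod : ℕ → ℕ → ℕ → ℕ → ℕ
  | 0, b, e, M => b ^ e % M
  | k + 1, b, e, M =>
    bif Nat.blt e 32 then b ^ e % M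
    else (powMod k b (e / 32) M) ^ 32 * b ^ (e % 32) % M

theorem powMod_eq (k b e M : ℕ) : powMod k b e M = b ^ e % M := by
  induction k generalizing e with
  | zero => rfl
  | succ k ih =>
    unfold powMod
    cases hb : Nat.blt e 32
    · simp only [cond_false, ih]
      conv_rhs => rw [← Nat.div_add_mod e 32, pow_add, mul_comm 32, pow_mul]
      rw [Nat.mul_mod, Nat.pow_mod, Nat.mod_mod, ← Nat.pow_mod, ← Nat.mul_mod]
    · simp

/-- Boolean test for `b ^ e ≡ 1` modulo `M * (b - 1)`. -/
def powOne (b e M : ℕ) : Bool :=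
  Nat.beq (powMod 20 b e (M * (b - 1))) (1 % (M * (b - 1)))

theorem powOne_iff (b e M : ℕ) : powOne b e M = true ↔ b ^ e ≡ 1 [MOD M * (b - 1)] := by
  unfold powOne
  rw [powMod_eq, Nat.beq_eq]
  rfl

/-- Boolean primality test by trial division, for numbers below `14 ^ 2`. -/
def trialPrime (r : ℕ) : Bool :=
  Nat.blt 1 r && Nat.blt r 196 &&
    (List.range 14).all fun d => Nat.blt d 2 || Nat.beq d r || !Nat.beq (r % d) 0

theorem prime_of_trialPrime {r : ℕ} (h : trialPrime r = true) : r.Prime := by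
  simp only [trialPrime, Bool.and_eq_true, Nat.blt_eq, List.all_eq_true, List.mem_range,
    Bool.or_eq_true, Bool.not_eq_true', Nat.beq_eq] at h
  rw [Nat.prime_def_le_sqrt]
  refine ⟨h.1.1, fun d hd hds hdvd => ?_⟩
  rw [Nat.le_sqrt] at hds
  rcases h.2 d (by nlinarith [h.1.2]) with (h | h) | h
  · omega
  · subst h
    nlinarith
  · rw [Nat.mod_eq_zero_of_dvd hdvd] at h
    simp at h

theorem pow_dvd_of_not_dvd_div {r v D g : ℕ} (hr : r.Prime) (hv : r ^ v ∣ D) (hg : g ∣ D)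
    (hn : ¬ g ∣ D / r) : r ^ v ∣ g := by
  obtain ⟨w, rfl⟩ := hv
  obtain ⟨k, hk, hkv⟩ := (Nat.dvd_prime_pow hr).1 (Nat.gcd_dvd_right g (r ^ v))
  have h1 : g ∣ r ^ k * w := by
    have := Nat.gcd_mul_right_dvd_mul_gcd g (r ^ v) w
    rw [Nat.gcd_eq_left hg, hkv] at this
    exact this.trans (Nat.mul_dvd_mul_left _ (Nat.gcd_dvd_right _ _))
  rcases hk.lt_or_eq with hlt | rfl
  · exfalso
    apply hn
    obtain ⟨c, rfl⟩ : ∃ c, v = c + 1 := ⟨v - 1, by omega⟩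
    rw [pow_succ, mul_assoc, mul_left_comm, Nat.mul_div_cancel_left _ hr.pos]
    exact h1.trans (Nat.mul_dvd_mul_right (pow_dvd_pow r (by omega)) w)
  · rw [← hkv]
    exact Nat.gcd_dvd_left _ _

theorem gcd_pow_dvd_exponent {x M D r j : ℕ} (hr : r.Prime) (hj : x ^ j ≡ 1 [MOD M])
    (hD : x ^ D ≡ 1 [MOD M]) (hn : ¬ x ^ (D / r) ≡ 1 [MOD M]) : D.gcd (r ^ 32) ∣ j := by
  obtain ⟨v, -, hv⟩ := (Nat.dvd_prime_pow hr).1 (Nat.gcd_dvd_right D (r ^ 32))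
  rw [hv]
  refine (pow_dvd_of_not_dvd_div (D := D) (g := orderOf (x : ZMod M)) hr
    (hv ▸ Nat.gcd_dvd_left _ _) ?_ ?_).trans ?_
  · rw [orderOf_dvd_iff_pow_eq_one]
    exact_mod_cast (ZMod.natCast_eq_natCast_iff _ _ _).2 hD
  · rw [orderOf_dvd_iff_pow_eq_one]
    intro h
    exact hn ((ZMod.natCast_eq_natCast_iff _ _ _).1 (by exact_mod_cast h))
  · rw [orderOf_dvd_iff_pow_eq_one]
    exact_mod_cast (ZMod.natCast_eq_natCast_iff _ _ _).2 hj

/-- `transfers p q I M D r` checks that whenever `I` divides the exponent belonging to `p`, the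
modulus `M` divides `N - 1`, and that this makes the largest power of `r` dividing `D` a divisor of
the exponent belonging to `q`. -/
def transfers (p q I M D r : ℕ) : Bool :=
  (Nat.beq M p || (Nat.beq (M.gcd p) 1 && powOne p I M)) && Nat.beq (M.gcd q) 1 &&
    powOne q D M && !powOne q (D / r) M && trialPrime r

theorem dvd_of_transfers {p q I M D r N m n : ℕ} (h : transfers p q I M D r = true)
    (hp : IsNSol N p m) (hq : IsNSol N q n) (hI : I ∣ m - 1) : D.gcd (r ^ 32) ∣ n - 1 := by
  simp only [transfers, Bool.and_eq_true, Bool.or_eq_true, Bool.not_eq_true', Nat.beq_eq] at h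
  obtain ⟨⟨⟨⟨h1, h2⟩, h3⟩, h4⟩, h5⟩ := h
  have hM : M ∣ N - 1 := by
    rcases h1 with rfl | ⟨h1, h1'⟩
    · exact hp.dvd_sub_one
    · rw [hp.dvd_sub_one_iff h1]
      obtain ⟨c, hc⟩ := hI
      rw [hc, pow_mul]
      simpa using ((powOne_iff _ _ _).1 h1').pow c
  refine gcd_pow_dvd_exponent (prime_of_trialPrime h5) ((hq.dvd_sub_one_iff h2).1 hM)
    ((powOne_iff _ _ _).1 h3) ?_
  rw [← powOne_iff, h4]
  simp

/-- Runs a list of transfers, where `c = 2 * M + s` encodes the modulus `M` and the side `s` the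
transfer starts from, and checks that the accumulated divisors force `q ^ 2 ∣ N - 1` or
`p ^ 2 ∣ N - 1`. -/
def refutes (p q : ℕ) : ℕ → ℕ → List (ℕ × ℕ × ℕ) → Bool
  | I, J, [] => powOne p I (q ^ 2) || powOne q J (p ^ 2)
  | I, J, (c, D, r) :: l =>
    bif Nat.beq (c % 2) 0 then
      transfers p q I (c / 2) D r && refutes p q I (J.lcm (D.gcd (r ^ 32))) l
    else
      transfers q p J (c / 2) D r && refutes p q (I.lcm (D.gcd (r ^ 32))) J l

theorem false_of_powOne {p q I N m n : ℕ} (h : powOne p I (q ^ 2) = true) (hpq : q.Coprime p)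
    (hp : IsNSol N p m) (hq : IsNSol N q n) (hI : I ∣ m - 1) : False := by
  apply hq.not_sq_dvd
  rw [hp.dvd_sub_one_iff (hpq.pow_left 2)]
  obtain ⟨c, hc⟩ := hI
  rw [hc, pow_mul]
  simpa using ((powOne_iff _ _ _).1 h).pow c

theorem false_of_refutes {p q N m n : ℕ} (hpq : p.Coprime q) (hp : IsNSol N p m)
    (hq : IsNSol N q n) {I J : ℕ} {l : List (ℕ × ℕ × ℕ)} (h : refutes p q I J l = true)
    (hI : I ∣ m - 1) (hJ : J ∣ n - 1) : False := by
  induction l generalizing I J with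
  | nil =>
    simp only [refutes, Bool.or_eq_true] at h
    rcases h with h | h
    · exact false_of_powOne h hpq.symm hp hq hI
    · exact false_of_powOne h hpq hq hp hJ
  | cons a l ih =>
    obtain ⟨c, D, r⟩ := a
    simp only [refutes] at h
    cases hc : Nat.beq (c % 2) 0 <;>
      simp only [hc, cond_true, cond_false, Bool.and_eq_true] at h
    · exact ih h.2 (Nat.lcm_dvd hI (dvd_of_transfers h.1 hq hp hJ)) hJ
    · exact ih h.2 hI (Nat.lcm_dvd hJ (dvd_of_transfers h.1 hp hq hI))

/-- Sequences of transfers refuting the pairs `(p, q)` with `p < q` running through the primes below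
`127`, listed by `q` and then by `p`, the pair `(2, 5)` excepted. -/
def transferTable : List (ℕ × List (ℕ × List (ℕ × ℕ × ℕ))) :=
  [
   (3, [(2, [(4,2,2)])]),
   (5, [(3, [(11,4,2), (6,2,2), (8,4,2), (27,3,3), (146,72,3)])]),
   (7, [(2, [(4,2,2)]), (3, [(15,6,2), (6,3,3), (39,18,3), (74,9,3)]), (5, [(10,4,2)])]),
   (11, [(2, [(4,2,2)]), (3, [(23,5,5)]), (5, [(23,5,5), (10,5,5), (142,70,7), (423,35,7),
   (8402,4200,5)]), (7, [(23,10,2), (14,3,3), (4,2,2), (7,3,3), (86,7,7)])]),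
   (13, [(2, [(27,12,2), (10,4,2)]), (3, [(27,3,3), (6,3,3), (123,10,5), (242,110,2), (315,78,13)]),
   (5, [(10,4,2), (15,6,3), (62,30,5)]), (7, [(27,12,2), (27,12,3), (14,2,2), (86,21,7)]), (11,
   [(27,12,2), (27,12,3), (22,10,2), (6,3,3), (315,39,13)])]),
   (17, [(2, [(35,8,2), (10,4,2)]), (3, [(6,2,2)]), (5, [(10,4,2), (19,6,3), (62,30,5)]), (7,
   [(35,16,2), (14,6,2), (14,6,3), (7,3,3), (86,21,7)]), (11, [(35,16,2), (22,10,2), (19,6,3),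
   (26,6,3), (615,153,17)]), (13, [(35,4,2), (26,6,2), (26,6,3), (7,3,3), (314,39,13)])]),
   (19, [(2, [(4,2,2)]), (3, [(39,18,2), (39,18,3), (74,36,3)]), (5, [(39,9,3), (10,2,2),
   (62,15,5)]), (7, [(14,6,2), (14,6,3)]), (11, [(39,3,3), (22,10,2), (22,10,5), (5,2,2), (11,5,5),
   (18,9,3), (399,22,11), (662,165,11)]), (13, [(26,12,2), (26,12,3)]), (17, [(39,9,3), (34,8,2),
   (614,51,17)])]),
   (23, [(2, [(4,2,2)]), (3, [(47,11,11), (6,2,2), (5,2,2), (134,33,3)]), (5, [(47,22,2), (47,22,11),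
   (10,4,2), (9,4,2), (26,6,3), (134,33,11), (663,165,5), (1042,520,5)]), (7, [(47,22,2), (14,3,3),
   (4,2,2), (7,3,3), (86,21,7)]), (11, [(47,22,2), (47,22,11), (4,2,2), (398,99,3), (543,135,3),
   (2906,363,11)]), (13, [(26,6,2), (26,6,3)]), (17, [(47,22,2), (34,16,2), (18,6,3), (27,6,3),
   (614,306,17)]), (19, [(47,22,2), (47,22,11), (38,9,3), (4,2,2), (10,4,2), (107,52,13),
   (1198,598,23), (1383,46,23)])]),
   (29, [(2, [(59,28,2), (59,28,7), (86,42,3), (135,66,11), (178,88,2)]), (3, [(59,28,2), (59,28,7),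
   (6,2,2), (8,4,2), (843,105,3), (843,105,5), (2102,525,3)]), (5, [(59,14,2), (59,14,7), (10,2,2),
   (898,448,2), (898,448,7), (24195,12096,2), (24195,12096,3), (24866,12432,3), (24866,12432,37),
   (27827,13912,47), (31083,3885,5), (33842,16920,5)]), (7, [(59,7,7), (14,7,7), (9466,1183,13),
   (23663,11830,5), (23663,11830,13), (40042,20020,2), (7,3,3), (11,4,2), (32,16,2), (35,16,2),
   (818,408,17), (3947,1972,29)]), (11, [(59,28,2), (22,10,2), (22,10,5), (63,30,3), (74,12,3),
   (135,66,11), (178,88,11)]), (13, [(59,14,2), (26,3,3), (4,2,2), (7,3,3), (314,52,13)]), (17,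
   [(59,4,2), (34,16,2), (18,6,3), (27,6,3), (614,306,17)]), (19, [(59,28,2), (59,28,7), (38,18,2),
   (38,18,3), (7,3,3), (8,4,2), (16,8,2), (19,9,3), (123,30,5), (142,35,5), (483,48,2), (674,336,2),
   (1046,261,29), (1859,116,29)]), (23, [(59,7,7), (46,11,11), (10673434,5336716,2),
   (10673434,5336716,7), (5,2,2), (15,3,3), (18,6,3), (135,33,11), (12146,2024,23)])]),
   (31, [(2, [(4,2,2)]), (3, [(63,30,2), (63,30,3), (4,2,2), (17,4,2), (146,72,3)]), (5, [(63,3,3),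
   (10,5,5), (23,5,5), (142,70,7), (362,20,2), (563,140,2), (1202,200,5)]), (7, [(14,6,2),
   (14,6,3)]), (11, [(63,30,2), (22,5,5), (4,2,2), (6,3,3), (33,8,2), (663,330,11), (706,352,11)]),
   (13, [(63,30,2), (63,30,3), (26,4,2), (314,78,13)]), (17, [(63,30,3), (34,16,2), (614,306,17)]),
   (19, [(63,15,3), (63,15,5), (38,6,2), (38,6,3), (5,2,2), (17,4,2), (26,4,2), (50,25,5), (75,36,3),
   (218,54,3), (327,162,3), (3803,95,19), (4106,513,19)]), (23, [(63,10,2), (63,10,5), (4,2,2),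
   (6,3,3), (39,9,3), (99,21,7), (142,70,7), (2234,279,31), (2607,651,31)]), (29, [(63,10,2),
   (58,28,2), (58,28,7), (33,16,2), (34,16,2), (819,408,17), (3946,493,29)])]),
   (37, [(2, [(75,36,2), (10,4,2)]), (3, [(75,18,2), (75,18,3), (8,4,2), (11,4,2), (146,9,3)]), (5,
   [(75,36,2), (75,36,3), (10,4,2), (6,3,3), (87,42,7), (98,21,7), (135,22,11), (143,5,5),
   (242,55,5)]), (7, [(75,9,3), (14,3,3), (18,9,3), (38,2,2), (63,15,5), (87,6,2), (255,126,7),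
   (422,105,7)]), (11, [(75,6,2), (75,6,3), (22,5,5), (6,3,3), (8,4,2), (11,5,5), (135,66,11),
   (662,330,11)]), (13, [(75,36,2), (75,36,3), (26,12,2), (26,12,3), (314,39,13)]), (17, [(75,36,2),
   (34,16,2), (6,3,3), (87,21,7), (275,68,17), (478,238,17)]), (19, [(75,36,2), (75,36,3), (38,2,2),
   (8,4,2), (98,21,7), (1046,522,29), (1683,812,29), (8818,4408,19)]), (23, [(75,12,2), (75,12,3),
   (46,22,2), (46,22,11), (6,3,3), (135,33,11), (12146,2024,23)]), (29, [(75,12,2), (75,12,3),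
   (58,28,2), (58,28,7), (6,3,3), (18,9,3), (63,10,5), (122,20,5), (399,99,11), (662,330,11),
   (1203,600,5), (2555,319,29), (2902,1450,29)]), (31, [(75,4,2), (62,6,2), (62,6,3), (135,66,11),
   (5458,1364,31)])]),
   (41, [(2, [(83,20,2), (4,2,2), (15,3,3), (26,12,2)]), (3, [(6,2,2), (15,6,3), (26,12,3)]), (5,
   [(83,20,2), (10,5,5), (4,2,2), (8,4,2), (15,6,3), (203,25,5), (302,50,5)]), (7, [(83,40,2),
   (14,2,2), (7,3,3), (86,7,7)]), (11, [(83,40,2), (22,10,2), (22,10,5), (8,4,2), (15,3,3),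
   (38,18,3), (59,28,7), (795,99,11), (926,462,11)]), (13, [(83,40,2), (26,12,2), (26,12,3), (7,3,3),
   (314,52,13)]), (17, [(83,40,2), (83,40,5), (34,16,2), (142,14,7), (227,112,7), (275,68,17),
   (478,238,17)]), (19, [(83,40,2), (38,18,2), (38,18,3), (8,4,2), (10,5,5), (1523,380,19),
   (1683,812,29), (2206,551,19)]), (23, [(83,10,2), (83,10,5), (4,2,2), (15,3,3), (18,6,3),
   (3447,861,41)]), (29, [(58,4,2)]), (31, [(83,10,2), (83,10,5), (62,15,3), (3447,574,41)]), (37,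
   [(83,5,5), (74,18,3), (3447,861,41)])]),
   (43, [(2, [(4,2,2)]), (3, [(87,42,2), (87,42,3), (4,2,2), (23,5,5), (542,270,3)]), (5,
   [(10,4,2)]), (7, [(87,6,2), (87,6,3), (14,7,7), (4,2,2), (6,3,3), (23,10,5), (27,12,2), (32,8,2),
   (35,16,2), (38,9,3), (219,27,3), (542,270,3), (5295,2646,7), (6274,1568,7)]), (11, [(87,7,7),
   (22,2,2), (5,2,2), (6,3,3), (27,12,2), (27,12,3), (38,9,3), (58,28,7), (122,60,5), (143,70,5),
   (399,22,11), (662,165,11)]), (13, [(87,21,3), (26,6,2), (26,6,3), (5,2,2), (314,156,13)]), (17,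
   [(87,21,3), (34,8,2), (614,306,17)]), (19, [(87,42,2), (87,42,3), (87,42,7)]), (23, [(87,21,3),
   (46,22,2), (46,22,11), (5,2,2), (6,3,3), (279,46,23), (554,276,23)]), (29, [(87,42,2), (87,42,3),
   (87,42,7), (58,28,2), (58,28,7), (23,10,5), (62,30,5), (251,50,5), (4763,2380,17), (5102,850,17),
   (11699,2924,43)]), (31, [(87,21,3), (62,30,2), (62,30,3), (62,30,5), (5,2,2), (27,4,2), (38,9,3),
   (399,99,11), (5458,2728,31)]), (37, [(74,4,2), (9,4,2), (23,5,5), (274,136,17), (1295,646,19),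
   (1522,760,19), (8439,703,37), (8882,4440,37)]), (41, [(82,20,2), (82,20,5), (5,2,2), (6,3,3),
   (27,12,3), (3446,861,41)])]),
   (47, [(2, [(4,2,2)]), (3, [(95,23,23), (6,2,2), (5,2,2), (33,8,2), (82,40,2), (195,48,3),
   (278,69,3)]), (5, [(10,4,2), (9,4,2), (17,8,2), (626,312,3), (626,312,13), (1095,546,3),
   (1202,75,5)]), (7, [(14,6,2), (14,6,3), (5,2,2), (7,3,3), (86,7,7)]), (11, [(95,46,2), (95,46,23),
   (22,5,5), (2026,1012,11)]), (13, [(95,46,2), (26,4,2), (7,3,3), (314,39,13)]), (17, [(34,4,2),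
   (5,2,2), (9,4,2), (18,6,3), (207,51,17), (274,136,17)]), (19, [(95,46,2), (38,9,3), (4,2,2),
   (7,3,3), (10,4,2), (17,4,2), (19,9,3), (98,42,7), (1046,522,29), (1683,812,29), (8818,4408,19)]),
   (23, [(95,46,2), (95,46,23), (4,2,2), (33,4,2), (106,13,13), (263,130,5), (278,69,3),
   (1882,235,47), (2259,188,47)]), (29, [(95,46,2), (58,28,2), (58,28,7), (9,4,2), (27,3,3),
   (74,3,3), (207,51,17), (3946,1972,29)]), (31, [(95,46,2), (95,46,23), (62,5,5), (4,2,2), (7,3,3),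
   (23,5,5), (38,9,3), (64,4,2), (82,40,2), (98,42,7), (143,70,7), (147,72,2), (1043,130,13),
   (1094,39,13), (2258,282,47), (2447,1222,47)]), (37, [(95,23,23), (74,3,3), (123,20,2),
   (274,136,2), (274,136,17), (579,272,2), (819,408,3), (922,460,5), (1043,130,13), (6866,858,11),
   (21058,658,47), (24819,4136,47)]), (41, [(95,46,2), (82,40,2), (82,40,5), (14,6,3), (19,6,3),
   (3446,861,41)]), (43, [(95,46,2), (86,7,7), (4,2,2), (7,3,3), (26,4,2), (33,8,2), (65,16,2),
   (626,312,13), (4475,1118,43), (5506,1376,43)])]),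
   (53, [(2, [(107,52,2), (10,4,2)]), (3, [(6,2,2)]), (5, [(10,4,2), (19,6,3), (62,30,5)]), (7,
   [(107,26,2), (14,3,3), (4,2,2), (7,3,3), (86,21,7)]), (11, [(107,26,2), (22,5,5), (4,2,2),
   (8,4,2), (19,6,3), (38,18,3), (163,54,3), (563,280,2), (563,280,7), (615,153,17), (898,224,2),
   (1155,96,2), (2594,324,3), (3567,1782,11), (3742,935,11)]), (13, [(107,13,13), (26,13,13),
   (528062,132015,3), (528062,132015,5), (15,2,2), (23,10,5), (819,136,2), (842,420,7), (1095,21,7),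
   (9466,1183,13)]), (17, [(107,26,13), (34,8,2), (17,8,2), (55,6,3), (146,72,3), (819,51,17),
   (886,442,17)]), (19, [(107,52,2), (107,52,13), (38,18,2), (38,18,3), (7,3,3), (98,21,7),
   (262,5,5), (423,15,5), (615,51,17), (886,442,17), (1295,646,19), (1522,760,19)]), (23, [(107,4,2),
   (46,22,2), (8,4,2), (19,6,3), (55,18,3), (74,9,3), (542,135,5), (563,280,7), (5938,212,53),
   (6363,3180,53)]), (29, [(107,26,2), (107,26,13), (58,7,7), (4,2,2), (10,4,2), (19,6,3),
   (134,22,11), (179,88,2), (227,112,2), (227,112,7), (563,70,5), (674,336,2), (2122,265,53),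
   (3395,1696,53)]), (31, [(107,52,2), (62,30,2), (62,30,3), (62,30,5), (7,3,3), (64,32,2),
   (662,165,11), (707,352,11), (5458,2728,31)]), (37, [(107,26,2), (74,9,3), (4,2,2), (7,3,3),
   (19,9,3), (62,30,5), (134,22,11), (146,72,2), (179,8,2), (243,55,5), (243,55,11), (2554,116,29),
   (2903,1450,29), (64382,10730,37)]), (41, [(82,40,2), (82,40,5), (19,6,3), (3446,574,41)]), (43,
   [(107,26,2), (86,21,3), (86,21,7), (4,2,2), (8,4,2), (11,4,2), (19,9,3), (38,18,3), (615,306,17),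
   (11698,344,43)]), (47, [(94,23,23)])]),
   (59, [(2, [(4,2,2)]), (3, [(119,29,29), (6,2,2), (5,2,2), (1046,174,3)]), (5, [(10,2,2), (9,4,2),
   (26,12,3), (327,54,3), (542,270,5)]), (7, [(14,6,2), (14,6,3), (5,2,2), (7,3,3), (86,7,7)]), (11,
   [(119,58,2), (119,58,29), (22,5,5), (4,2,2), (83,40,2), (122,60,3), (327,162,3), (486,162,3),
   (1983,990,11), (2554,44,11)]), (13, [(119,58,2), (26,12,2), (26,12,3), (7,3,3), (314,52,13)]),
   (17, [(34,8,2), (5,2,2), (18,6,3), (27,6,3), (614,306,17)]), (19, [(38,18,2), (38,18,3), (5,2,2),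
   (7,3,3), (19,9,3), (398,66,11), (839,418,19), (914,456,19)]), (23, [(119,58,2), (119,58,29),
   (46,11,11), (135,33,3), (158,78,3), (7083,708,59)]), (29, [(119,29,29), (33526,986,17),
   (168898,3016,2), (33,16,2), (819,408,3), (1346,96,3), (7083,1180,59)]), (31, [(119,58,2),
   (119,58,29), (62,15,3), (4,2,2), (7,3,3), (32,8,2), (35,16,2), (64,16,2), (387,96,2),
   (662,330,11), (839,418,19), (914,456,19), (3778,472,59), (4487,1121,59)]), (37, [(119,58,2),
   (74,36,2), (74,36,3), (7,3,3), (9,4,2), (19,9,3), (86,7,7), (146,72,2), (274,17,17), (479,238,17),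
   (1187,74,37), (2518,1258,37)]), (41, [(82,5,5), (23,10,2), (23,10,5), (122,60,2), (122,60,3),
   (327,81,3), (3446,574,41)]), (43, [(119,58,2), (119,58,29), (4,2,2), (7,3,3), (26,12,3),
   (7083,885,59)]), (47, [(119,58,2), (119,58,29), (4,2,2), (11,4,2), (26,12,3), (7083,885,59)]),
   (53, [(119,29,29)])]),
   (61, [(2, [(123,60,2), (123,60,3), (18,9,3), (39,18,3), (74,36,2)]), (3, [(123,10,2), (123,10,5),
   (6,3,3), (4,2,2), (8,4,2), (15,6,3), (22,10,5), (83,8,2), (146,36,3)]), (5, [(123,30,2),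
   (123,30,3), (6,3,3), (27,4,2), (1202,300,5)]), (7, [(123,60,2), (123,60,3), (14,6,2), (14,6,3),
   (86,42,7)]), (11, [(123,4,2), (22,10,2), (22,10,5), (6,3,3), (8,4,2), (263,65,13), (1323,33,11),
   (1718,11,11)]), (13, [(123,3,3), (26,3,3), (195,96,2), (314,156,13)]), (17, [(123,60,3),
   (34,16,2), (614,306,17)]), (19, [(123,30,2), (123,30,3), (38,9,3), (10,5,5), (195,32,2),
   (263,26,13), (1154,576,2), (29187,3648,19), (29642,14820,19)]), (23, [(123,20,2), (46,22,2),
   (46,22,11), (6,3,3), (10,5,5), (15,3,3), (23,11,11), (12146,276,23)]), (29, [(123,12,2),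
   (58,28,2), (58,28,7), (6,3,3), (195,96,2), (1047,261,29), (1858,464,29)]), (31, [(123,60,2),
   (123,60,3), (123,60,5), (62,2,2), (8,4,2), (10,5,5), (38,9,3), (98,42,7), (147,72,3), (542,135,3),
   (1403,350,5), (3723,930,31), (3802,1900,19), (4107,513,19), (4714,1178,31)]), (37, [(123,20,2),
   (123,20,5), (74,36,3), (7,3,3), (10,5,5), (263,130,13), (314,156,13), (8542,2135,61),
   (9519,4758,61)]), (41, [(123,10,2), (82,20,2), (82,20,5), (6,3,3), (27,12,3), (3446,861,41)]),
   (43, [(123,60,2), (123,60,5), (86,42,2), (86,42,3), (86,42,7), (15,7,7), (50,25,5),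
   (4762,2380,17), (5103,850,17), (11698,5848,43)]), (47, [(123,3,3), (74,36,2), (74,36,3),
   (147,72,2), (363,180,5), (482,40,5), (1323,330,11), (3723,930,31), (5458,341,31),
   (68079,17019,61)]), (53, [(123,20,2), (123,20,5), (106,52,2), (106,52,13), (6,3,3), (10,5,5),
   (15,3,3), (18,9,3), (39,18,3), (83,40,2), (482,40,2), (614,306,17), (887,442,17), (1294,646,19),
   (1523,760,19), (3723,465,31), (4714,1178,31), (68079,5673,61)]), (59, [(123,60,3), (118,58,2),
   (118,58,29), (7082,1770,59)])]),
   (67, [(2, [(4,2,2)]), (3, [(135,22,2), (6,3,3), (4,2,2), (15,6,3), (35,16,2), (146,36,3)]), (5,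
   [(135,22,2), (10,4,2), (6,3,3), (17,8,2), (35,16,2), (99,42,7), (226,112,7), (423,35,5),
   (482,120,5)]), (7, [(14,3,3)]), (11, [(135,66,3), (135,66,11), (2906,484,11)]), (13, [(135,66,2),
   (135,66,3), (26,12,2), (26,12,3), (314,13,13)]), (17, [(135,33,3), (34,2,2), (614,306,17)]), (19,
   [(135,33,3), (38,18,2), (38,18,3), (5,2,2), (19,9,3), (35,8,2), (63,15,5), (82,40,5), (254,126,7),
   (1046,522,29), (1523,380,19), (1683,812,29), (2206,551,19)]), (23, [(135,33,3), (135,33,11),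
   (46,22,2), (5,2,2), (6,3,3), (8847,2211,67)]), (29, [(58,14,2), (58,14,7), (5,2,2), (6,3,3),
   (10,4,2), (17,8,2), (63,10,5), (82,40,5), (2043,510,17), (3946,116,29)]), (31, [(135,66,2),
   (62,3,3), (32,8,2), (2979,744,31), (3226,1612,31)]), (37, [(135,3,3), (74,18,2), (74,18,3),
   (35,16,2), (99,21,7), (142,70,5), (226,112,2), (363,90,5), (8042,67,67), (8579,2144,67)]), (41,
   [(135,66,3), (82,40,2), (82,40,5), (3446,861,41)]), (43, [(135,22,2), (135,22,11), (86,21,3),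
   (4,2,2), (8847,2211,67)]), (47, [(94,46,2), (94,46,23)]), (53, [(135,22,2), (135,22,11),
   (106,52,2), (6,3,3), (17,8,2), (63,30,5), (82,40,2), (4022,402,67), (6435,1608,67)]), (59,
   [(118,58,2), (118,58,29), (5,2,2), (6,3,3), (15,6,3), (7082,3540,59)]), (61, [(135,66,2),
   (135,66,3), (135,66,11), (122,60,2), (122,60,3), (8847,4422,67)])]),
   (71, [(2, [(4,2,2)]), (3, [(6,2,2)]), (5, [(143,5,5), (10,5,5), (423,35,7), (1262,315,7),
   (1767,126,2), (4443,370,37), (7402,1850,5)]), (7, [(143,70,2), (143,70,5), (14,7,7), (4,2,2),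
   (7,3,3), (1767,98,7), (2942,735,7)]), (11, [(143,70,2), (143,70,5), (143,70,7)]), (13,
   [(143,70,2), (26,12,2), (26,12,3), (7,3,3), (314,39,13)]), (17, [(34,16,2), (9,4,2), (10,5,5),
   (423,210,3), (614,153,17)]), (19, [(38,18,2), (38,18,3), (5,2,2), (7,3,3), (19,9,3), (398,198,11),
   (839,418,19), (914,456,19)]), (23, [(143,14,2), (46,11,11), (4,2,2), (19,6,3), (26,12,3),
   (3315,828,23), (3866,161,23)]), (29, [(143,35,5), (143,35,7), (58,14,2), (19,6,3), (26,12,3),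
   (10227,2556,71)]), (31, [(143,70,2), (62,15,3), (62,15,5), (4,2,2), (7,3,3), (14,7,7), (38,18,3),
   (59,28,2), (147,72,2), (256,32,2), (662,165,11), (707,352,11), (5458,2728,31)]), (37, [(143,7,7),
   (74,9,3), (10227,2556,71)]), (41, [(82,40,2), (82,40,5), (19,6,3), (3446,82,41)]), (43,
   [(143,35,5), (143,35,7), (86,42,2), (86,42,3), (5,2,2), (19,9,3), (22,5,5), (398,198,11),
   (839,209,19), (5398,2698,71), (8523,710,71)]), (47, [(94,23,23)]), (53, [(143,70,2), (143,70,5),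
   (143,70,7), (54,6,3), (10227,852,71)]), (59, [(143,70,2), (118,29,29), (4,2,2), (19,6,3),
   (7082,3540,59)]), (61, [(143,70,2), (143,70,5), (143,70,7), (122,60,3), (10227,5112,71)]), (67,
   [(143,70,2), (134,33,3), (134,33,11), (4,2,2), (7,3,3), (8846,737,67)])]),
   (73, [(2, [(147,9,3), (4,2,2), (75,36,2), (218,27,3), (363,180,5), (662,110,11), (795,44,11),
   (1762,880,2)]), (3, [(147,12,2), (147,12,3), (6,3,3), (16,8,2), (195,48,2), (1154,576,3)]), (5,
   [(147,72,3), (10,4,2), (62,30,5)]), (7, [(147,24,2), (147,24,3), (14,6,2), (14,6,3), (86,42,7)]),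
   (11, [(147,72,2), (147,72,3), (22,10,2), (22,10,5), (6,3,3), (32,16,2), (227,56,7), (254,21,7),
   (2234,1116,31), (2607,62,31), (3446,574,41), (5415,902,11), (5458,2728,11)]), (13, [(147,72,2),
   (147,72,3), (26,4,2), (314,156,13)]), (17, [(147,24,3), (34,16,2), (614,306,17)]), (19,
   [(147,36,2), (147,36,3), (38,9,3), (4,2,2), (8,4,2), (83,40,5), (98,42,7), (302,50,5),
   (759,189,3), (3803,95,19), (4106,342,19)]), (23, [(147,36,2), (46,11,11), (6,3,3), (8,4,2),
   (32,16,2), (83,10,5), (227,112,7), (6075,1518,23), (6442,1610,23)]), (29, [(147,72,2), (147,72,3),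
   (58,28,2), (58,28,7), (6,3,3), (15,7,7), (16,8,2), (54,27,3), (83,40,5), (134,33,11), (195,96,2),
   (219,54,3), (226,16,2), (30627,7656,29), (31322,15660,29)]), (31, [(147,72,2), (147,72,3),
   (62,30,2), (62,30,3), (62,30,5), (16,8,2), (662,110,11), (707,352,11), (5458,2728,31)]), (37,
   [(147,9,3), (74,2,2), (5,2,2), (6,3,3), (62,30,5), (123,20,2), (134,33,11), (243,55,11),
   (2554,638,29), (25407,6351,73)]), (41, [(147,18,3), (82,4,2), (3446,574,41)]), (43, [(147,24,2),
   (86,42,2), (86,42,3), (86,42,7), (15,7,7), (22,10,5), (63,30,5), (250,100,5), (4762,2380,17),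
   (5103,850,17), (11698,731,43)]), (47, [(147,72,2), (147,72,3), (94,46,2), (94,46,23), (6,3,3),
   (2855,1426,31), (21578,10788,29), (25407,6351,73)]), (53, [(147,72,2), (147,72,3), (106,52,2),
   (6,3,3), (34,16,2), (54,27,3), (83,40,5), (219,108,3), (486,243,3), (975,243,3), (3566,594,11),
   (30627,3828,29), (31322,15660,29), (25407,219,73)]), (59, [(147,72,3), (118,58,2), (118,58,29),
   (7082,885,59)]), (61, [(147,36,2), (147,36,3), (122,15,3), (122,15,5), (4,2,2), (8,4,2), (11,5,5),
   (422,21,7), (1046,29,29), (49535,12383,61), (734,183,61)]), (67, [(147,36,2), (147,36,3),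
   (134,33,3), (134,33,11), (8846,4422,67)]), (71, [(147,18,3), (142,35,5), (142,35,7),
   (10226,284,71)])]),
   (79, [(2, [(4,2,2)]), (3, [(159,78,2), (159,78,3), (4,2,2), (11,4,2), (146,36,3)]), (5,
   [(159,39,3), (10,2,2), (62,30,5)]), (7, [(14,3,3)]), (11, [(159,39,3), (22,10,2), (22,10,5),
   (5,2,2), (6,3,3), (18,9,3), (87,7,7), (795,99,11), (926,231,11)]), (13, [(159,39,3), (159,39,13),
   (6,3,3), (15,2,2), (87,21,7), (9466,2366,13)]), (17, [(159,26,2), (34,16,2), (6,3,3), (15,6,3),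
   (614,51,17)]), (19, [(38,18,2), (38,18,3), (17,4,2), (19,9,3), (1046,174,29), (2207,1102,19),
   (2434,304,19)]), (23, [(159,3,3), (46,22,2), (46,22,11), (5,2,2), (6,3,3), (26,13,13), (87,21,7),
   (142,35,7), (263,130,5), (2579,23,23), (2762,138,23)]), (29, [(159,78,2), (159,78,3), (159,78,13),
   (58,28,2), (6,3,3), (12327,6162,79)]), (31, [(159,39,3), (159,39,13)]), (37, [(159,78,2),
   (159,78,3), (159,78,13), (74,36,2), (74,36,3), (12327,237,79)]), (41, [(159,26,2), (82,8,2),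
   (6,3,3), (11,5,5), (22,10,5), (63,15,3), (3446,246,41)]), (43, [(159,78,2), (159,78,3), (86,3,3),
   (4,2,2), (11,4,2), (278,23,23), (4695,2346,17), (11698,5848,43)]), (47, [(159,78,2), (159,78,3),
   (94,23,23), (4,2,2), (6,3,3), (11,4,2), (18,9,3), (34,16,2), (39,9,3), (54,27,3), (83,40,5),
   (87,7,7), (219,108,3), (1402,700,5), (4703,2350,47), (5078,2538,47)]), (53, [(159,78,2),
   (159,78,3), (159,78,13), (106,52,2), (6,3,3), (12327,237,79)]), (59, [(159,78,3), (118,29,29),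
   (7082,590,59)]), (61, [(159,26,2), (159,26,13), (122,60,2), (122,60,3), (12327,6162,79)]), (67,
   [(134,66,2), (134,66,3), (134,66,11), (5,2,2), (7,3,3), (8846,2211,67)]), (71, [(159,26,2),
   (142,35,5), (142,35,7), (4,2,2), (18,9,3), (39,18,3), (10226,5112,71)]), (73, [(159,39,3),
   (159,39,13), (146,36,2), (146,36,3), (12327,474,79)])]),
   (83, [(2, [(4,2,2)]), (3, [(6,2,2), (5,2,2), (15,6,3), (26,4,2), (107,52,13), (158,39,3)]), (5,
   [(10,4,2), (15,6,3), (62,30,5)]), (7, [(14,2,2), (5,2,2), (7,3,3), (86,21,7)]), (11, [(22,10,2),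
   (22,10,5), (5,2,2), (15,3,3), (18,6,3), (423,35,7), (663,330,11), (926,154,11)]), (13, [(26,4,2),
   (7,3,3), (107,13,13), (158,39,13)]), (17, [(34,8,2), (15,6,3), (614,153,17)]), (19, [(167,82,2),
   (167,82,41), (38,3,3), (4,2,2), (7,3,3), (19,9,3), (98,14,7), (227,112,7), (1478,738,41),
   (3119,1558,19), (3194,1596,19)]), (23, [(46,22,2), (46,22,11), (5,2,2), (15,3,3), (18,6,3),
   (135,33,11), (12146,6072,23)]), (29, [(167,41,41), (58,7,7), (5578,2788,17), (16323,8160,2),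
   (16323,8160,17), (3946,986,29)]), (31, [(62,30,2), (62,30,3), (62,30,5), (5,2,2), (16,4,2),
   (27,4,2), (32,8,2), (1763,880,11), (5458,2728,31)]), (37, [(167,41,41), (74,9,3), (39,2,2),
   (735,183,3), (735,183,61), (1466,366,2), (1478,738,41), (1642,820,2), (1642,820,5), (2463,615,5),
   (3119,1558,19), (4323,720,2), (15506,2584,17), (2519,629,37), (2962,148,37)]), (41, [(167,41,41),
   (3504682,1752340,2), (9,4,2), (27,12,3), (3986,996,83), (5315,664,83)]), (43, [(167,82,2),
   (86,21,3), (86,21,7), (4,2,2), (7,3,3), (22,10,5), (26,4,2), (51,4,2), (74,9,3), (227,112,2),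
   (386,96,2), (1227,51,17), (1294,323,19), (1523,760,19), (9635,602,43), (9806,2451,43)]), (47,
   [(167,82,2), (94,23,23), (4,2,2), (15,6,3), (16,4,2), (18,6,3), (32,8,2), (39,9,3), (54,18,3),
   (122,15,5), (147,72,2), (206,51,17), (275,136,17), (363,180,5), (423,105,7), (478,119,7),
   (5267,188,47), (7522,470,47)]), (53, [(167,82,2), (106,4,2), (9,4,2), (15,3,3), (18,6,3),
   (562,280,5), (663,165,11), (794,66,11), (46643,11660,53), (214,53,53)]), (59, [(118,58,2),
   (118,58,29), (15,6,3), (7082,236,59)]), (61, [(122,15,3), (122,15,5), (39,9,3), (735,183,61),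
   (1466,366,61)]), (67, [(167,82,2), (134,33,3), (134,33,11), (4,2,2), (7,3,3), (8846,2211,67)]),
   (71, [(167,82,2), (142,35,5), (142,35,7), (16,4,2), (27,12,3), (10226,5112,71)]), (73,
   [(167,82,2), (146,8,2), (7,3,3), (33,16,2), (74,9,3), (226,14,7), (255,21,7), (422,15,5),
   (663,110,11), (30626,2552,29), (31323,15660,29), (25406,12702,73)]), (79, [(167,82,2),
   (167,82,41), (158,39,3), (4,2,2), (10,4,2), (19,9,3), (27,13,13), (32,8,2), (35,16,2), (74,9,3),
   (262,130,5), (663,33,11), (1227,204,17), (1838,459,17), (2519,629,37), (2738,333,37),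
   (10958,5478,83), (12287,3071,83)])]),
   (89, [(2, [(4,2,2), (11,4,2), (19,6,3), (26,12,2)]), (3, [(6,2,2)]), (5, [(10,2,2), (19,6,3),
   (62,10,5)]), (7, [(179,88,2), (14,6,2), (14,6,3), (7,3,3), (86,42,7)]), (11, [(179,22,2),
   (179,22,11), (4,2,2), (19,6,3), (2906,1452,11)]), (13, [(26,12,2), (26,12,3)]), (17, [(179,44,2),
   (179,44,11), (34,4,2), (46,22,11), (135,33,3), (614,153,17)]), (19, [(179,88,2), (179,88,11),
   (38,18,2), (38,18,3), (8,4,2), (459,57,19), (838,38,19)]), (23, [(179,88,2), (46,22,2),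
   (46,22,11), (8,4,2), (19,6,3), (26,12,3), (55,18,3), (74,36,3), (363,180,5), (422,70,5),
   (1383,138,23), (1658,276,23)]), (29, [(179,88,2), (58,28,2), (58,28,7), (19,6,3), (467,58,29),
   (698,348,29)]), (31, [(179,88,2), (179,88,11), (62,10,2), (62,10,5), (7,3,3), (14,6,3),
   (747,62,31), (1366,682,31)]), (37, [(179,8,2), (74,36,2), (74,36,3), (7,3,3), (16,8,2), (62,10,5),
   (83,5,5), (5342,267,89), (7479,1246,89)]), (41, [(82,40,2), (82,40,5), (19,6,3), (3446,123,41)]),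
   (43, [(179,88,2), (86,42,2), (86,42,3), (86,42,7), (22,11,11), (2247,187,17), (11698,2924,43)]),
   (47, [(179,44,2), (179,44,11), (26,12,3), (16023,890,89)]), (53, [(179,44,2), (179,44,11),
   (54,6,3), (16023,8010,89)]), (59, [(118,58,2), (118,58,29), (19,6,3), (7082,3540,59)]), (61,
   [(179,88,2), (179,88,11), (122,20,2), (7,3,3), (11,5,5), (14,6,3), (422,70,7), (14242,3560,89),
   (14955,2492,89)]), (67, [(179,11,11), (134,11,11), (5060135,115003,7), (40966,20482,2), (5,2,2),
   (7,3,3), (8846,4422,67)]), (71, [(179,44,2), (142,35,5), (142,35,7), (4,2,2), (63,15,3),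
   (10226,639,71)]), (73, [(179,22,2), (179,22,11), (146,9,3), (16023,4005,89)]), (79, [(179,44,2),
   (158,13,13), (4,2,2), (7,3,3), (12326,3081,79)]), (83, [(179,88,2), (179,88,11), (14,6,3),
   (16023,4005,89)])]),
   (97, [(2, [(195,48,2), (10,4,2)]), (3, [(195,48,2), (6,3,3), (4,2,2), (8,4,2), (75,18,3),
   (99,42,7), (254,126,3)]), (5, [(195,96,3), (10,4,2), (62,5,5)]), (7, [(14,2,2)]), (11,
   [(195,48,2), (22,5,5), (4,2,2), (6,3,3), (135,66,11), (178,11,11)]), (13, [(195,96,2), (195,96,3),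
   (26,12,2), (26,12,3), (314,156,13)]), (17, [(195,96,3), (34,16,2), (614,51,17)]), (19,
   [(195,32,2), (38,18,2), (38,18,3), (16,8,2), (467,29,29), (8818,551,19)]), (23, [(195,96,2),
   (195,96,3), (46,22,2), (46,22,11), (6,3,3), (279,46,23), (554,276,23)]), (29, [(195,96,2),
   (195,96,3), (58,28,2), (58,28,7), (16,8,2), (467,58,29), (698,348,29)]), (31, [(195,48,2),
   (195,48,3), (62,5,5), (4,2,2), (6,3,3), (135,66,11), (5458,2728,31)]), (37, [(195,96,2),
   (195,96,3), (74,12,2), (74,12,3), (86,7,7), (31083,1110,37), (33302,8325,37)]), (41, [(195,96,3),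
   (82,40,2), (82,40,5), (3446,574,41)]), (43, [(195,24,2), (195,24,3), (86,7,7), (4,2,2), (6,3,3),
   (15,7,7), (22,5,5), (63,30,5), (4762,595,17), (5103,850,17), (11698,5848,43)]), (47, [(195,8,2),
   (94,23,23), (4,2,2), (8,4,2), (15,6,3), (1883,235,47), (2258,47,47)]), (53, [(195,48,2),
   (195,48,3)]), (59, [(195,96,3), (118,58,2), (118,58,29), (7082,1770,59)]), (61, [(195,3,3),
   (122,30,2), (122,30,3), (122,30,5), (5,2,2), (23,10,5), (26,12,2), (75,36,2), (75,36,3),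
   (82,40,2), (135,66,11), (242,55,11), (3722,310,31), (5459,341,31), (68078,5673,61)]), (67,
   [(195,32,2), (134,6,2), (134,6,3), (7,3,3), (8846,4422,67)]), (71, [(195,96,2), (195,96,3),
   (142,14,2), (6,3,3), (8,4,2), (11,5,5), (279,69,23), (554,276,23), (7762,1940,97),
   (8927,2231,97)]), (73, [(195,24,2), (195,24,3), (146,12,2), (146,12,3), (16,8,2), (467,232,29),
   (25406,2117,73)]), (79, [(195,16,2), (158,13,13), (4,2,2), (15,3,3), (12326,6162,79)]), (83,
   [(195,96,2), (195,96,3), (166,82,2), (166,82,41), (6,3,3), (99,14,7), (226,14,7), (279,69,23),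
   (554,276,23), (106907,1909,83), (334,83,83)]), (89, [(195,16,2), (178,11,11), (4,2,2), (15,6,3),
   (16022,1602,89)])]),
   (101, [(2, [(203,100,2), (203,100,5), (82,40,2)]), (3, [(203,100,2), (203,100,5), (6,2,2),
   (122,12,3)]), (5, [(203,25,5), (10,5,5), (63,3,3), (302,50,5)]), (7, [(203,100,2), (14,6,2),
   (14,6,3), (7,3,3), (86,21,7)]), (11, [(203,100,2), (22,10,2), (22,10,5), (16,8,2), (179,22,11),
   (398,66,11)]), (13, [(203,50,2), (26,6,2), (26,6,3), (7,3,3), (314,13,13)]), (17, [(203,10,2),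
   (34,2,2), (18,6,3), (27,6,3), (614,51,17)]), (19, [(203,25,5), (38,9,3), (302,50,2), (302,50,5),
   (983,490,7), (1822,910,13), (2343,585,13), (3202,1600,2), (13683,57,19), (13834,3458,19)]), (23,
   [(203,50,2), (203,50,5), (46,11,11), (4,2,2), (8,4,2), (35,16,2), (50,25,5), (122,12,3),
   (219,36,3), (422,21,7), (2234,558,31), (2607,651,31), (2763,690,23), (2854,713,23)]), (29,
   [(203,100,5), (58,28,2), (58,28,7), (35,16,2), (82,40,2), (143,35,7), (179,88,11), (226,112,2),
   (1859,464,29), (2554,319,29)]), (31, [(203,25,5), (62,5,5), (22,10,2), (35,16,2), (64,32,2),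
   (179,88,11), (5458,2728,31)]), (37, [(203,25,5), (74,6,3), (20607,10302,101)]), (41, [(203,20,2),
   (82,40,2), (82,40,5), (14,6,3), (19,6,3), (3446,861,41)]), (43, [(203,50,2), (203,50,5),
   (86,21,3), (86,21,7), (4,2,2), (7,3,3), (8,4,2), (19,9,3), (35,8,2), (82,40,2), (1907,952,17),
   (2042,68,17), (6158,1539,19), (8435,4216,31), (9807,4902,43), (10666,2666,43)]), (47, [(203,50,2),
   (203,50,5), (4,2,2), (8,4,2), (16,8,2), (22,10,5), (35,4,2), (83,40,2), (194,24,3), (219,108,3),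
   (2426,101,101), (7275,909,101)]), (53, [(203,100,2), (203,100,5), (18,6,3), (20607,10302,101)]),
   (59, [(203,100,2), (118,58,2), (118,58,29), (10,5,5), (63,15,3), (7082,885,59)]), (61,
   [(203,100,2), (203,100,5), (122,12,2), (122,12,3), (7,3,3), (10,5,5), (19,9,3), (35,16,2),
   (422,21,7), (482,80,2), (675,336,7), (14643,1220,61), (15374,2562,61)]), (67, [(203,100,2),
   (134,66,2), (134,66,3), (134,66,11), (7,3,3), (8846,737,67)]), (71, [(203,25,5), (142,7,7),
   (10,5,5), (63,15,3), (10226,1704,71)]), (73, [(203,100,2), (203,100,5), (146,72,3),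
   (20607,10302,101)]), (79, [(158,13,13), (315,52,2), (315,52,13), (626,312,2), (626,312,3),
   (1875,72,3), (12326,6162,79)]), (83, [(203,100,2), (203,100,5), (14,6,3), (20607,10302,101)]),
   (89, [(203,100,2), (178,8,2), (18,6,3), (27,12,3), (16022,1602,89)]), (97, [(203,25,5),
   (194,24,3), (20607,10302,101)])]),
   (103, [(2, [(4,2,2)]), (3, [(207,34,2), (6,3,3), (4,2,2), (15,6,3), (39,18,3), (74,12,2),
   (195,48,2), (1154,576,3)]), (5, [(207,102,3), (10,4,2), (62,15,5)]), (7, [(207,51,3), (14,6,2),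
   (14,6,3), (5,2,2), (86,21,7)]), (11, [(207,102,2), (207,102,3), (22,5,5), (6,3,3), (18,9,3),
   (63,30,5), (74,12,2), (195,48,2), (255,63,7), (422,105,7), (482,80,2), (1235,308,11),
   (1322,132,11)]), (13, [(26,2,2), (5,2,2), (14,6,3), (39,18,3), (314,52,13)]), (17, [(207,51,3),
   (207,51,17), (34,17,17), (614,51,3), (818,68,2), (2123,212,2), (2123,212,53), (2722,272,2),
   (6998,3498,11), (6998,3498,53), (7143,119,7), (10475,1309,11), (12723,1272,2), (13358,3339,3),
   (13467,1683,3), (14258,7128,3), (14786,1056,2), (16707,8352,29), (31215,7803,17),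
   (33526,8381,17)]), (19, [(207,51,17), (38,6,2), (38,6,3), (5,2,2), (159,39,13), (262,130,5),
   (1143,570,19), (1294,38,19)]), (23, [(46,22,2), (46,22,11), (5,2,2), (6,3,3), (15,3,3),
   (135,33,11), (12146,2024,23)]), (29, [(207,51,3), (207,51,17), (58,7,7), (26,2,2), (134,33,3),
   (159,78,2), (3946,493,29)]), (31, [(207,34,2), (62,15,3), (62,15,5), (4,2,2), (7,3,3), (27,4,2),
   (64,8,2), (147,72,2), (256,32,2), (662,165,11), (707,352,11), (5458,2728,31)]), (37, [(207,34,2),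
   (74,12,2), (74,12,3), (7,3,3), (62,15,5), (134,33,11), (48843,4070,37), (298,74,37)]), (41,
   [(82,20,2), (82,20,5), (5,2,2), (6,3,3), (1143,114,19), (2463,615,41), (3118,1558,41)]), (43,
   [(207,102,2), (207,102,3), (207,102,17)]), (47, [(207,6,2), (207,6,3), (94,23,23), (4,2,2),
   (6,3,3), (18,9,3), (27,4,2), (32,4,2), (64,8,2), (122,15,5), (147,72,2), (363,180,5), (482,80,2),
   (867,432,2), (25947,6486,47), (27074,13536,47)]), (53, [(106,52,2), (106,52,13), (33,16,2),
   (2123,265,53), (3394,848,53)]), (59, [(207,51,3), (118,58,2), (118,58,29), (7082,3540,59)]), (61,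
   [(122,15,3), (122,15,5), (7,3,3), (23,10,2), (23,10,5), (194,12,2), (262,130,13), (315,156,2),
   (422,105,7), (1046,522,29), (1322,132,11), (1683,812,29), (26843,3355,61), (28306,14152,61)]),
   (67, [(207,102,2), (207,102,3), (134,33,3), (134,33,11), (8846,402,67)]), (71, [(207,102,3),
   (142,7,7), (10226,1278,71)]), (73, [(146,24,2), (146,24,3), (7,3,3), (9,4,2), (65,32,2),
   (82,20,5), (1143,570,19), (2434,64,2), (16707,8352,29), (25406,12702,73)]), (79, [(158,6,2),
   (158,6,3), (5,2,2), (7,3,3), (12326,1027,79)]), (83, [(207,51,3), (166,82,2), (166,82,41),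
   (5,2,2), (6,3,3), (17,4,2), (18,9,3), (106,52,2), (159,39,13), (195,96,2), (255,126,7),
   (386,192,2), (394,196,7), (687,98,7), (1235,77,11), (1718,143,11), (1822,455,5), (1983,990,5),
   (16707,8352,29), (17054,8526,29), (20999,362,181), (21722,181,181), (60095,30046,83),
   (334,166,83)]), (89, [(207,34,2), (207,34,17), (178,88,2), (6,3,3), (15,6,3), (18,9,3), (54,27,3),
   (255,42,7), (8654,4326,103), (11127,927,103)]), (97, [(207,51,3), (207,51,17), (194,12,2),
   (194,12,3), (5,2,2), (9,4,2), (17,8,2), (466,232,29), (699,348,29), (103706,51852,149),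
   (2387,1192,149), (184166,92082,103), (1239,618,103)]), (101, [(207,102,3), (202,100,2),
   (202,100,5), (20606,5151,101)])]),
   (107, [(2, [(4,2,2)]), (3, [(6,2,2)]), (5, [(10,4,2)]), (7, [(215,106,2), (14,3,3), (4,2,2),
   (7,3,3), (86,7,7)]), (11, [(22,10,2), (22,10,5), (5,2,2), (19,6,3), (38,6,3), (63,30,5),
   (399,22,11), (662,330,11)]), (13, [(26,3,3), (255,63,3), (255,63,7), (1094,26,13)]), (17,
   [(34,16,2), (55,6,3), (614,153,17)]), (19, [(38,6,2), (38,6,3), (5,2,2), (7,3,3), (10,4,2),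
   (459,57,19), (914,114,19)]), (23, [(46,22,2), (46,22,11), (5,2,2), (19,6,3), (135,33,11),
   (5063,230,23), (6074,46,23)]), (29, [(58,7,7), (87,42,2), (87,42,3), (134,11,11), (542,270,2),
   (542,270,3), (542,270,5), (663,330,5), (802,400,2), (802,400,5), (1203,600,5), (3747,624,13),
   (3902,1950,13), (36195,9048,29), (118,29,29)]), (31, [(215,106,2), (62,15,3), (62,15,5), (4,2,2),
   (27,4,2), (399,99,11), (5458,2728,31)]), (37, [(74,9,3), (15,3,3), (27,12,2), (38,6,2), (62,15,5),
   (203,25,5), (6002,3000,5), (55503,4625,37), (298,37,37)]), (41, [(82,10,2), (82,10,5), (19,6,3),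
   (3446,1722,41)]), (43, [(215,106,2), (86,7,7), (4,2,2), (7,3,3), (22,10,5), (26,3,3), (59,28,2),
   (59,28,7), (63,30,5), (203,50,5), (302,50,5), (4762,1190,17), (5103,850,17), (11698,5848,43)]),
   (47, [(94,46,2), (94,46,23), (5,2,2), (16,4,2), (19,6,3), (32,8,2), (51,20,5), (62,15,3),
   (315,39,13), (459,228,19), (28654,7163,29), (65427,4089,47), (566,282,47)]), (53, [(215,53,53),
   (283658,47276,2), (5,2,2), (9,4,2), (51,20,5), (122,30,3), (163,6,3), (315,156,13),
   (53666,2236,43), (347,172,43), (110426,27606,107), (1287,321,107)]), (59, [(215,106,2),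
   (118,29,29), (4,2,2), (19,6,3), (7082,885,59)]), (61, [(122,30,2), (122,30,3), (122,30,5),
   (7,3,3), (9,4,2), (19,9,3), (146,72,2), (459,19,19), (722,114,19), (55635,13908,61),
   (734,61,61)]), (67, [(215,106,2), (134,11,11), (4,2,2), (7,3,3), (8846,1474,67)]), (71,
   [(215,106,2), (142,35,5), (142,35,7), (4,2,2), (16,4,2), (23,5,5), (55,6,3), (62,15,3),
   (163,18,3), (459,114,19), (722,114,19), (5399,2698,71), (8522,4260,71)]), (73, [(215,106,2),
   (146,72,2), (146,72,3), (7,3,3), (315,156,13), (11338,1417,109), (12647,6322,29),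
   (25406,6351,73)]), (79, [(158,78,2), (158,78,3), (158,78,13), (5,2,2), (7,3,3), (12326,6162,79)]),
   (83, [(166,82,2), (166,82,41), (5,2,2), (14,3,3), (27,4,2), (55,18,3), (74,9,3), (163,54,3),
   (218,36,2), (315,156,13), (542,270,5), (843,420,5), (1479,738,41), (2602,1300,5),
   (24903,12450,83), (27226,13612,83)]), (89, [(178,44,2), (178,44,11), (55,6,3), (16022,4005,89)]),
   (97, [(194,96,2), (194,96,3)]), (101, [(202,10,2), (202,10,5), (19,6,3), (20606,303,101)]), (103,
   [(215,106,2), (215,106,53), (206,51,3), (4,2,2), (7,3,3), (16,4,2), (51,20,5), (62,15,5),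
   (399,11,11), (662,330,11), (98343,24585,149), (127546,31886,107), (1287,214,107)])]),
   (109, [(2, [(219,36,2), (219,36,3), (26,4,2)]), (3, [(219,27,3), (6,3,3), (15,6,2), (38,18,3)]),
   (5, [(219,27,3), (10,2,2), (62,5,5)]), (7, [(219,27,3), (14,3,3), (38,18,2), (123,60,2),
   (123,60,5), (562,7,7)]), (11, [(219,108,2), (219,108,3), (22,2,2), (6,3,3), (11,5,5), (16,8,2),
   (62,5,5), (387,64,2), (2643,165,11), (2818,1408,11)]), (13, [(219,108,2), (219,108,3), (26,4,2),
   (314,39,13)]), (17, [(219,36,3), (34,16,2), (614,153,17)]), (19, [(219,36,2), (219,36,3),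
   (38,18,2), (38,18,3), (23,10,5), (50,10,5), (383,190,19), (458,76,19)]), (23, [(219,36,2),
   (219,36,3), (46,22,2), (46,22,11), (8,4,2), (18,9,3), (3315,828,23), (3866,966,23)]), (29,
   [(219,54,2), (219,54,3), (58,14,2), (58,14,7), (26,4,2), (1907,238,17), (3946,1972,29)]), (31,
   [(219,54,2), (219,54,3), (62,5,5), (8,4,2), (16,8,2), (27,4,2), (662,165,11), (707,352,11),
   (5458,682,31)]), (37, [(219,108,2), (219,108,3), (74,36,2), (74,36,3), (23,5,5), (134,22,11),
   (243,55,11), (1202,200,5), (2554,319,29), (2903,1450,29), (64382,5365,37)]), (41, [(219,12,3),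
   (82,8,2), (3446,861,41)]), (43, [(219,18,2), (219,18,3), (86,21,3), (86,21,7), (4,2,2), (11,4,2),
   (15,7,7), (50,10,5), (6023,3010,43), (7226,903,43)]), (47, [(219,108,2), (219,108,3), (94,46,2),
   (94,46,23), (6,3,3), (23,5,5), (50,10,5), (383,190,19), (458,76,19), (838,418,11), (1323,330,11),
   (3575,1786,47), (4138,2068,47)]), (53, [(219,108,2), (219,108,3), (106,52,2), (18,9,3), (23,5,5),
   (50,10,5), (147,72,2), (482,240,2), (486,243,3), (562,7,7), (975,243,3), (2643,33,11),
   (3566,1782,11), (28778,2398,109), (33575,16786,109)]), (59, [(219,108,3), (118,58,2), (118,58,29),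
   (7082,3540,59)]), (61, [(219,54,2), (219,54,3), (122,6,2), (122,6,3), (11,5,5), (18,9,3),
   (26,4,2), (62,5,5), (75,36,2), (82,8,2), (194,16,2), (422,35,7), (675,336,7), (14643,1220,61),
   (15374,7686,61)]), (67, [(219,108,2), (219,108,3), (134,22,2), (134,22,11), (8846,201,67)]), (71,
   [(219,18,3), (142,35,5), (142,35,7), (10226,5112,71)]), (73, [(219,27,3), (146,18,2), (146,18,3),
   (5,2,2), (23,10,5), (262,65,13), (315,156,13), (387,192,2), (482,240,2), (11338,2834,109),
   (13955,6976,109)]), (79, [(219,108,2), (219,108,3), (158,78,2), (23,10,5), (794,396,11),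
   (2182,545,109), (4799,1199,109)]), (83, [(219,54,2), (219,54,3), (4,2,2), (6,3,3), (11,4,2),
   (23,10,5), (106,52,13), (159,39,13), (662,165,11), (19935,9966,151), (23558,5889,151),
   (131675,65836,109)]), (89, [(219,27,3), (178,44,2), (178,44,11), (16022,8010,89)]), (97,
   [(219,27,3), (194,16,2), (5,2,2), (6,3,3), (9,4,2), (23,5,5), (50,10,5), (383,95,19), (458,76,19),
   (110583,9215,97), (778,388,97)]), (101, [(219,12,3), (202,100,2), (202,100,5),
   (20606,10302,101)]), (103, [(219,108,2), (219,108,3), (206,102,2), (23,5,5), (50,10,5),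
   (70634,2943,109), (2183,1090,109)]), (107, [(219,36,2), (219,36,3), (214,106,2), (214,106,53),
   (8,4,2), (50,10,5), (254,126,7), (1907,952,17), (2042,1020,17), (36383,18190,107),
   (1286,642,107)])]),
   (113, [(2, [(227,28,2), (10,4,2)]), (3, [(227,112,2), (6,2,2), (39,18,3), (74,36,3)]), (5,
   [(10,4,2), (39,9,3), (62,15,5)]), (7, [(227,14,2), (14,7,7), (4,2,2), (7,3,3), (8,4,2), (11,4,2),
   (26,3,3), (50,20,5), (63,15,5), (395,98,7), (982,98,7)]), (11, [(227,56,2), (22,5,5), (4,2,2),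
   (8,4,2), (11,5,5), (39,3,3), (62,15,3), (1383,138,23), (2026,253,11)]), (13, [(227,56,2),
   (26,3,3), (4,2,2), (7,3,3), (314,39,13)]), (17, [(227,112,2), (34,16,2), (18,6,3), (27,6,3),
   (614,51,17)]), (19, [(227,112,2), (38,2,2), (8,4,2), (362,60,5), (1523,380,19), (2434,304,19)]),
   (23, [(227,112,2), (227,112,7), (46,22,2), (46,22,11), (39,9,3), (54,18,3), (142,70,5),
   (1383,138,23), (1658,828,23)]), (29, [(227,112,2), (58,28,2), (58,28,7), (39,18,3), (54,18,3),
   (1047,261,29), (1858,464,29)]), (31, [(227,56,2), (62,15,3), (62,15,5), (4,2,2), (7,3,3),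
   (32,16,2), (662,165,11), (707,352,11), (5458,2728,31)]), (37, [(227,112,2), (74,36,2), (74,36,3),
   (7,3,3), (62,15,5), (83,5,5), (274,136,17), (2519,629,37), (2962,1480,37)]), (41, [(82,10,2),
   (82,10,5), (39,18,3), (3446,861,41)]), (43, [(227,112,2), (227,112,7), (86,14,2), (86,14,7),
   (7,3,3), (22,5,5), (26,3,3), (63,30,5), (250,100,5), (4762,1190,17), (5103,850,17),
   (11698,5848,43)]), (47, [(227,112,2), (227,112,7), (94,46,2), (94,46,23), (8,4,2), (26,3,3),
   (39,9,3), (58,28,7), (122,10,5), (143,70,5), (1042,260,13), (1095,39,13), (13163,3290,47),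
   (14666,7332,47)]), (53, [(227,28,2), (227,28,7), (106,26,2), (54,18,3), (1047,87,29),
   (26218,3277,113), (32547,16272,113)]), (59, [(118,58,2), (118,58,29), (39,18,3), (7082,3540,59)]),
   (61, [(227,56,2), (122,10,2), (122,10,5), (7,3,3), (8,4,2), (26,3,3), (1467,183,61),
   (1954,976,61)]), (67, [(227,112,2), (134,66,2), (134,66,3), (134,66,11), (7,3,3), (8846,67,67)]),
   (71, [(227,16,2), (142,70,2), (142,70,5), (142,70,7), (18,6,3), (27,12,3), (10226,426,71)]), (73,
   [(146,72,2), (146,72,3), (7,3,3), (1047,29,29), (25406,12702,73)]), (79, [(227,112,2), (158,78,2),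
   (158,78,3), (158,78,13), (7,3,3), (12326,3081,79)]), (83, [(227,14,2), (166,41,41), (4,2,2),
   (8,4,2), (11,4,2), (14,7,7), (26,3,3), (39,3,3), (106,26,13), (263,130,5), (422,35,5),
   (503,125,5), (13275,6636,79), (15802,1975,79), (78687,13114,83), (334,166,83)]), (89,
   [(227,112,2), (178,88,2), (178,88,11), (18,6,3), (27,12,3), (16022,2670,89)]), (97, [(227,14,2),
   (227,14,7), (194,12,2), (194,12,3), (7,3,3), (9,4,2), (142,70,5), (303,75,5), (1882,940,47),
   (2447,1222,13), (378302,31525,97)]), (101, [(202,100,2), (202,100,5), (39,9,3),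
   (20606,10302,101)]), (103, [(227,112,2), (227,112,7), (206,34,2), (206,34,17), (7,3,3), (8,4,2),
   (26,3,3), (74,36,3), (142,70,5), (219,108,3), (1383,345,23), (1658,828,23), (94763,11845,103),
   (1238,206,103)]), (107, [(227,112,2), (214,106,2), (214,106,53), (18,6,3), (27,3,3), (314,39,13),
   (33387,2782,107), (1286,642,107)]), (109, [(218,18,2), (218,18,3), (5,2,2), (7,3,3), (10,4,2),
   (22,5,5), (51,10,5), (83,8,2), (303,150,5), (802,100,5), (41103,20550,137), (1646,411,137),
   (59735,14933,109), (2182,1090,109)])])]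

theorem transferTable_refutes :
    (transferTable.all fun e => e.2.all fun a => refutes a.1 e.1 1 1 a.2) = true := by
  decide +kernel

theorem transferTable_complete :
    ∀ q ∈ List.range 127, q.Prime → ∀ p ∈ List.range q, p.Prime → (p = 2 ∧ q = 5) ∨
      (transferTable.any fun e => e.1 == q && e.2.any fun a => a.1 == p) = true := by
  decide +kernel

theorem not_isNSol_of_lt_127 {N p q m n : ℕ} (hp : p.Prime) (hq : q.Prime) (hpq : p < q)
    (hq' : q < 127) (hne : ¬ (p = 2 ∧ q = 5)) (hpN : IsNSol N p m) : ¬ IsNSol N q n := by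
  intro hqN
  rcases transferTable_complete q (List.mem_range.2 hq') hq p (List.mem_range.2 hpq) hp with h | h
  · exact hne h
  · simp only [List.any_eq_true, Bool.and_eq_true, beq_iff_eq] at h
    obtain ⟨e, he, rfl, a, ha, rfl⟩ := h
    have := transferTable_refutes
    rw [List.all_eq_true] at this
    have := this e he
    rw [List.all_eq_true] at this
    exact false_of_refutes ((Nat.coprime_primes hp hq).2 hpq.ne) hpN hqN (this a ha)
      (one_dvd _) (one_dvd _)

theorem pow_mod_period {x D M : ℕ} (h : x ^ D % M = 1 % M) (k : ℕ) :
    x ^ k % M = x ^ (k % D) % M := by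
  have h1 : x ^ (D * (k / D)) ≡ 1 [MOD M] := by
    rw [pow_mul]
    simpa using Nat.ModEq.pow (k / D) (show x ^ D ≡ 1 [MOD M] from h)
  have h2 := h1.mul_right (x ^ (k % D))
  rwa [← pow_add, Nat.div_add_mod, one_mul] at h2

theorem mod_eq_zero_of_pow {x D M k : ℕ} (hD : 0 < D) (h : x ^ D % M = 1 % M)
    (h' : ∀ r < D, x ^ r % M = 1 % M → r = 0) (hk : x ^ k % M = 1 % M) : k % D = 0 :=
  h' _ (Nat.mod_lt _ hD) (by rw [← pow_mod_period h, hk])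

theorem pow_mod_one_of_dvd {x D M k : ℕ} (h : x ^ D % M = 1 % M) (hk : k % D = 0) :
    x ^ k % M = 1 % M := by
  rw [pow_mod_period h, hk, pow_zero]

theorem mod_eq_one_iff_of_eq {X Y M : ℕ} (h : 128 * X = 125 * Y + 3) (h1 : M.Coprime 128)
    (h2 : M.Coprime 125) : X % M = 1 % M ↔ Y % M = 1 % M := by
  have e : 128 * X ≡ 128 * 1 [MOD M] ↔ 125 * Y ≡ 125 * 1 [MOD M] := by
    rw [h]
    exact ⟨fun h => Nat.ModEq.add_right_cancel' 3 h, fun h => h.add_right 3⟩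
  exact ⟨fun h => Nat.ModEq.cancel_left_of_coprime h2 (e.1 (Nat.ModEq.mul_left _ h)),
    fun h => Nat.ModEq.cancel_left_of_coprime h1 (e.2 (Nat.ModEq.mul_left _ h))⟩

theorem two_pow_five_pow_eq {k l : ℕ} (h : 128 * 2 ^ k = 125 * 5 ^ l + 3) : k = 0 := by
  generalize hX : 2 ^ k = X at h
  generalize hY : 5 ^ l = Y at h
  have hk100 : k % 100 = 0 :=
    mod_eq_zero_of_pow (x := 2) (M := 125) (by norm_num) (by decide +kernel) (by decide +kernel)
      (by rw [hX]; omega)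
  have hl32 : l % 32 = 0 :=
    mod_eq_zero_of_pow (x := 5) (M := 128) (by norm_num) (by decide +kernel) (by decide +kernel)
      (by rw [hY]; omega)
  have hl3 : l % 3 = 0 := by
    have h1 := pow_mod_one_of_dvd (x := 2) (D := 5) (M := 31) (k := k) (by decide +kernel) (by omega)
    rw [hX] at h1
    exact mod_eq_zero_of_pow (x := 5) (M := 31) (by norm_num) (by decide +kernel)
      (by decide +kernel) (by rw [hY]; exact (mod_eq_one_iff_of_eq h (by norm_num) (by norm_num)).1 h1)
  have hk48 : k % 48 = 0 := by
    have h1 := pow_mod_one_of_dvd (x := 5) (D := 96) (M := 97) (k := l) (by decide +kernel)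
      (by omega)
    rw [hY] at h1
    exact mod_eq_zero_of_pow (x := 2) (M := 97) (by norm_num) (by decide +kernel)
      (by decide +kernel) (by rw [hX]; exact (mod_eq_one_iff_of_eq h (by norm_num) (by norm_num)).2 h1)
  have hl256 : l % 256 = 0 := by
    have h1 := pow_mod_one_of_dvd (x := 2) (D := 16) (M := 257) (k := k) (by decide +kernel)
      (by omega)
    rw [hX] at h1
    exact mod_eq_zero_of_pow (x := 5) (M := 257) (by norm_num) (by decide +kernel)
      (by decide +kernel) (by rw [hY]; exact (mod_eq_one_iff_of_eq h (by norm_num) (by norm_num)).1 h1)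
  have h1 := pow_mod_one_of_dvd (x := 5) (D := 256) (M := 1024) (k := l) (by decide +kernel)
    hl256
  rw [hY] at h1
  have h2 : X % 8 = 1 := by omega
  rcases k with _ | _ | _ | k
  · rfl
  · omega
  · omega
  · rw [pow_add] at hX
    omega

theorem eq_31_of_isNSol_two_five {N m n : ℕ} (h2 : IsNSol N 2 m) (h5 : IsNSol N 5 n) : N = 31 := by
  have e2 := h2.mul_add_one
  have e5 := h5.mul_add_one
  have hm := h2.2.1
  have hn := h5.2.1
  have hlt : n < m := h2.exponent_lt h5 (by norm_num)
  norm_num at e2 e5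
  obtain ⟨l, rfl⟩ | rfl : (∃ l, n = l + 3) ∨ n = 2 := by
    rcases Nat.lt_or_ge 2 n with h | h
    · exact .inl ⟨n - 3, by omega⟩
    · exact .inr (by omega)
  · have hm5 : 5 ≤ m := by
      by_contra! hm5
      have : m = 4 := by omega
      subst this
      have : 1 ≤ 5 ^ l := Nat.one_le_pow _ _ (by norm_num)
      rw [pow_add] at e5
      omega
    obtain ⟨k, rfl⟩ : ∃ k, m = k + 5 := ⟨m - 5, by omega⟩
    have : k = 0 := two_pow_five_pow_eq (l := l) (by rw [pow_add] at e2 e5; omega)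
    subst this
    omega
  · have hN : N = 6 := by omega
    rcases m with _ | _ | _ | k
    · omega
    · omega
    · omega
    · rw [pow_succ, pow_succ, pow_succ] at e2
      omega

/-! ### Divisibility of interpolation determinants -/

theorem sum_range_le_sum_weight {κ : Type*} [DecidableEq κ] {m : ℕ} (t : ℕ)
    (ht : t ≤ m + 1) (s : Finset (ℕ ⊕ κ)) (hs : s.card = t) :
    ∑ k ∈ Finset.range t, k ≤ ∑ i ∈ s, Sum.elim id (fun _ => m) i := by
  induction t generalizing s with
  | zero => simp
  | succ t ih =>
    obtain ⟨i, hi, hit⟩ : ∃ i ∈ s, t ≤ Sum.elim id (fun _ => m) i := by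
      by_contra! hcon
      have hsub : s ⊆ (Finset.range t).map ⟨Sum.inl, Sum.inl_injective⟩ := by
        rintro (j | j) hj
        · have := hcon _ hj
          simpa using this
        · have := hcon _ hj
          simp at this
          omega
      have := Finset.card_le_card hsub
      simp [hs] at this
    rw [Finset.sum_range_succ, ← Finset.sum_erase_add _ _ hi]
    exact add_le_add (ih (by omega) _ (by rw [Finset.card_erase_of_mem hi, hs]; rfl)) hit

theorem pow_dvd_det_of_rows {ι : Type*} [Fintype ι] [DecidableEq ι] (R : Matrix ι ι ℤ) (p : ℤ)
    (m J : ℕ) (v : ℕ → ι → ℤ) (a : ι → ℕ) (g : ι → ℕ → ℤ) (ε : ι → ι → ℤ)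
    (hR : ∀ r c, p ^ a r * R r c =
      ∑ j ∈ Finset.range J, g r j * (p ^ j * v j c) + p ^ m * ε r c)
    (hm : Fintype.card ι ≤ m + 1) :
    p ^ (∑ k ∈ Finset.range (Fintype.card ι), k) ∣ p ^ (∑ r, a r) * R.det := by
  set w : ℕ ⊕ ι → ℕ := Sum.elim id (fun _ => m)
  set e : Fin J ⊕ ι → ℕ ⊕ ι := Sum.map Fin.val id
  have he : Function.Injective e := Fin.val_injective.sumMap Function.injective_id
  set u : Fin J ⊕ ι → ι → ℤ := Sum.elim (fun j => v j) (fun c => Pi.single c 1)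
  set G : ι → Fin J ⊕ ι → ℤ := fun r => Sum.elim (fun j => g r j) (fun c => ε r c)
  have hrow : (fun r => p ^ a r • R r) = fun r => ∑ i, (G r i * p ^ w (e i)) • u i := by
    funext r c
    simp only [Pi.smul_apply, smul_eq_mul, hR, Fintype.sum_sum_type, Finset.sum_apply, G, w, e, u,
      Sum.elim_inl, Sum.elim_inr, Sum.map_inl, Sum.map_inr, id]
    rw [Finset.sum_range]
    congr 1
    · exact Finset.sum_congr rfl fun j _ => by ring
    · rw [Finset.sum_eq_single c]
      · simp [mul_comm]
      · intro b _ hb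
        simp [hb.symm]
      · simp
  have hdet : p ^ (∑ r, a r) * R.det = Matrix.detRowAlternating fun r => p ^ a r • R r := by
    have := (Matrix.detRowAlternating (R := ℤ) (n := ι)).toMultilinearMap.map_smul_univ
      (fun r => p ^ a r) R
    rw [Finset.prod_pow_eq_pow_sum] at this
    exact this.symm
  rw [hdet, hrow]
  have := (Matrix.detRowAlternating (R := ℤ) (n := ι)).toMultilinearMap.map_sum
    (fun r i => (G r i * p ^ w (e i)) • u i)
  simp only [AlternatingMap.coe_multilinearMap] at this
  rw [this]
  refine Finset.dvd_sum fun σ _ => ?_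
  have h2 := (Matrix.detRowAlternating (R := ℤ) (n := ι)).toMultilinearMap.map_smul_univ
      (fun r => G r (σ r) * p ^ w (e (σ r))) (fun r => u (σ r))
  simp only [AlternatingMap.coe_multilinearMap] at h2
  rw [h2]
  by_cases hσ : Function.Injective σ
  · rw [smul_eq_mul, Finset.prod_mul_distrib, Finset.prod_pow_eq_pow_sum]
    refine Dvd.dvd.mul_right (Dvd.dvd.mul_left (pow_dvd_pow _ ?_) _) _
    have hi : Function.Injective (e ∘ σ) := he.comp hσ
    have := sum_range_le_sum_weight (Fintype.card ι) hm (Finset.univ.map ⟨e ∘ σ, hi⟩) (by simp)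
    simpa [Finset.sum_map] using this
  · simp only [Function.Injective, not_forall] at hσ
    obtain ⟨i, j, hij, hne⟩ := hσ
    rw [AlternatingMap.map_eq_zero_of_eq _ _ (by rw [hij]) hne]
    simp


theorem pow_dvd_fwdDiff_choose_mul_pow {p P : ℤ} (hP : p ∣ P - 1) (j a x : ℕ) :
    p ^ j ∣ p ^ a * (fwdDiff 1)^[j] (fun y : ℕ => (y.choose a : ℤ) * P ^ y) x := by
  induction j generalizing a with
  | zero => simp
  | succ j ih =>
    rw [Function.iterate_succ_apply]
    rcases a with _ | a
    · have : fwdDiff 1 (fun y : ℕ => (y.choose 0 : ℤ) * P ^ y) =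
          (P - 1) • fun y : ℕ => (y.choose 0 : ℤ) * P ^ y := by
        funext y
        simp [fwdDiff, pow_succ]
        ring
      rw [this, fwdDiff_iter_const_smul, Pi.smul_apply, smul_eq_mul, mul_left_comm, pow_succ']
      exact mul_dvd_mul hP (ih 0)
    · have : fwdDiff 1 (fun y : ℕ => (y.choose (a + 1) : ℤ) * P ^ y) =
          ((P - 1) • fun y : ℕ => (y.choose (a + 1) : ℤ) * P ^ y) +
            P • fun y : ℕ => (y.choose a : ℤ) * P ^ y := by
        funext y
        simp only [fwdDiff, pow_succ, Pi.add_apply, Pi.smul_apply, smul_eq_mul, Nat.choose_succ_succ]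
        push_cast
        ring
      rw [this, fwdDiff_iter_add, fwdDiff_iter_const_smul, fwdDiff_iter_const_smul, Pi.add_apply,
        Pi.smul_apply, Pi.smul_apply, smul_eq_mul, smul_eq_mul, mul_add]
      refine dvd_add ?_ ?_
      · rw [mul_left_comm, pow_succ']
        exact mul_dvd_mul hP (ih _)
      · rw [mul_left_comm, pow_succ', pow_succ', mul_assoc]
        exact Dvd.dvd.mul_left (mul_dvd_mul_left _ (ih a)) _

/-! ### A zero estimate for exponential polynomials -/

open Polynomial in
theorem coeff_prod_of_natDegree_le_fun {ι R : Type*} [CommSemiring R] (s : Finset ι)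
    (f : ι → R[X]) (d : ι → ℕ) (h : ∀ i ∈ s, (f i).natDegree ≤ d i) :
    (∏ i ∈ s, f i).coeff (∑ i ∈ s, d i) = ∏ i ∈ s, (f i).coeff (d i) := by
  classical
  induction s using Finset.induction_on with
  | empty => simp
  | insert a s ha ih =>
    rw [Finset.prod_insert ha, Finset.sum_insert ha, Finset.prod_insert ha,
      coeff_mul_add_eq_of_natDegree_le (h a (Finset.mem_insert_self a s)),
      ih fun i hi => h i (Finset.mem_insert_of_mem hi)]
    exact (natDegree_prod_le _ _).trans
      (Finset.sum_le_sum fun i hi => h i (Finset.mem_insert_of_mem hi))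

open Polynomial in
theorem coeff_det_of_natDegree_le {n R : Type*} [Fintype n] [DecidableEq n] [CommRing R]
    (G : Matrix n n R[X]) (d : n → ℕ) (h : ∀ i k, (G i k).natDegree ≤ d k) :
    G.det.coeff (∑ k, d k) = (Matrix.of fun i k => (G i k).coeff (d k)).det := by
  rw [Matrix.det_apply, Matrix.det_apply, finsetSum_coeff]
  refine Finset.sum_congr rfl fun σ _ => ?_
  rw [Polynomial.coeff_smul, coeff_prod_of_natDegree_le_fun _ _ _ fun i _ => h _ _]
  rfl

open Polynomial in
theorem natDegree_det_le {n R : Type*} [Fintype n] [DecidableEq n] [CommRing R]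
    (G : Matrix n n R[X]) (d : n → ℕ) (h : ∀ i k, (G i k).natDegree ≤ d k) :
    G.det.natDegree ≤ ∑ k, d k := by
  rw [Matrix.det_apply]
  refine natDegree_sum_le_of_forall_le _ _ fun σ _ => (natDegree_smul_le _ _).trans ?_
  exact (natDegree_prod_le _ _).trans (Finset.sum_le_sum fun i _ => h _ _)

open Polynomial in
theorem det_taylor_ne_zero {n : ℕ} (f : Fin n → ℚ[X]) (hf : ∀ k, f k ≠ 0) (y : Fin n → ℚ)
    (hy : Function.Injective y) :
    (Matrix.of fun i k : Fin n => C (y k ^ (i : ℕ)) * taylor (i : ℚ) (f k)).det ≠ 0 := by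
  have hd : ∀ i k : Fin n, (Matrix.of (fun i k : Fin n =>
      C (y k ^ (i : ℕ)) * taylor (i : ℚ) (f k)) i k).natDegree ≤ (f k).natDegree := fun i k =>
    (natDegree_C_mul_le _ _).trans (natDegree_taylor _ _).le
  intro h0
  have := coeff_det_of_natDegree_le _ _ hd
  rw [h0, coeff_zero] at this
  have h2 : (Matrix.of fun i k : Fin n => (Matrix.of (fun i k : Fin n =>
      C (y k ^ (i : ℕ)) * taylor (i : ℚ) (f k)) i k).coeff (f k).natDegree) =
      Matrix.of fun i k : Fin n => (f k).leadingCoeff * (Matrix.vandermonde y).transpose i k := by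
    ext i k
    simp only [Matrix.of_apply, Matrix.transpose_apply, Matrix.vandermonde_apply, coeff_C_mul,
      coeff_taylor_natDegree]
    ring
  rw [h2, Matrix.det_mul_row, Matrix.det_transpose] at this
  have h3 := Matrix.det_vandermonde_ne_zero_iff.2 hy
  have h4 : ∏ k, (f k).leadingCoeff ≠ 0 :=
    Finset.prod_ne_zero_iff.2 fun k _ => leadingCoeff_ne_zero.2 (hf k)
  exact mul_ne_zero h4 h3 this.symm

/-- The polynomial `∑ c_a * binom(X, a)`. -/
noncomputable def binomialPoly {K : ℕ} (c : Fin K → ℚ) : Polynomial ℚ :=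
  ∑ a : Fin K, Polynomial.C (c a / (a : ℕ).factorial) * descPochhammer ℚ a

theorem binomialPoly_eval {K : ℕ} (c : Fin K → ℚ) (x : ℕ) :
    (binomialPoly c).eval (x : ℚ) = ∑ a : Fin K, c a * (x.choose a : ℚ) := by
  rw [binomialPoly, Polynomial.eval_finsetSum]
  refine Finset.sum_congr rfl fun a _ => ?_
  rw [Polynomial.eval_mul, Polynomial.eval_C, descPochhammer_eval_eq_descFactorial,
    Nat.descFactorial_eq_factorial_mul_choose]
  have : ((a : ℕ).factorial : ℚ) ≠ 0 := by exact_mod_cast Nat.factorial_ne_zero _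
  push_cast
  field_simp

theorem natDegree_binomialPoly_le {K : ℕ} (c : Fin K → ℚ) :
    (binomialPoly c).natDegree ≤ K - 1 := by
  refine Polynomial.natDegree_sum_le_of_forall_le _ _ fun a _ =>
    (Polynomial.natDegree_C_mul_le _ _).trans ?_
  rw [descPochhammer_natDegree]
  have := a.2
  omega

theorem eq_zero_of_binomialPoly_eq_zero {K : ℕ} (c : Fin K → ℚ) (h : binomialPoly c = 0)
    (a : Fin K) : c a = 0 := by
  obtain ⟨k, hk⟩ := a
  induction k using Nat.strong_induction_on with
  | _ k ih =>
    have := binomialPoly_eval c k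
    rw [h, Polynomial.eval_zero, Finset.sum_eq_single ⟨k, hk⟩] at this
    · simpa using this.symm
    · rintro ⟨b, hb'⟩ _ hb
      rcases lt_or_gt_of_ne (fun h => hb (Fin.ext h) : b ≠ k) with hb | hb
      · rw [ih b hb, zero_mul]
      · rw [Nat.choose_eq_zero_of_lt hb, Nat.cast_zero, mul_zero]
    · simp

/-- Entries of the interpolation matrix. -/
def interpEntry (h l : ℕ) (Q A B : ℤ) (a b u s : ℕ) : ℤ :=
  ((u + h * s).choose a : ℤ) * Q ^ (u * b) * A ^ (s * b) * B ^ (s * (l - b))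

theorem interpEntry_zero_estimate {K l h U S : ℕ} {Q A B : ℤ} (hQ : 2 ≤ Q) (hA : A ≠ 0)
    (hB : B ≠ 0) (hU : U ≤ h) (hUS : (K - 1) * (l + 1) < U * S)
    (F : Fin K × Fin (l + 1) → ℚ)
    (hF : ∀ u s : ℕ, u < U + l → s < S →
      ∑ r, F r * (interpEntry h l Q A B r.1 r.2 u s : ℚ) = 0) : F = 0 := by
  classical
  set f : Fin (l + 1) → Polynomial ℚ := fun b => binomialPoly fun a => F (a, b) with hf
  suffices hall : ∀ b, f b = 0 by
    funext ⟨a, b⟩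
    exact eq_zero_of_binomialPoly_eq_zero _ (hall b) a
  by_contra! hne
  obtain ⟨b₀, hb₀⟩ := hne
  set T := {b // f b ≠ 0}
  set n := Fintype.card T
  have hn : n ≤ l + 1 := by
    have := Fintype.card_subtype_le fun b : Fin (l + 1) => f b ≠ 0
    rwa [Fintype.card_fin] at this
  let e : Fin n ≃ T := (Fintype.equivFin T).symm
  have hQ0 : (Q : ℚ) ≠ 0 := by exact_mod_cast (by omega : Q ≠ 0)
  have hA0 : (A : ℚ) ≠ 0 := by exact_mod_cast hA
  have hB0 : (B : ℚ) ≠ 0 := by exact_mod_cast hB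
  let y : Fin n → ℚ := fun k => (Q : ℚ) ^ ((e k).1 : ℕ)
  have hy : Function.Injective y := by
    intro i j hij
    have : ((e i).1 : ℕ) = ((e j).1 : ℕ) :=
      pow_right_injective₀ (by positivity) (by exact_mod_cast (by omega : Q ≠ 1)) hij
    exact e.injective (Subtype.ext (Fin.ext this))
  have hdet := det_taylor_ne_zero (fun k => f (e k).1) (fun k => (e k).2) y hy
  set P := (Matrix.of fun i k : Fin n =>
    Polynomial.C (y k ^ (i : ℕ)) * Polynomial.taylor (i : ℚ) (f (e k).1)).det with hP
  apply hdet
  have hdeg : P.natDegree ≤ (l + 1) * (K - 1) := by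
    refine (natDegree_det_le _ (fun _ => K - 1) fun i k => ?_).trans ?_
    · exact (Polynomial.natDegree_C_mul_le _ _).trans
        ((Polynomial.natDegree_taylor _ _).le.trans (natDegree_binomialPoly_le _))
    · simpa using Nat.mul_le_mul_right _ hn
  refine Polynomial.eq_zero_of_natDegree_lt_card_of_eval_eq_zero P
    (f := fun i : Fin U × Fin S => ((i.1 + h * i.2 : ℕ) : ℚ)) ?_ ?_ ?_
  · rintro ⟨u, s⟩ ⟨u', s'⟩ huv
    have huv : (u : ℕ) + h * s = u' + h * s' := Nat.cast_injective (R := ℚ) huv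
    have hu := u.2
    have hu' := u'.2
    have h1 : (s : ℕ) = s' := by
      have e1 : ((u : ℕ) + h * s) / h = s := by
        rw [Nat.add_mul_div_left _ _ (by omega), Nat.div_eq_of_lt (by omega), zero_add]
      have e2 : ((u' : ℕ) + h * s') / h = s' := by
        rw [Nat.add_mul_div_left _ _ (by omega), Nat.div_eq_of_lt (by omega), zero_add]
      rw [← e1, huv, e2]
    have h2 : (u : ℕ) = u' := by
      rw [h1] at huv
      omega
    exact Prod.ext (Fin.ext h2) (Fin.ext h1)
  · rintro ⟨u, s⟩
    set x : ℕ := u + h * s with hx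
    have hev : Polynomial.eval (x : ℚ) P = (Matrix.of fun i k : Fin n =>
        y k ^ (i : ℕ) * (f (e k).1).eval ((x + i : ℕ) : ℚ)).det := by
      rw [hP, ← Polynomial.coe_evalRingHom, RingHom.map_det]
      congr 1
      ext i k
      simp [Polynomial.taylor_eval, add_comm]
    rw [hev, ← Matrix.exists_mulVec_eq_zero_iff]
    set z : ℚ := (Q : ℚ) ^ (u : ℕ) * ((A : ℚ) / B) ^ (s : ℕ) with hz
    have hz0 : z ≠ 0 := by positivity
    refine ⟨fun k => z ^ ((e k).1 : ℕ), fun h0 => ?_, ?_⟩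
    · have := congrFun h0 (e.symm ⟨b₀, hb₀⟩)
      exact pow_ne_zero _ hz0 this
    · funext i
      have hi := hF (u + i) s (by have := u.2; have := i.2; omega) s.2
      rw [Fintype.sum_prod_type_right] at hi
      have hterm : ∀ b : Fin (l + 1), ∑ a : Fin K,
          F (a, b) * (interpEntry h l Q A B a b (u + i) s : ℚ) =
          (B : ℚ) ^ ((s : ℕ) * l) * (((Q : ℚ) ^ (b : ℕ)) ^ (i : ℕ) *
            (f b).eval ((x + i : ℕ) : ℚ) * z ^ (b : ℕ)) := by
        intro b
        rw [hf, binomialPoly_eval, Finset.mul_sum, Finset.sum_mul, Finset.mul_sum]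
        refine Finset.sum_congr rfl fun a _ => ?_
        have hb : (b : ℕ) ≤ l := by have := b.2; omega
        have hsplit : (s : ℕ) * l = s * (l - b) + s * b := by
          rw [← Nat.mul_add, Nat.sub_add_cancel hb]
        rw [hsplit, pow_add, interpEntry, hz, show (u : ℕ) + i + h * s = x + i by omega]
        push_cast
        rw [mul_pow, div_pow, div_pow, ← pow_mul, ← pow_mul, ← pow_mul, ← pow_mul, add_mul, pow_add,
          mul_comm (b : ℕ) i]
        field_simp
      simp only [hterm] at hi
      rw [← Finset.mul_sum] at hi
      have hi := (mul_eq_zero.1 hi).resolve_left (pow_ne_zero _ hB0)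
      rw [Matrix.mulVec, dotProduct, Pi.zero_apply, ← hi]
      simp only [Matrix.of_apply]
      have : ∑ k : Fin n, y k ^ (i : ℕ) * (f (e k).1).eval ((x + i : ℕ) : ℚ) *
          z ^ ((e k).1 : ℕ) = ∑ b : T, ((Q : ℚ) ^ (b.1 : ℕ)) ^ (i : ℕ) *
            (f b.1).eval ((x + i : ℕ) : ℚ) * z ^ (b.1 : ℕ) :=
        Equiv.sum_comp e fun b : T => ((Q : ℚ) ^ (b.1 : ℕ)) ^ (i : ℕ) *
            (f b.1).eval ((x + i : ℕ) : ℚ) * z ^ (b.1 : ℕ)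
      rw [this, ← Finset.sum_subtype (Finset.univ.filter fun b => f b ≠ 0) (by simp)
        (fun b => ((Q : ℚ) ^ (b : ℕ)) ^ (i : ℕ) * (f b).eval ((x + i : ℕ) : ℚ) * z ^ (b : ℕ))]
      refine Finset.sum_filter_of_ne fun b _ hb h0 => hb ?_
      rw [h0]
      simp
  · simpa [mul_comm] using hdeg.trans_lt (by rw [mul_comm]; exact hUS)

/-! ### The interpolation inequality -/

theorem exists_submatrix_det_ne_zero {ι κ : Type*} [Fintype ι] [Fintype κ] [DecidableEq ι]
    (M : Matrix ι κ ℚ) (h : ∀ F : ι → ℚ, (∀ k, ∑ r, F r * M r k = 0) → F = 0) :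
    ∃ c : ι → κ, (M.submatrix id c).det ≠ 0 := by
  have hli : LinearIndependent ℚ M.row := by
    rw [Fintype.linearIndependent_iff]
    intro F hF
    have := h F fun k => by
      have := congrFun hF k
      simpa using this
    exact fun i => congrFun this i
  have hrank : Module.finrank ℚ (Submodule.span ℚ (Set.range M.col)) = Fintype.card ι := by
    rw [← M.rank_eq_finrank_span_cols, hli.rank_matrix]
  obtain ⟨f, hf, -, hfli⟩ := Submodule.exists_fun_fin_finrank_span_eq ℚ (Set.range M.col)
  let e : ι ≃ Fin (Module.finrank ℚ (Submodule.span ℚ (Set.range M.col))) :=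
    (Fintype.equivFin ι).trans (finCongr hrank.symm)
  choose c hc using hf
  refine ⟨fun i => c (e i), ?_⟩
  have hcol : (M.submatrix id fun i => c (e i)).col = f ∘ e := by
    funext i
    exact hc (e i)
  have := hfli.comp e e.injective
  rw [← hcol, Matrix.linearIndependent_cols_iff_isUnit, Matrix.isUnit_iff_isUnit_det] at this
  exact this.ne_zero

theorem abs_det_le_prod {ι : Type*} [Fintype ι] [DecidableEq ι] (R : Matrix ι ι ℤ) (b : ι → ℝ)
    (h : ∀ r c, |(R r c : ℝ)| ≤ b r) : |(R.det : ℝ)| ≤ (Fintype.card ι).factorial * ∏ r, b r := by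
  rw [Matrix.det_apply']
  push_cast
  refine (Finset.abs_sum_le_sum_abs _ _).trans ?_
  have : ∀ σ ∈ (Finset.univ : Finset (Equiv.Perm ι)),
      |((Equiv.Perm.sign σ : ℤ) : ℝ) * ∏ i, (R (σ i) i : ℝ)| ≤ ∏ r, b r := by
    intro σ _
    rw [abs_mul, Finset.abs_prod, ← Equiv.prod_comp σ b]
    have h1 : |((Equiv.Perm.sign σ : ℤ) : ℝ)| = 1 := by
      rcases Int.units_eq_one_or (Equiv.Perm.sign σ) with h | h <;> simp [h]
    rw [h1, one_mul]
    exact Finset.prod_le_prod (fun _ _ => abs_nonneg _) fun i _ => h _ _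
  refine (Finset.sum_le_card_nsmul _ _ _ this).trans ?_
  rw [Finset.card_univ, Fintype.card_perm, nsmul_eq_mul]

theorem pow_dvd_det_interp {K l h m : ℕ} {p Q A B : ℤ} (hp : p ∣ Q - 1)
    (hm : p ^ m ∣ B * Q ^ h - A) (hT : K * (l + 1) ≤ m + 1)
    (c : Fin K × Fin (l + 1) → ℕ × ℕ) :
    p ^ (∑ k ∈ Finset.range (K * (l + 1)), k) ∣ p ^ (∑ r : Fin K × Fin (l + 1), (r.1 : ℕ)) *
      (Matrix.of fun r i : Fin K × Fin (l + 1) =>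
        interpEntry h l Q A B r.1 r.2 (c i).1 (c i).2).det := by
  have hcard : Fintype.card (Fin K × Fin (l + 1)) = K * (l + 1) := by simp
  rw [← hcard]
  have hQ : ∀ b : ℕ, p ∣ Q ^ b - 1 := fun b => hp.trans (sub_one_dvd_pow_sub_one Q b)
  have hex : ∀ r : Fin K × Fin (l + 1), ∀ j, ∃ g, p ^ (r.1 : ℕ) * (fwdDiff 1)^[j]
      (fun y : ℕ => (y.choose r.1 : ℤ) * (Q ^ (r.2 : ℕ)) ^ y) 0 = p ^ j * g := fun r j =>
    pow_dvd_fwdDiff_choose_mul_pow (hQ _) j _ _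
  choose g hg using hex
  have hex2 : ∀ r i : Fin K × Fin (l + 1), ∃ ε : ℤ, interpEntry h l Q A B r.1 r.2 (c i).1 (c i).2 =
      (((c i).1 + h * (c i).2).choose r.1 : ℤ) * (Q ^ (r.2 : ℕ)) ^ ((c i).1 + h * (c i).2) *
        B ^ ((c i).2 * l) + p ^ m * ε := by
    intro r i
    have hb : (r.2 : ℕ) ≤ l := by have := r.2.2; omega
    have h1 : p ^ m ∣ A ^ ((c i).2 * r.2) - (B * Q ^ h) ^ ((c i).2 * r.2) :=
      (by rw [← dvd_neg, neg_sub]; exact hm : p ^ m ∣ A - B * Q ^ h).trans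
        (sub_dvd_pow_sub_pow _ _ _)
    obtain ⟨ε, hε⟩ := h1
    refine ⟨(((c i).1 + h * (c i).2).choose r.1 : ℤ) * Q ^ ((c i).1 * r.2) *
      B ^ ((c i).2 * (l - r.2)) * ε, ?_⟩
    have hsplit : (c i).2 * l = (c i).2 * (l - r.2) + (c i).2 * r.2 := by
      rw [← Nat.mul_add, Nat.sub_add_cancel hb]
    rw [interpEntry, eq_add_of_sub_eq hε, hsplit, pow_add]
    ring
  choose ε hε using hex2
  refine pow_dvd_det_of_rows _ p m ((Finset.univ.sup fun i => (c i).1 + h * (c i).2) + 1)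
    (fun j i => (((c i).1 + h * (c i).2).choose j : ℤ) * B ^ ((c i).2 * l)) (fun r => (r.1 : ℕ)) g
    (fun r i => p ^ (r.1 : ℕ) * ε r i) ?_ (by rw [hcard]; exact hT)
  intro r i
  rw [Matrix.of_apply, hε, mul_add]
  congr 1
  · set x := (c i).1 + h * (c i).2 with hx
    have hxle : x + 1 ≤ (Finset.univ.sup fun i => (c i).1 + h * (c i).2) + 1 :=
      Nat.succ_le_succ (Finset.le_sup (f := fun i => (c i).1 + h * (c i).2) (Finset.mem_univ i))
    have hs := shift_eq_sum_fwdDiff_iter (1 : ℕ)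
      (fun y : ℕ => (y.choose r.1 : ℤ) * (Q ^ (r.2 : ℕ)) ^ y) x 0
    simp only [zero_add, smul_eq_mul, mul_one] at hs
    rw [hs, ← Finset.sum_subset (Finset.range_mono hxle), Finset.sum_mul, Finset.mul_sum]
    · refine Finset.sum_congr rfl fun j _ => ?_
      have := hg r j
      simp only [nsmul_eq_mul]
      linear_combination (x.choose j : ℤ) * B ^ ((c i).2 * l) * this
    · intro j _ hj
      rw [Finset.mem_range, not_lt] at hj
      rw [Nat.choose_eq_zero_of_lt (by omega)]
      simp
  · ring

theorem abs_interpEntry_le {l h U S X : ℕ} {Q A B : ℤ} {α γ : ℝ} (hQ : 1 ≤ Q)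
    (hα : 1 ≤ α) (hγ : 1 ≤ γ) (hA : |(A : ℝ)| ≤ α) (hB : |(B : ℝ)| ≤ α * γ)
    {a b u s : ℕ} (hb : b ≤ l) (hu : u ≤ U) (hs : s ≤ S) (hX : U + h * S ≤ X) :
    |(interpEntry h l Q A B a b u s : ℝ)| ≤
      (X : ℝ) ^ a / a.factorial * (Q : ℝ) ^ (U * b) * (α ^ (S * l) * γ ^ (S * (l - b))) := by
  have hQ' : (1 : ℝ) ≤ Q := by exact_mod_cast hQ
  rw [interpEntry]
  push_cast
  have hC : ((u + h * s).choose a : ℝ) ≤ (X : ℝ) ^ a / a.factorial := by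
    refine (Nat.choose_le_pow_div a (u + h * s)).trans ?_
    gcongr
    exact_mod_cast (Nat.add_le_add hu (Nat.mul_le_mul_left h hs)).trans hX
  have hQb : (Q : ℝ) ^ (u * b) ≤ (Q : ℝ) ^ (U * b) := by gcongr
  have hAB : |(A : ℝ)| ^ (s * b) * |(B : ℝ)| ^ (s * (l - b)) ≤
      α ^ (S * l) * γ ^ (S * (l - b)) :=
    calc |(A : ℝ)| ^ (s * b) * |(B : ℝ)| ^ (s * (l - b))
        ≤ α ^ (s * b) * (α * γ) ^ (s * (l - b)) := by gcongr
      _ = α ^ (s * l) * γ ^ (s * (l - b)) := by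
        rw [mul_pow, ← mul_assoc, ← pow_add, ← Nat.mul_add, Nat.add_sub_cancel' hb]
      _ ≤ _ := by gcongr
  have hQ0 : (0 : ℝ) ≤ Q := zero_le_one.trans hQ'
  rw [abs_mul, abs_mul, abs_mul, mul_assoc (_ * _), Nat.abs_cast, abs_pow, abs_pow, abs_pow,
    abs_of_nonneg hQ0]
  exact mul_le_mul (mul_le_mul hC hQb (by positivity) (by positivity)) hAB (by positivity)
    (by positivity)

theorem pow_le_five_pow_mul_prod_factorial_sq (K : ℕ) :
    (K : ℝ) ^ (K * (K - 1)) ≤ 5 ^ (K * (K - 1)) * (∏ a ∈ Finset.range K, (a.factorial : ℝ)) ^ 2 := by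
  have h1 : ∀ K : ℕ, (1 : ℝ) ≤ ∏ a ∈ Finset.range K, (a.factorial : ℝ) := fun K => by
    exact_mod_cast Finset.one_le_prod' (s := Finset.range K) (f := Nat.factorial)
      fun a _ => Nat.factorial_pos a
  rcases le_total K 5 with hK | hK
  · have h5 : (K : ℝ) ≤ 5 := by exact_mod_cast hK
    calc (K : ℝ) ^ (K * (K - 1)) ≤ 5 ^ (K * (K - 1)) * 1 := by rw [mul_one]; gcongr
      _ ≤ _ := by gcongr; exact one_le_pow₀ (h1 K)
  · induction K, hK using Nat.le_induction with
    | base =>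
      rw [Nat.cast_ofNat]
      exact le_mul_of_one_le_right (by positivity) (one_le_pow₀ (h1 5))
    | succ K hK ih =>
      have hK0 : (0 : ℝ) < K := by exact_mod_cast (by omega : 0 < K)
      have hfac : (K : ℝ) ^ K ≤ Real.exp 1 ^ K * K.factorial := by
        have := Real.pow_div_factorial_le_exp (K : ℝ) hK0.le K
        rw [div_le_iff₀ (by positivity)] at this
        rwa [← Real.exp_nat_mul, mul_one]
      have hsucc : ((K + 1 : ℕ) : ℝ) ^ K ≤ (K : ℝ) ^ K * Real.exp 1 := by
        have h : ((K + 1 : ℕ) : ℝ) = K * (1 + 1 / K) := by push_cast; field_simp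
        rw [h, mul_pow]
        gcongr
        calc (1 + 1 / (K : ℝ)) ^ K ≤ Real.exp (1 / K) ^ K := by
              gcongr
              rw [add_comm]
              exact Real.add_one_le_exp _
          _ = Real.exp 1 := by rw [← Real.exp_nat_mul]; congr 1; field_simp
      have he : Real.exp 1 ^ (3 * K + 1) ≤ 25 ^ K := by
        have h3 : Real.exp 1 ≤ 2.7183 := by linarith [Real.exp_one_lt_d9]
        have hb : Real.exp 1 ^ (3 * 5 + 1) ≤ 25 ^ 5 :=
          (pow_le_pow_left₀ (Real.exp_pos 1).le h3 _).trans (by norm_num)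
        clear ih hfac hsucc
        induction K, hK using Nat.le_induction with
        | base => exact hb
        | succ K hK ih =>
          have := ih (by exact_mod_cast (by omega : 0 < K))
          calc Real.exp 1 ^ (3 * (K + 1) + 1) = Real.exp 1 ^ (3 * K + 1) * Real.exp 1 ^ 3 := by ring
            _ ≤ 25 ^ K * 25 := by
              gcongr
              exact (pow_le_pow_left₀ (Real.exp_pos 1).le h3 _).trans (by norm_num)
            _ = 25 ^ (K + 1) := by ring
      rw [Finset.prod_range_succ, mul_pow, Nat.add_sub_cancel]
      have e1 : K * (K + 1) = K * (K - 1) + 2 * K := by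
        obtain ⟨k, rfl⟩ : ∃ k, K = k + 1 := ⟨K - 1, by omega⟩
        rw [Nat.add_sub_cancel]; ring
      calc ((K + 1 : ℕ) : ℝ) ^ ((K + 1) * K) = (((K + 1 : ℕ) : ℝ) ^ K) ^ (K + 1) := by
            rw [← pow_mul]; ring_nf
        _ ≤ ((K : ℝ) ^ K * Real.exp 1) ^ (K + 1) := by gcongr
        _ = (K : ℝ) ^ (K * (K - 1)) * ((K : ℝ) ^ K) ^ 2 * Real.exp 1 ^ (K + 1) := by
            rw [mul_pow, ← pow_mul, e1, pow_add]; ring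
        _ ≤ (5 ^ (K * (K - 1)) * (∏ a ∈ Finset.range K, (a.factorial : ℝ)) ^ 2) *
            (Real.exp 1 ^ K * K.factorial) ^ 2 * Real.exp 1 ^ (K + 1) := by gcongr
        _ = (5 ^ (K * (K - 1)) * (∏ a ∈ Finset.range K, (a.factorial : ℝ)) ^ 2) *
            (K.factorial : ℝ) ^ 2 * Real.exp 1 ^ (3 * K + 1) := by ring
        _ ≤ (5 ^ (K * (K - 1)) * (∏ a ∈ Finset.range K, (a.factorial : ℝ)) ^ 2) *
            (K.factorial : ℝ) ^ 2 * 25 ^ K := by gcongr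
        _ = _ := by
            rw [mul_comm (K + 1) K, e1, pow_add, pow_mul 5 2 K]; norm_num; ring

theorem prod_interp_bound_sq {K l U S : ℕ} {X Q α γ : ℝ} (hX : 0 ≤ X) (hQ : 0 ≤ Q) (hα : 0 ≤ α)
    (hγ : 0 ≤ γ) (hK : 0 < K) :
    (∏ r : Fin K × Fin (l + 1), (X ^ (r.1 : ℕ) / (r.1 : ℕ).factorial * Q ^ (U * r.2) *
      (α ^ (S * l) * γ ^ (S * (l - r.2))))) ^ 2 ≤
    ((5 * X / K) ^ (K - 1) * (Q ^ U * α ^ (2 * S) * γ ^ S) ^ l) ^ (K * (l + 1)) := by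
  have hK0 : (0 : ℝ) < K := by exact_mod_cast hK
  have hsum : ∑ b ∈ Finset.range (l + 1), (l - b) = ∑ b ∈ Finset.range (l + 1), b := by
    have := Finset.sum_range_reflect (fun b => b) (l + 1)
    simpa using this
  have hsl : (∑ b ∈ Finset.range (l + 1), b) * 2 = (l + 1) * l := Finset.sum_range_id_mul_two _
  have hsk : (∑ b ∈ Finset.range K, b) * 2 = K * (K - 1) := Finset.sum_range_id_mul_two _
  rw [Finset.prod_mul_distrib, Finset.prod_mul_distrib, Finset.prod_mul_distrib,
    Fintype.prod_prod_type, Fintype.prod_prod_type, Finset.prod_const, Fintype.prod_prod_type]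
  simp only [Finset.prod_const, Finset.card_univ, Fintype.card_fin, Fintype.card_prod]
  rw [Finset.prod_pow, Fin.prod_univ_eq_prod_range (fun a => X ^ a / (a.factorial : ℝ)) K,
    Fin.prod_univ_eq_prod_range (fun b => Q ^ (U * b)) (l + 1),
    Fin.prod_univ_eq_prod_range (fun b => γ ^ (S * (l - b))) (l + 1),
    Finset.prod_pow_eq_pow_sum, Finset.prod_pow_eq_pow_sum, ← Finset.mul_sum, ← Finset.mul_sum,
    hsum, Finset.prod_div_distrib, Finset.prod_pow_eq_pow_sum]
  set P := ∏ a ∈ Finset.range K, (a.factorial : ℝ) with hP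
  have hPpos : 0 < P := Finset.prod_pos fun a _ => by positivity
  have hPle : (X ^ (K * (K - 1)) / P ^ 2) ≤ (5 * X / K) ^ (K * (K - 1)) := by
    rw [div_pow, mul_pow, div_le_div_iff₀ (by positivity) (by positivity)]
    have := pow_le_five_pow_mul_prod_factorial_sq K
    calc X ^ (K * (K - 1)) * (K : ℝ) ^ (K * (K - 1))
        ≤ X ^ (K * (K - 1)) * (5 ^ (K * (K - 1)) * P ^ 2) := by gcongr
      _ = _ := by ring
  calc _ = (X ^ ((∑ b ∈ Finset.range K, b) * 2) / P ^ 2) ^ (l + 1) *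
        Q ^ (U * ((∑ b ∈ Finset.range (l + 1), b) * 2) * K) * α ^ (2 * S * l * (K * (l + 1))) *
        γ ^ (S * ((∑ b ∈ Finset.range (l + 1), b) * 2) * K) := by
          rw [mul_pow, mul_pow, mul_pow, pow_mul X, div_pow]
          simp only [← pow_mul]
          ring_nf
    _ ≤ ((5 * X / K) ^ (K * (K - 1))) ^ (l + 1) *
        Q ^ (U * ((∑ b ∈ Finset.range (l + 1), b) * 2) * K) * α ^ (2 * S * l * (K * (l + 1))) *
        γ ^ (S * ((∑ b ∈ Finset.range (l + 1), b) * 2) * K) := by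
          rw [hsk]; gcongr
    _ = _ := by
          rw [hsl]
          simp only [mul_pow (_ ^ _ : ℝ), ← pow_mul]
          ring_nf

theorem interp_inequality {K l h m U S X p : ℕ} {Q A B : ℤ} {α γ : ℝ} (hp0 : 0 < p)
    (hp : (p : ℤ) ∣ Q - 1) (hm : (p : ℤ) ^ m ∣ B * Q ^ h - A) (hT : K * (l + 1) ≤ m + 1)
    (hQ : 2 ≤ Q) (hα : 1 ≤ α) (hγ : 1 ≤ γ) (hA : |(A : ℝ)| ≤ α) (hB : |(B : ℝ)| ≤ α * γ)
    (hA0 : A ≠ 0) (hB0 : B ≠ 0) (hK : 0 < K) (hU : U ≤ h) (hUS : (K - 1) * (l + 1) < U * S)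
    (hX : (U + l - 1) + h * (S - 1) ≤ X) :
    (p : ℝ) ^ (K * l) ≤ ((K * (l + 1) : ℕ) : ℝ) ^ 2 * (5 * X / K) ^ (K - 1) *
      ((Q : ℝ) ^ (U + l - 1) * α ^ (2 * (S - 1)) * γ ^ (S - 1)) ^ l := by
  obtain ⟨c, hc⟩ := exists_submatrix_det_ne_zero
    (Matrix.of fun (r : Fin K × Fin (l + 1)) (i : Fin (U + l) × Fin S) =>
      (interpEntry h l Q A B r.1 r.2 i.1 i.2 : ℚ)) fun F hF =>
        interpEntry_zero_estimate hQ hA0 hB0 hU hUS F fun u s hu hs => hF (⟨u, hu⟩, ⟨s, hs⟩)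
  set R : Matrix (Fin K × Fin (l + 1)) (Fin K × Fin (l + 1)) ℤ := Matrix.of fun r i =>
    interpEntry h l Q A B r.1 r.2 ((fun i => (((c i).1 : ℕ), ((c i).2 : ℕ))) i).1
      ((fun i => (((c i).1 : ℕ), ((c i).2 : ℕ))) i).2 with hR
  have hR0 : R.det ≠ 0 := by
    intro h0
    apply hc
    have : (R.map (Int.castRingHom ℚ)).det = 0 := by
      rw [← RingHom.mapMatrix_apply, ← RingHom.map_det, h0, map_zero]
    exact this
  have hdvd := pow_dvd_det_interp hp hm hT (fun i => (((c i).1 : ℕ), ((c i).2 : ℕ)))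
  rw [← hR] at hdvd
  have hle := Int.le_of_dvd (by positivity) ((dvd_abs _ _).2 hdvd)
  have hbd := abs_det_le_prod R (fun r : Fin K × Fin (l + 1) =>
      ((X : ℝ) ^ (r.1 : ℕ) / (r.1 : ℕ).factorial * (Q : ℝ) ^ ((U + l - 1) * r.2) *
      (α ^ ((S - 1) * l) * γ ^ ((S - 1) * (l - r.2))))) fun r i =>
    abs_interpEntry_le (by omega) hα hγ hA hB (by omega) (Nat.le_sub_one_of_lt (c i).1.2)
      (Nat.le_sub_one_of_lt (c i).2.2) hX
  have hQ0 : (0 : ℝ) ≤ Q := by exact_mod_cast (by omega : (0 : ℤ) ≤ Q)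
  have hsq := prod_interp_bound_sq (K := K) (l := l) (U := U + l - 1) (S := S - 1)
    (Nat.cast_nonneg X) hQ0 (zero_le_one.trans hα) (zero_le_one.trans hγ) hK
  set T := K * (l + 1) with hTdef
  have hTpos : 0 < T := by positivity
  set D : ℝ := |(R.det : ℝ)| with hD
  have hcard : Fintype.card (Fin K × Fin (l + 1)) = T := by simp [hTdef]
  rw [hcard] at hbd
  set Pi := ∏ r : Fin K × Fin (l + 1), ((X : ℝ) ^ (r.1 : ℕ) / (r.1 : ℕ).factorial *
    (Q : ℝ) ^ ((U + l - 1) * r.2) * (α ^ ((S - 1) * l) * γ ^ ((S - 1) * (l - r.2))))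
  have hle' : (p : ℝ) ^ (∑ k ∈ Finset.range T, k) ≤
      (p : ℝ) ^ (∑ r : Fin K × Fin (l + 1), (r.1 : ℕ)) * D := by
    rw [abs_mul, abs_pow, Nat.abs_cast] at hle
    rw [hD, ← Int.cast_abs]
    exact_mod_cast hle
  have hs2 : (∑ r : Fin K × Fin (l + 1), (r.1 : ℕ)) * 2 = T * (K - 1) := by
    rw [Fintype.sum_prod_type]
    simp only [Finset.sum_const, Finset.card_univ, Fintype.card_fin, smul_eq_mul]
    rw [← Finset.mul_sum, Fin.sum_univ_eq_sum_range (fun a => a) K, mul_assoc,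
      Finset.sum_range_id_mul_two, hTdef]
    ring
  have hs1 : (∑ k ∈ Finset.range T, k) * 2 = T * (K - 1) + K * l * T := by
    rw [Finset.sum_range_id_mul_two, hTdef]
    obtain ⟨k, rfl⟩ : ∃ k, K = k + 1 := ⟨K - 1, by omega⟩
    have : (k + 1) * (l + 1) - 1 = k + (k + 1) * l := by
      rw [Nat.mul_succ]; omega
    rw [this, Nat.add_sub_cancel]
    ring
  have hp0' : (0 : ℝ) < p := by exact_mod_cast hp0
  have h2 : ((p : ℝ) ^ (K * l)) ^ T ≤ D ^ 2 := by
    have := pow_le_pow_left₀ (by positivity) hle' 2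
    rw [mul_pow, ← pow_mul, ← pow_mul, hs1, hs2, pow_add, pow_mul _ (K * l) T] at this
    exact le_of_mul_le_mul_left this (by positivity)
  have hfact : (T.factorial : ℝ) ≤ (T : ℝ) ^ T := by exact_mod_cast Nat.factorial_le_pow T
  have h3 : D ^ 2 ≤ ((T : ℝ) ^ 2 * ((5 * X / K) ^ (K - 1) *
      ((Q : ℝ) ^ (U + l - 1) * α ^ (2 * (S - 1)) * γ ^ (S - 1)) ^ l)) ^ T :=
    calc D ^ 2 ≤ (T.factorial * Pi) ^ 2 := by gcongr
      _ = (T.factorial : ℝ) ^ 2 * Pi ^ 2 := by ring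
      _ ≤ ((T : ℝ) ^ T) ^ 2 * ((5 * X / K) ^ (K - 1) *
          ((Q : ℝ) ^ (U + l - 1) * α ^ (2 * (S - 1)) * γ ^ (S - 1)) ^ l) ^ T := by gcongr
      _ = _ := by rw [mul_pow ((T : ℝ) ^ 2), ← pow_mul, ← pow_mul, mul_comm T 2]
  have hα0 := zero_le_one.trans hα
  have hγ0 := zero_le_one.trans hγ
  rw [mul_assoc]
  exact le_of_pow_le_pow_left₀ hTpos.ne' (by positivity) (h2.trans h3)

theorem IsNSol.pow_dvd_interp {N p q m n : ℕ} (hp : IsNSol N p m) (hq : IsNSol N q n) :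
    (p : ℤ) ^ m ∣ (q * (p - 1) : ℤ) * q ^ (n - 1) - (p - q) := by
  have h1 : (N : ℤ) * (p - 1) + 1 = p ^ m := by
    have := hp.mul_add_one
    have h2 := hp.1
    zify [show 1 ≤ p by omega] at this
    exact this
  have h2 : (N : ℤ) * (q - 1) + 1 = q ^ n := by
    have := hq.mul_add_one
    have h2 := hq.1
    zify [show 1 ≤ q by omega] at this
    exact this
  have h3 : (q : ℤ) ^ n = q * q ^ (n - 1) := by
    rw [← pow_succ', Nat.sub_add_cancel (by have := hq.2.1; omega)]
  refine ⟨q - 1, ?_⟩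
  linear_combination (q - 1 : ℤ) * h1 - (p - 1 : ℤ) * h2 - (p - 1 : ℤ) * h3

theorem lt_div_of_log_le {K : ℝ} (hK : 224 ≤ K) : Real.log K < K / 28 := by
  have h1 : Real.log (K / 224) ≤ K / 224 - 1 := Real.log_le_sub_one_of_pos (by linarith)
  rw [Real.log_div (by linarith) (by norm_num)] at h1
  have h2 : Real.log 224 ≤ 7 := by
    rw [Real.log_le_iff_le_exp (by norm_num), show (7 : ℝ) = (7 : ℕ) * 1 by norm_num,
      Real.exp_nat_mul]
    refine le_trans ?_ (pow_le_pow_left₀ (by norm_num)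
      (show (2.7 : ℝ) ≤ Real.exp 1 by linarith [Real.exp_one_gt_d9]) 7)
    norm_num
  linarith

set_option maxHeartbeats 1000000 in
theorem IsNSol.lt_of_interp {N p q m n f h l : ℕ} (hp : IsNSol N p m) (hq : IsNSol N q n)
    (hpq : p < q) (hf0 : 0 < f) (hf : f * h = n - 1) (hfp : (p : ℤ) ∣ (q : ℤ) ^ f - 1) (hl : 3 ≤ l)
    {t : ℝ} (ht : t = h * Real.log p / Real.log q) (htl : 61 * ((l : ℝ) + 1) ^ 2 ≤ t)
    (hlp : 8 ≤ l * Real.log p) :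
    l * Real.log p / 2 < Real.log (10 * t / 27) := by
  by_contra! hle
  have hp2 : (2 : ℝ) ≤ p := by exact_mod_cast hp.1
  have hpq' : (p : ℝ) ≤ q := by exact_mod_cast hpq.le
  have hq0 : (0 : ℝ) < q := by linarith
  have hp0 : (0 : ℝ) < p := by linarith
  set P := Real.log p with hP
  have hP0 : 0 < P := Real.log_pos (by linarith)
  obtain ⟨ρ, hρ⟩ : ∃ ρ, ρ = Real.log q / P := ⟨_, rfl⟩
  have hlq : Real.log q = ρ * P := by rw [hρ]; field_simp
  have hρ1 : 1 ≤ ρ := by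
    rw [hρ, one_le_div hP0]
    exact Real.log_le_log (by linarith) hpq'
  obtain ⟨Λ, hΛ⟩ : ∃ Λ : ℝ, Λ = l + 1 := ⟨_, rfl⟩
  have hΛ4 : 4 ≤ Λ := by
    have : (3 : ℝ) ≤ l := by exact_mod_cast hl
    linarith
  have hf1 : (1 : ℝ) ≤ f := by exact_mod_cast hf0
  have hht : (h : ℝ) = ρ * t := by rw [ht, hlq]; field_simp
  rw [← hΛ] at htl
  have ht0 : 0 < t := by nlinarith
  obtain ⟨W, hW⟩ : ∃ W, W = ρ ^ 2 * f * Λ := ⟨_, rfl⟩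
  have hρρ : ρ ≤ ρ ^ 2 := by nlinarith
  have hW1 : ρ * Λ ≤ W := by
    rw [hW]
    have : ρ ≤ ρ ^ 2 * f := by nlinarith
    nlinarith
  have hW2 : ρ * f * Λ ≤ W := by rw [hW]; gcongr
  have hWΛ : Λ ≤ W := by nlinarith
  have hW0 : 0 < W := by linarith
  set S := ⌈4 * ρ * f * Λ⌉₊ with hS
  set U := ⌈14 * ρ * Λ⌉₊ with hU
  have hS1 : 4 * ρ * f * Λ ≤ S := Nat.le_ceil _
  have hS2 : (S : ℝ) < 4 * ρ * f * Λ + 1 := Nat.ceil_lt_add_one (by positivity)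
  have hU1 : 14 * ρ * Λ ≤ U := Nat.le_ceil _
  have hU2 : (U : ℝ) < 14 * ρ * Λ + 1 := Nat.ceil_lt_add_one (by positivity)
  have hSpos : 0 < S := Nat.ceil_pos.2 (by positivity)
  have hUpos : 0 < U := Nat.ceil_pos.2 (by positivity)
  set K := ⌈(U : ℝ) * S / Λ⌉₊ with hK
  have hK1 : (U : ℝ) * S / Λ ≤ K := Nat.le_ceil _
  have hK2 : (K : ℝ) < U * S / Λ + 1 := Nat.ceil_lt_add_one (by positivity)
  have hKpos : 0 < K := Nat.ceil_pos.2 (by positivity)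
  have hUS : 56 * W * Λ ≤ U * S := by
    calc 56 * W * Λ = (14 * ρ * Λ) * (4 * ρ * f * Λ) := by rw [hW]; ring
      _ ≤ _ := by gcongr
  have hUS2 : (U : ℝ) * S ≤ (14 * ρ * Λ + 1) * (4 * ρ * f * Λ + 1) := by gcongr
  have hKW : 56 * W ≤ K := by
    refine le_trans ?_ hK1
    rw [le_div_iff₀ (by linarith)]
    exact hUS
  have hKΛ : K * Λ < U * S + Λ := by
    have := mul_lt_mul_of_pos_right hK2 (show 0 < Λ by linarith)
    rwa [add_mul, div_mul_cancel₀ _ (by linarith), one_mul] at this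
  have hKΛ' : K * Λ ≤ 61 * W * Λ := by
    have h1 : (14 * ρ * Λ + 1) * (4 * ρ * f * Λ + 1) =
        56 * W * Λ + 14 * (ρ * Λ) + 4 * (ρ * f * Λ) + 1 := by rw [hW]; ring
    have h2 : W * 4 ≤ W * Λ := by gcongr
    linarith
  have hT : K * (l + 1) ≤ m + 1 := by
    have h1 : ((n - 1 : ℕ) : ℝ) * Real.log q ≤ m * P := by
      rw [hP, ← Real.log_pow, ← Real.log_pow]
      refine Real.log_le_log (by positivity) ?_
      exact_mod_cast hq.pow_lt.le.trans hp.lt_pow.le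
    rw [← hf, hlq] at h1
    push_cast at h1
    have h2 : ρ ^ 2 * f * t ≤ m := by
      refine le_of_mul_le_mul_right ?_ hP0
      rw [hht] at h1
      linarith
    have h3 : 61 * W * Λ ≤ ρ ^ 2 * f * t := by
      calc 61 * W * Λ = ρ ^ 2 * f * (61 * Λ ^ 2) := by rw [hW]; ring
        _ ≤ _ := by gcongr
    have h4 : (K : ℝ) * (l + 1) ≤ m := by rw [← hΛ]; linarith
    have h5 : K * (l + 1) ≤ m := by exact_mod_cast h4
    omega
  have hUh : U ≤ h := by
    have : (U : ℝ) ≤ h := by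
      rw [hht]
      have h1 : ρ * (61 * Λ ^ 2) ≤ ρ * t := by gcongr
      have h2 : ρ * Λ * 4 ≤ ρ * Λ * Λ := by gcongr
      have h3 : 1 * 1 ≤ ρ * Λ := by gcongr; linarith
      linarith
    exact_mod_cast this
  have hKU : (K - 1) * (l + 1) < U * S := by
    have : ((K : ℝ) - 1) * (l + 1) < U * S := by rw [← hΛ]; linarith
    have h2 : (((K - 1 : ℕ) : ℝ)) * (l + 1) < U * S := by
      rwa [Nat.cast_sub hKpos, Nat.cast_one]
    exact_mod_cast h2
  have hB : |((q * (p - 1) : ℤ) : ℝ)| ≤ (q : ℝ) * p := by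
    push_cast
    rw [abs_of_nonneg (mul_nonneg hq0.le (by linarith))]
    exact mul_le_mul_of_nonneg_left (by linarith) hq0.le
  have hA : |((p - q : ℤ) : ℝ)| ≤ (q : ℝ) := by
    push_cast
    rw [abs_le]
    constructor <;> linarith
  have hdvd : (p : ℤ) ^ m ∣ (q * (p - 1) : ℤ) * ((q : ℤ) ^ f) ^ h - (p - q) := by
    rw [← pow_mul, hf]
    exact hp.pow_dvd_interp hq
  have hQ : (2 : ℤ) ≤ (q : ℤ) ^ f := by
    have h2 : (2 : ℤ) ≤ q := by exact_mod_cast hq.1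
    exact h2.trans (le_self_pow₀ (by linarith) hf0.ne')
  have hmain := interp_inequality (by have := hp.1; omega) hfp hdvd hT hQ
    (by linarith : (1 : ℝ) ≤ q) (by linarith : (1 : ℝ) ≤ p) hA hB
    (by have : (p : ℤ) < q := by exact_mod_cast hpq
        omega)
    (by have : (2 : ℤ) ≤ p := by exact_mod_cast hp.1
        have h3 : (p : ℤ) < q := by exact_mod_cast hpq
        exact mul_ne_zero (by omega) (by omega)) hKpos hUh hKU le_rfl
  have hS' : ((S - 1 : ℕ) : ℝ) ≤ 4 * ρ * f * Λ := by
    rw [Nat.cast_sub hSpos, Nat.cast_one]; linarith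
  have hU' : ((U + l - 1 : ℕ) : ℝ) ≤ 15 * ρ * Λ := by
    rw [Nat.cast_sub (by omega)]
    push_cast
    have h1 : 1 * Λ ≤ ρ * Λ := by gcongr
    linarith
  have hX : 5 * ((U + l - 1 + h * (S - 1) : ℕ) : ℝ) / K ≤ 10 * t / 27 := by
    rw [Nat.cast_add, Nat.cast_mul, div_le_iff₀ (by positivity)]
    have h1 : (h : ℝ) * ((S - 1 : ℕ) : ℝ) ≤ ρ * t * (4 * ρ * f * Λ) := by
      rw [hht]; gcongr
    have h2 : ρ * t * (4 * ρ * f * Λ) = 4 * W * t := by rw [hW]; ring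
    have h3 : 10 * t / 27 * (56 * W) ≤ 10 * t / 27 * K := by gcongr
    have h4 : 976 * W ≤ t * W := by
      have : 61 * (4 : ℝ) ^ 2 ≤ 61 * Λ ^ 2 := by gcongr
      exact mul_le_mul_of_nonneg_right (by linarith) hW0.le
    refine le_trans ?_ h3
    linarith
  have hTpos : (0 : ℝ) < ((K * (l + 1) : ℕ) : ℝ) := by positivity
  have hXpos : (0 : ℝ) < 5 * ((U + l - 1 + h * (S - 1) : ℕ) : ℝ) / K := by
    have : 0 < U + l - 1 := by omega
    positivity
  have hlog := Real.log_le_log (by positivity) hmain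
  push_cast only [Int.cast_pow, Int.cast_natCast] at hlog
  rw [Real.log_mul (by positivity) (by positivity), Real.log_mul (by positivity) (by positivity),
    Real.log_pow, Real.log_pow, Real.log_pow, Real.log_pow, Real.log_mul (by positivity)
    (by positivity), Real.log_mul (by positivity) (by positivity), Real.log_pow, Real.log_pow,
    Real.log_pow, Real.log_pow, ← hP, hlq] at hlog
  have hx1 : ((K - 1 : ℕ) : ℝ) * Real.log (5 * ((U + l - 1 + h * (S - 1) : ℕ) : ℝ) / K) ≤
      K * (l * P / 2) := by
    have h1 : Real.log (5 * ((U + l - 1 + h * (S - 1) : ℕ) : ℝ) / K) ≤ l * P / 2 :=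
      (Real.log_le_log hXpos hX).trans hle
    calc _ ≤ ((K - 1 : ℕ) : ℝ) * (l * P / 2) := by gcongr
      _ ≤ _ := by gcongr; omega
  have hx2 : ((U + l - 1 : ℕ) : ℝ) * (f * (ρ * P)) + ((2 * (S - 1) : ℕ) : ℝ) * (ρ * P) +
      ((S - 1 : ℕ) : ℝ) * P ≤ 27 / 56 * K * P := by
    have h1 : ((U + l - 1 : ℕ) : ℝ) * (f * (ρ * P)) ≤ 15 * W * P := by
      calc _ ≤ 15 * ρ * Λ * (f * (ρ * P)) := by gcongr
        _ = _ := by rw [hW]; ring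
    have h2 : ((2 * (S - 1) : ℕ) : ℝ) * (ρ * P) ≤ 8 * W * P := by
      rw [Nat.cast_mul, Nat.cast_ofNat]
      calc _ ≤ 2 * (4 * ρ * f * Λ) * (ρ * P) := by gcongr
        _ = _ := by rw [hW]; ring
    have h3 : ((S - 1 : ℕ) : ℝ) * P ≤ 4 * W * P := by
      gcongr
      linarith
    have h4 : 27 / 56 * (56 * W) * P ≤ 27 / 56 * K * P := by gcongr
    linarith
  have hlogT : Real.log ((K * (l + 1) : ℕ) : ℝ) ≤ 2 * Real.log K := by
    rw [← Nat.cast_two, ← Real.log_pow]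
    refine Real.log_le_log hTpos ?_
    push_cast
    rw [← hΛ, sq]
    gcongr
    linarith
  have hlK := lt_div_of_log_le (K := K) (by linarith)
  have hl0 : (0 : ℝ) ≤ l := by positivity
  have hx3 := mul_le_mul_of_nonneg_left hx2 hl0
  have hK0 : (0 : ℝ) < K := by positivity
  have hx4 : K * 8 ≤ K * (l * P) := by gcongr
  push_cast at hlog hlogT hx3 hx1
  linarith

theorem mul_sq_le_pow_of_base {b l₀ : ℕ} (hb : (22.6 * ((l₀ : ℝ) + 2) ^ 2) ^ 2 ≤ (b : ℝ) ^ l₀)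
    (hr : ((l₀ : ℝ) + 3) ^ 4 ≤ b * ((l₀ : ℝ) + 2) ^ 4) {l : ℕ} (hl : l₀ < l) :
    (22.6 * ((l : ℝ) + 1) ^ 2) ^ 2 ≤ (b : ℝ) ^ (l - 1) := by
  obtain ⟨k, rfl⟩ : ∃ k, l = l₀ + 1 + k := ⟨l - (l₀ + 1), by omega⟩
  clear hl
  have e : ∀ k, l₀ + 1 + k - 1 = l₀ + k := fun k => by omega
  rw [e]
  induction k with
  | zero => push_cast; ring_nf at hb ⊢; exact hb
  | succ k ih =>
    set x : ℝ := (l₀ : ℝ) + 2 with hx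
    have hx0 : 0 < x := by positivity
    have hk : (0 : ℝ) ≤ k := by positivity
    have h1 : (x + (k + 1)) * x ≤ (x + k) * (x + 1) := by nlinarith
    have h2 : (x + (k + 1)) ^ 4 ≤ b * (x + k) ^ 4 := by
      have h3 := pow_le_pow_left₀ (by positivity) h1 4
      rw [mul_pow, mul_pow] at h3
      have h4 : (x + 1) ^ 4 ≤ b * x ^ 4 := by
        convert hr using 2
        rw [hx]; ring
      refine le_of_mul_le_mul_right (h3.trans ?_) (pow_pos hx0 4)
      calc (x + k) ^ 4 * (x + 1) ^ 4 ≤ (x + k) ^ 4 * (b * x ^ 4) := by gcongr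
        _ = _ := by ring
    have e1 : ((l₀ + 1 + (k + 1) : ℕ) : ℝ) + 1 = x + (k + 1) := by push_cast; rw [hx]; ring
    have e2 : ((l₀ + 1 + k : ℕ) : ℝ) + 1 = x + k := by push_cast; rw [hx]; ring
    rw [e2] at ih
    rw [e1]
    calc (22.6 * (x + (k + 1)) ^ 2) ^ 2 = 22.6 ^ 2 * (x + (k + 1)) ^ 4 := by ring
      _ ≤ 22.6 ^ 2 * (b * (x + k) ^ 4) := by gcongr
      _ = b * (22.6 * (x + k) ^ 2) ^ 2 := by ring
      _ ≤ b * (b : ℝ) ^ (l₀ + k) := by gcongr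
      _ = _ := by rw [← pow_succ', add_assoc]

theorem IsNSol.ratio_lt {N p q m n f h l₀ b : ℕ} (hp : IsNSol N p m) (hq : IsNSol N q n)
    (hpq : p < q) (hf0 : 0 < f) (hf : f * h = n - 1) (hfp : (p : ℤ) ∣ (q : ℤ) ^ f - 1)
    (hl : 3 ≤ l₀) (hbp : b ≤ p) (h8 : 8 ≤ l₀ * Real.log p)
    (hb : (22.6 * ((l₀ : ℝ) + 2) ^ 2) ^ 2 ≤ (b : ℝ) ^ l₀)
    (hr : ((l₀ : ℝ) + 3) ^ 4 ≤ b * ((l₀ : ℝ) + 2) ^ 4) :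
    h * Real.log p / Real.log q < 61 * ((l₀ : ℝ) + 1) ^ 2 := by
  by_contra! ht
  obtain ⟨t, ht'⟩ : ∃ t, t = h * Real.log p / Real.log q := ⟨_, rfl⟩
  rw [← ht'] at ht
  have hp2 : (2 : ℝ) ≤ p := by exact_mod_cast hp.1
  have hP0 : 0 < Real.log p := Real.log_pos (by linarith)
  have hex : ∃ l, Real.log (10 * t / 27) ≤ (l : ℕ) * Real.log p / 2 := by
    obtain ⟨l, hl⟩ := exists_nat_ge (Real.log (10 * t / 27) * 2 / Real.log p)
    refine ⟨l, ?_⟩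
    rw [div_le_iff₀ hP0] at hl
    linarith
  classical
  set l := Nat.find hex with hldef
  have hl2 := Nat.find_spec hex
  rw [← hldef] at hl2
  have h1 := hp.lt_of_interp hq hpq hf0 hf hfp hl ht' ht h8
  have hll : l₀ < l := by
    by_contra! hle
    have : (l : ℝ) * Real.log p / 2 ≤ l₀ * Real.log p / 2 := by gcongr
    linarith
  have hmin := Nat.find_min hex (show l - 1 < l by omega)
  rw [not_le] at hmin
  have hg := mul_sq_le_pow_of_base hb hr hll
  have ht0 : 0 < t := lt_of_lt_of_le (by positivity) ht
  have hb2 : (b : ℝ) ^ (l - 1) ≤ (10 * t / 27) ^ 2 := by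
    have h2 : (p : ℝ) ^ (l - 1) ≤ (10 * t / 27) ^ 2 := by
      rw [← Real.log_le_log_iff (by positivity) (by positivity), Real.log_pow, Real.log_pow]
      push_cast
      linarith
    refine le_trans ?_ h2
    gcongr
  have h3 : 22.6 * ((l : ℝ) + 1) ^ 2 ≤ 10 * t / 27 :=
    le_of_pow_le_pow_left₀ two_ne_zero (by positivity) (hg.trans hb2)
  have h4 : 61 * ((l : ℝ) + 1) ^ 2 ≤ t := by nlinarith [sq_nonneg ((l : ℝ) + 1)]
  have h5 : (8 : ℝ) ≤ l * Real.log p := h8.trans (by gcongr)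
  exact absurd (hp.lt_of_interp hq hpq hf0 hf hfp (by omega) ht' h4 h5) (not_lt.2 hl2)

theorem IsNSol.exists_order {N p q m n : ℕ} (hp : IsNSol N p m) (hq : IsNSol N q n)
    (pp : p.Prime) (pq : q.Prime) (hpq : p < q) :
    ∃ f h, 0 < f ∧ f ≤ p - 1 ∧ f * h = n - 1 ∧ (p : ℤ) ∣ (q : ℤ) ^ f - 1 := by
  have := Fact.mk pp
  have hq0 : (q : ZMod p) ≠ 0 := by
    rw [Ne, ZMod.natCast_eq_zero_iff]
    intro h
    exact hpq.ne ((Nat.prime_dvd_prime_iff_eq pp pq).1 h)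
  have hone : (q : ZMod p) ^ (n - 1) = 1 := by
    have h1 := (dvd_pow_self (p : ℤ) (by have := hp.2.1; omega : m ≠ 0)).trans
      (hp.pow_dvd_interp hq)
    have h2 := (ZMod.intCast_zmod_eq_zero_iff_dvd _ p).2 h1
    push_cast at h2
    rw [CharP.cast_eq_zero (ZMod p) p] at h2
    have h3 : (q : ZMod p) * ((q : ZMod p) ^ (n - 1) - 1) = 0 := by linear_combination -h2
    exact sub_eq_zero.1 ((mul_eq_zero.1 h3).resolve_left hq0)
  obtain ⟨h, hh⟩ := orderOf_dvd_of_pow_eq_one hone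
  refine ⟨orderOf (q : ZMod p), h, ?_, ?_, hh.symm, ?_⟩
  · rw [orderOf_pos_iff, isOfFinOrder_iff_pow_eq_one]
    exact ⟨n - 1, by have := hq.2.1; omega, hone⟩
  · exact Nat.le_of_dvd (by have := pp.two_le; omega)
      (orderOf_dvd_of_pow_eq_one (ZMod.pow_card_sub_one_eq_one hq0))
  · rw [← ZMod.intCast_zmod_eq_zero_iff_dvd]
    push_cast
    rw [pow_orderOf_eq_one, sub_self]

theorem IsNSol.log_le {N p q m n : ℕ} (hp : IsNSol N p m) (hq : IsNSol N q n) (pp : p.Prime)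
    (pq : q.Prime) (hpq : p < q) (hq127 : 127 ≤ q)
    (hL : (q * Real.log q) ^ 2 / 4 < Real.log N) : Real.log N ≤ 4500000 := by
  by_contra! hL2
  obtain ⟨f, h, hf0, hfp, hfh, hdvd⟩ := hp.exists_order hq pp pq hpq
  have hp2 : (2 : ℝ) ≤ p := by exact_mod_cast hp.1
  have hq2 : (127 : ℝ) ≤ q := by exact_mod_cast hq127
  have hpq' : (p : ℝ) < q := by exact_mod_cast hpq
  set G := Real.log q with hG
  set P := Real.log p with hP
  have h2l := Real.log_two_gt_d9
  have hG1 : 1 ≤ G := by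
    rw [hG, Real.le_log_iff_exp_le (by linarith)]
    linarith [Real.exp_one_lt_d9]
  have hP0 : 0 < P := Real.log_pos (by linarith)
  have hNpos : 0 < N := by have := hq.pow_lt; omega
  have hLn : Real.log N ≤ n * G := by
    rw [hG, ← Real.log_pow]
    exact Real.log_le_log (by exact_mod_cast hNpos) (by exact_mod_cast hq.lt_pow.le)
  obtain ⟨R, hR⟩ : ∃ R, R = (Real.log N / G - 1) / G := ⟨_, rfl⟩
  have hRG : R * G ^ 2 = Real.log N - G := by rw [hR]; field_simp
  have hn1 : ((n - 1 : ℕ) : ℝ) = n - 1 := by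
    rw [Nat.cast_sub (by have := hq.2.1; omega), Nat.cast_one]
  have hRn : R * G ≤ f * h := by
    have h1 : ((f * h : ℕ) : ℝ) = n - 1 := by rw [hfh, hn1]
    push_cast at h1
    rw [h1]
    refine le_of_mul_le_mul_right ?_ (by linarith : 0 < G)
    linarith
  have hR1 : 0.249 * (q : ℝ) ^ 2 ≤ R := by
    refine le_of_mul_le_mul_right ?_ (by positivity : 0 < G ^ 2)
    rw [hRG]
    have : (127 : ℝ) ^ 2 * G ≤ q ^ 2 * G ^ 2 := by
      have : G ≤ G ^ 2 := by nlinarith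
      gcongr
    nlinarith
  have hR2 : 105000 ≤ R := by
    rcases le_total G 6.5 with hG6 | hG6
    · refine le_of_mul_le_mul_right ?_ (by positivity : 0 < G ^ 2)
      rw [hRG]
      nlinarith
    · have h650 : (650 : ℝ) ≤ q := by
        rw [hG, Real.le_log_iff_exp_le (by linarith)] at hG6
        refine le_trans ?_ hG6
        have h13 : (650 : ℝ) ^ 2 ≤ Real.exp 6.5 ^ 2 := by
          rw [← Real.exp_nat_mul, show ((2 : ℕ) : ℝ) * 6.5 = (13 : ℕ) * 1 by norm_num,
            Real.exp_nat_mul]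
          refine le_trans ?_ (pow_le_pow_left₀ (by norm_num)
            (show (2.718 : ℝ) ≤ Real.exp 1 by linarith [Real.exp_one_gt_d9]) 13)
          norm_num
        exact le_of_pow_le_pow_left₀ two_ne_zero (Real.exp_pos _).le h13
      nlinarith
  have hfp' : (f : ℝ) ≤ p - 1 := by
    have : ((f : ℕ) : ℝ) ≤ ((p - 1 : ℕ) : ℝ) := by exact_mod_cast hfp
    rwa [Nat.cast_sub (by have := hp.1; omega), Nat.cast_one] at this
  have hf0' : (0 : ℝ) < f := by exact_mod_cast hf0
  have key : ∀ c : ℝ, 0 ≤ c → c * (p - 1) ≤ R * P → c ≤ h * P / G := by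
    intro c hc0 hc
    rw [le_div_iff₀ (by linarith)]
    refine le_of_mul_le_mul_right ?_ hf0'
    calc c * G * f ≤ c * G * (p - 1) := by gcongr
      _ = c * (p - 1) * G := by ring
      _ ≤ R * P * G := by gcongr
      _ = R * G * P := by ring
      _ ≤ f * h * P := by gcongr
      _ = _ := by ring
  have hpow : ∀ k : ℕ, 2 ^ k ≤ p → 0.6931 * k ≤ P := by
    intro k hk
    have h1 : Real.log ((2 : ℝ) ^ k) ≤ P :=
      Real.log_le_log (by positivity) (by exact_mod_cast hk)
    rw [Real.log_pow] at h1
    have : (0 : ℝ) ≤ k := by positivity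
    nlinarith
  have hRP : 105000 * P ≤ R * P := by gcongr
  have step : ∀ l₀ b k M : ℕ, 3 ≤ l₀ → b ≤ p → 2 ^ k ≤ p → p ≤ M → (8 : ℝ) ≤ l₀ * (0.6931 * k) →
      (22.6 * ((l₀ : ℝ) + 2) ^ 2) ^ 2 ≤ (b : ℝ) ^ l₀ →
      ((l₀ : ℝ) + 3) ^ 4 ≤ b * ((l₀ : ℝ) + 2) ^ 4 →
      61 * ((l₀ : ℝ) + 1) ^ 2 * (M - 1) ≤ 105000 * (0.6931 * k) → False := by
    intro l₀ b k M h3 hb hk hM h8 hb2 hr hfin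
    have hkP := hpow k hk
    have h8' : (8 : ℝ) ≤ l₀ * Real.log p := h8.trans (by gcongr)
    refine absurd (key (61 * ((l₀ : ℝ) + 1) ^ 2) (by positivity) ?_)
      (not_le.2 (hp.ratio_lt hq hpq hf0 hfh hdvd h3 hb h8' hb2 hr))
    have hM' : (p : ℝ) ≤ M := by exact_mod_cast hM
    calc 61 * ((l₀ : ℝ) + 1) ^ 2 * (p - 1) ≤ 61 * ((l₀ : ℝ) + 1) ^ 2 * (M - 1) := by gcongr
      _ ≤ 105000 * (0.6931 * (k : ℝ)) := hfin
      _ ≤ 105000 * P := by gcongr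
      _ ≤ _ := hRP
  rcases lt_or_ge p 3 with h | h3
  · exact step 29 2 1 2 (by norm_num) hp.1 (by have := hp.1; omega) (by omega) (by norm_num)
      (by norm_num) (by norm_num) (by norm_num)
  rcases lt_or_ge p 4 with h | h4
  · exact step 17 3 1 3 (by norm_num) h3 (by omega) (by omega) (by norm_num)
      (by norm_num) (by norm_num) (by norm_num)
  have h5 : 5 ≤ p := by
    rcases Nat.lt_or_ge p 5 with h | h
    · interval_cases p
      exact absurd pp (by norm_num)
    · exact h
  rcases lt_or_ge p 16 with h | h16
  · exact step 11 5 2 15 (by norm_num) h5 (by omega) (by omega) (by norm_num)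
      (by norm_num) (by norm_num) (by norm_num)
  rcases lt_or_ge p 29 with h | h29
  · exact step 11 5 4 28 (by norm_num) h5 (by omega) (by omega) (by norm_num)
      (by norm_num) (by norm_num) (by norm_num)
  rcases lt_or_ge p 69 with h | h69
  · exact step 4 29 4 68 (by norm_num) h29 (by omega) (by omega) (by norm_num)
      (by norm_num) (by norm_num) (by norm_num)
  rcases lt_or_ge p 256 with h | h256
  · exact step 3 69 6 255 (by norm_num) h69 (by omega) (by omega) (by norm_num)
      (by norm_num) (by norm_num) (by norm_num)
  rcases lt_or_ge p 512 with h | h512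
  · exact step 3 69 8 511 (by norm_num) h69 (by omega) (by omega) (by norm_num)
      (by norm_num) (by norm_num) (by norm_num)
  rcases lt_or_ge p 651 with h | h651
  · exact step 3 69 9 650 (by norm_num) h69 (by omega) (by omega) (by norm_num)
      (by norm_num) (by norm_num) (by norm_num)
  have hP9 := hpow 9 (by omega)
  have h8' : (8 : ℝ) ≤ ((3 : ℕ) : ℝ) * Real.log p := by
    push_cast at hP9 ⊢
    linarith
  refine absurd (key (61 * (((3 : ℕ) : ℝ) + 1) ^ 2) (by positivity) ?_)
    (not_le.2 (hp.ratio_lt (b := 69) hq hpq hf0 hfh hdvd le_rfl h69 h8' (by norm_num)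
      (by norm_num)))
  have h651' : (651 : ℝ) ≤ p := by exact_mod_cast h651
  push_cast at hP9 ⊢
  calc 61 * ((3 : ℝ) + 1) ^ 2 * (p - 1) ≤ 0.249 * p * 651 * (0.6931 * 9) := by linarith
    _ ≤ 0.249 * p * p * P := by gcongr
    _ ≤ R * P := by
      gcongr
      nlinarith

/-! ### Gaps between solutions -/

theorem divided_difference_bounds {f f' f'' : ℝ → ℝ} {x y z M : ℝ} (hxy : x < y) (hyz : y < z)
    (hf : ∀ t ∈ Set.Icc x z, HasDerivAt f (f' t) t)
    (hf' : ∀ t ∈ Set.Icc x z, HasDerivAt f' (f'' t) t)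
    (hpos : ∀ t ∈ Set.Icc x z, 0 < f'' t) (hM : ∀ t ∈ Set.Icc x z, f'' t ≤ M) :
    0 < (f x - f y) * (z - y) - (f y - f z) * (y - x) ∧
      (f x - f y) * (z - y) - (f y - f z) * (y - x) ≤ M * ((y - x) * (z - y) * (z - x)) / 2 := by
  have hxz : x < z := hxy.trans hyz
  have hu : 0 < y - x := by linarith
  have hv : 0 < z - y := by linarith
  have huv : 0 < z - x := by linarith
  have hcont : ContinuousOn f (Set.Icc x z) := fun t ht => (hf t ht).continuousAt.continuousWithinAt
  have hxm : x ∈ Set.Icc x z := ⟨le_rfl, hxz.le⟩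
  have hzm : z ∈ Set.Icc x z := ⟨hxz.le, le_rfl⟩
  have ha : 0 < (z - y) / (z - x) := by positivity
  have hb : 0 < (y - x) / (z - x) := by positivity
  have hab : (z - y) / (z - x) + (y - x) / (z - x) = 1 := by field_simp; ring
  have hcomb : (z - y) / (z - x) * x + (y - x) / (z - x) * z = y := by field_simp; ring
  constructor
  · have hmono : StrictMonoOn f' (Set.Icc x z) :=
      strictMonoOn_of_deriv_pos (convex_Icc x z)
        (fun t ht => (hf' t ht).continuousAt.continuousWithinAt) fun t ht => by
          rw [(hf' t (interior_subset ht)).deriv]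
          exact hpos t (interior_subset ht)
    have hconv : StrictConvexOn ℝ (Set.Icc x z) f :=
      StrictMonoOn.strictConvexOn_of_deriv (convex_Icc x z) hcont fun s hs t ht hst => by
        rw [(hf s (interior_subset hs)).deriv, (hf t (interior_subset ht)).deriv]
        exact hmono (interior_subset hs) (interior_subset ht) hst
    have h := hconv.2 hxm hzm hxz.ne ha hb hab
    simp only [smul_eq_mul] at h
    rw [hcomb] at h
    have h2 : (z - y) / (z - x) * f x + (y - x) / (z - x) * f z =
        ((z - y) * f x + (y - x) * f z) / (z - x) := by ring
    rw [h2, lt_div_iff₀ huv] at h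
    linarith
  · have hconv : ConvexOn ℝ (Set.Icc x z) fun t => M * t ^ 2 / 2 - f t := by
      refine convexOn_of_hasDerivWithinAt2_nonneg (convex_Icc x z) (f' := fun t => M * t - f' t)
        (f'' := fun t => M - f'' t) (by fun_prop) (fun t ht => ?_) (fun t ht => ?_) fun t ht => ?_
      · have h1 := (((hasDerivAt_id t).pow 2).const_mul M).div_const 2
        have h2 := h1.sub (hf t (interior_subset ht))
        refine (h2.congr_deriv ?_).hasDerivWithinAt
        simp
        ring
      · have h1 := (hasDerivAt_id t).const_mul M
        have h2 := h1.sub (hf' t (interior_subset ht))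
        refine (h2.congr_deriv ?_).hasDerivWithinAt
        simp
      · exact sub_nonneg.2 (hM t (interior_subset ht))
    have h := hconv.2 hxm hzm ha.le hb.le hab
    simp only [smul_eq_mul] at h
    rw [hcomb] at h
    have h2 : (z - y) / (z - x) * (M * x ^ 2 / 2 - f x) +
        (y - x) / (z - x) * (M * z ^ 2 / 2 - f z) =
        ((z - y) * (M * x ^ 2 / 2 - f x) + (y - x) * (M * z ^ 2 / 2 - f z)) / (z - x) := by ring
    rw [h2, le_div_iff₀ huv] at h
    linarith

/-- The exponent of a solution as a function of its base. -/
noncomputable def exponentFn (N t : ℝ) : ℝ := Real.log (N * t - (N - 1)) / Real.log t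

theorem hasDerivAt_exponentFn {N t : ℝ} (ht : 1 < t) (hN : 0 < N) :
    HasDerivAt (exponentFn N) ((N / (N * t - (N - 1)) * Real.log t -
      Real.log (N * t - (N - 1)) * t⁻¹) / Real.log t ^ 2) t := by
  have hv : 0 < N * t - (N - 1) := by nlinarith
  have hw : 0 < Real.log t := Real.log_pos ht
  have h1 : HasDerivAt (fun t => N * t - (N - 1)) N t := by
    simpa using ((hasDerivAt_id t).const_mul N).sub_const (N - 1)
  exact (h1.log hv.ne').div (Real.hasDerivAt_log (by linarith)) hw.ne'

theorem hasDerivAt_deriv_exponentFn {N t : ℝ} (ht : 1 < t) (hN : 0 < N) :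
    HasDerivAt (fun t => (N / (N * t - (N - 1)) * Real.log t -
      Real.log (N * t - (N - 1)) * t⁻¹) / Real.log t ^ 2)
      ((Real.log (N * t - (N - 1)) * (Real.log t + 2) -
        N * t / (N * t - (N - 1)) * Real.log t * (N * t / (N * t - (N - 1)) * Real.log t + 2)) /
        (t ^ 2 * Real.log t ^ 3)) t := by
  have hv : 0 < N * t - (N - 1) := by nlinarith
  have hw : 0 < Real.log t := Real.log_pos ht
  have ht0 : t ≠ 0 := by linarith
  have h1 : HasDerivAt (fun t => N * t - (N - 1)) N t := by
    simpa using ((hasDerivAt_id t).const_mul N).sub_const (N - 1)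
  have hl := Real.hasDerivAt_log ht0
  have h2 := (((hasDerivAt_const t N).div h1 hv.ne').mul hl).sub
    ((h1.log hv.ne').mul (hasDerivAt_inv ht0))
  have h3 := h2.div (hl.pow 2) (pow_pos hw 2).ne'
  refine h3.congr_deriv ?_
  simp only [Pi.mul_apply, Pi.sub_apply, Pi.div_apply, Pi.pow_apply]
  set v := N * t - (N - 1) with hvdef
  set w := Real.log t
  field_simp
  ring

theorem second_deriv_exponentFn_bounds {N t : ℝ} (ht : 16 ≤ t) (htN : t ≤ N) :
    0 < (Real.log (N * t - (N - 1)) * (Real.log t + 2) -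
        N * t / (N * t - (N - 1)) * Real.log t * (N * t / (N * t - (N - 1)) * Real.log t + 2)) /
        (t ^ 2 * Real.log t ^ 3) ∧
    (Real.log (N * t - (N - 1)) * (Real.log t + 2) -
        N * t / (N * t - (N - 1)) * Real.log t * (N * t / (N * t - (N - 1)) * Real.log t + 2)) /
        (t ^ 2 * Real.log t ^ 3) ≤ Real.log N * (Real.log t + 2) / (t ^ 2 * Real.log t ^ 3) := by
  have hN : 0 < N := by linarith
  have ht0 : 0 < t := by linarith
  have hv : 0 < N * t - (N - 1) := by nlinarith
  have hw : 0 < Real.log t := Real.log_pos (by linarith)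
  set w := Real.log t with hwdef
  set v := N * t - (N - 1) with hvdef
  set r := N * t / v with hr
  have hr1 : 1 ≤ r := by
    rw [hr, one_le_div hv]
    linarith
  have hr2 : r ≤ 1.1 := by
    rw [hr, div_le_iff₀ hv]
    nlinarith
  have hvt : N * (t - 1) ≤ v := by rw [hvdef]; linarith
  have hu : Real.log N + Real.log (t - 1) ≤ Real.log v := by
    rw [← Real.log_mul hN.ne' (by linarith)]
    exact Real.log_le_log (mul_pos hN (by linarith)) hvt
  have hLw : w ≤ Real.log N := Real.log_le_log ht0 htN
  have ht1 : w ≤ 2 * Real.log (t - 1) := by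
    have : w ≤ Real.log ((t - 1) ^ 2) := Real.log_le_log ht0 (by nlinarith)
    rwa [Real.log_pow] at this
  have hu2 : Real.log v ≤ Real.log N + w := by
    rw [hwdef, ← Real.log_mul hN.ne' ht0.ne']
    exact Real.log_le_log hv (by linarith)
  constructor
  · refine div_pos ?_ (by positivity)
    have h1 : r * w ≤ 1.1 * w := by gcongr
    have h2 : r * w * (r * w + 2) ≤ 1.1 * w * (1.1 * w + 2) := by gcongr
    have h3 : 1.5 * w * (w + 2) ≤ Real.log v * (w + 2) := by gcongr; linarith
    nlinarith [mul_pos hw hw]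
  · gcongr
    have h1 : 1 * w * (1 * w + 2) ≤ r * w * (r * w + 2) := by gcongr
    have h2 : Real.log v * (w + 2) ≤ (Real.log N + w) * (w + 2) := by gcongr
    linarith

theorem IsNSol.exponentFn_eq {N x m : ℕ} (h : IsNSol N x m) : exponentFn N x = m := by
  have hx := h.1
  have hx' : (1 : ℝ) < x := by exact_mod_cast hx
  have h1 := h.mul_add_one
  have h2 : (N : ℝ) * x - (N - 1) = (x : ℝ) ^ m := by
    have : ((N * (x - 1) + 1 : ℕ) : ℝ) = ((x ^ m : ℕ) : ℝ) := by rw [h1]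
    push_cast [Nat.cast_sub (by omega : 1 ≤ x)] at this
    linarith
  have := Real.log_pos hx'
  rw [exponentFn, h2, Real.log_pow]
  field_simp

theorem IsNSol.lt_self {N x m : ℕ} (h : IsNSol N x m) : x < N :=
  (Nat.le_self_pow (by have := h.2.1; omega) x).trans_lt h.pow_lt

theorem IsNSol.mod_two_eq {N x m : ℕ} (h : IsNSol N x m) (hx : x % 2 = 1) : m % 2 = N % 2 := by
  rw [← h.2.2, Finset.sum_nat_mod]
  have : ∀ i ∈ Finset.range m, x ^ i % 2 = 1 := fun i _ => by rw [Nat.pow_mod, hx]; simp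
  rw [Finset.sum_congr rfl this]
  simp

theorem IsNSol.gap_lower_bound {N x y z a b c : ℕ} (hx : IsNSol N x a) (hy : IsNSol N y b)
    (hz : IsNSol N z c) (hx2 : x % 2 = 1) (hy2 : y % 2 = 1) (hz2 : z % 2 = 1) (hxy : x < y)
    (hyz : y < z) (hx16 : 16 ≤ x) :
    32 * ((x : ℝ) ^ 2 * Real.log x ^ 3) ≤
      Real.log N * (Real.log x + 2) * ((z : ℝ) - x) ^ 3 := by
  have hxy' : (x : ℝ) < y := by exact_mod_cast hxy
  have hyz' : (y : ℝ) < z := by exact_mod_cast hyz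
  have hx16' : (16 : ℝ) ≤ x := by exact_mod_cast hx16
  have hzN : (z : ℝ) < N := by exact_mod_cast hz.lt_self
  have hw : 0 < Real.log x := Real.log_pos (by linarith)
  have hL : 0 < Real.log N := Real.log_pos (by linarith)
  obtain ⟨M, hM⟩ : ∃ M, M = Real.log N * (Real.log x + 2) / ((x : ℝ) ^ 2 * Real.log x ^ 3) :=
    ⟨_, rfl⟩
  have hM0 : 0 < M := by rw [hM]; positivity
  obtain ⟨h1, h2⟩ := divided_difference_bounds (M := M) hxy' hyz'
    (fun t ht => hasDerivAt_exponentFn (N := N) (by linarith [ht.1]) (by linarith))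
    (fun t ht => hasDerivAt_deriv_exponentFn (N := N) (by linarith [ht.1]) (by linarith))
    (fun t ht => (second_deriv_exponentFn_bounds (by linarith [ht.1]) (by linarith [ht.2])).1)
    (fun t ht => by
      have htx : Real.log x ≤ Real.log t := Real.log_le_log (by linarith) ht.1
      have ht0 : 0 < t := by linarith [ht.1]
      refine (second_deriv_exponentFn_bounds (by linarith [ht.1]) (by linarith [ht.2])).2.trans ?_
      have e : ∀ s w : ℝ, 0 < s → 0 < w → Real.log N * (w + 2) / (s ^ 2 * w ^ 3) =
          Real.log N / s ^ 2 * (1 / w ^ 2 + 2 / w ^ 3) := fun s w hs hw => by field_simp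
      rw [hM, e t _ ht0 (hw.trans_le htx), e x _ (by linarith) hw]
      have hwt : 0 < Real.log t := hw.trans_le htx
      gcongr
      exact ht.1)
  rw [hx.exponentFn_eq, hy.exponentFn_eq, hz.exponentFn_eq] at h1 h2
  obtain ⟨u, hu⟩ : ∃ u, y = x + 2 * u := ⟨(y - x) / 2, by omega⟩
  obtain ⟨v, hv⟩ : ∃ v, z = y + 2 * v := ⟨(z - y) / 2, by omega⟩
  have hab := hx.exponent_lt hy hxy
  have hbc := hy.exponent_lt hz hyz
  have ha2 := hx.mod_two_eq hx2
  have hb2 := hy.mod_two_eq hy2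
  have hc2 := hz.mod_two_eq hz2
  obtain ⟨d, hd⟩ : ∃ d, a = b + 2 * d := ⟨(a - b) / 2, by omega⟩
  obtain ⟨e, he⟩ : ∃ e, b = c + 2 * e := ⟨(b - c) / 2, by omega⟩
  have hD : ((a : ℝ) - b) * (z - y) - (b - c) * (y - x) = 4 * ((d * v - e * u : ℤ) : ℝ) := by
    rw [hv, hu, hd, he]
    push_cast
    ring
  rw [hD] at h1 h2
  have h3 : 0 < ((d * v - e * u : ℤ) : ℝ) := by linarith
  have h4 : (1 : ℝ) ≤ ((d * v - e * u : ℤ) : ℝ) := by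
    have : 0 < (d * v - e * u : ℤ) := by exact_mod_cast h3
    exact_mod_cast this
  have h5 : ((y : ℝ) - x) * (z - y) * (z - x) ≤ (z - x) ^ 3 / 4 := by
    have : ((y : ℝ) - x) * (z - y) ≤ (z - x) ^ 2 / 4 := by nlinarith [sq_nonneg ((y - x : ℝ) - (z - y))]
    have := mul_le_mul_of_nonneg_right this (by linarith : (0 : ℝ) ≤ z - x)
    linarith
  have h6 : M * (((y : ℝ) - x) * (z - y) * (z - x)) ≤ M * ((z - x) ^ 3 / 4) := by gcongr
  have h7 : 32 ≤ M * ((z : ℝ) - x) ^ 3 := by linarith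
  have hpos : 0 < (x : ℝ) ^ 2 * Real.log x ^ 3 := by positivity
  rw [hM, div_mul_eq_mul_div, le_div_iff₀ hpos] at h7
  exact h7

/-! ### Sums of reciprocals over sparse sets -/

theorem inv_cube_le_sub {u v c A s₀ : ℝ} (hu : 0 < u) (hv : 0 < v) (hc : 0 < c)
    (hs : c ≤ s₀ * u) (hA : 3 / (2 * c) * (1 + 5 * s₀ / 6) ≤ A) (h : u ^ 3 + c * u ^ 2 ≤ v ^ 3) :
    1 / u ^ 3 ≤ A * (1 / u ^ 2 - 1 / v ^ 2) := by
  obtain ⟨s, hsd⟩ : ∃ s, s = c / u := ⟨_, rfl⟩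
  have hs0 : 0 < s := by rw [hsd]; positivity
  have hcs : c = s * u := by rw [hsd]; field_simp
  have hss : s ≤ s₀ := by rw [hsd, div_le_iff₀ hu]; exact hs
  obtain ⟨w, hwd⟩ : ∃ w, w = v / u := ⟨_, rfl⟩
  have hw0 : 0 < w := by rw [hwd]; positivity
  have hvw : v = w * u := by rw [hwd]; field_simp
  have hw3 : 1 + s ≤ w ^ 3 := by
    have h1 : u ^ 3 * (1 + s) ≤ u ^ 3 * w ^ 3 := by
      rw [hcs, hvw] at h
      linarith
    exact le_of_mul_le_mul_left h1 (by positivity)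
  have hw2 : (1 + 5 * s / 6) / (1 + s / 6) ≤ w ^ 2 := by
    refine le_of_pow_le_pow_left₀ (n := 3) (by norm_num) (by positivity) ?_
    calc ((1 + 5 * s / 6) / (1 + s / 6)) ^ 3 ≤ (1 + s) ^ 2 := by
          rw [div_pow, div_le_iff₀ (by positivity), ← sub_nonneg]
          have : (1 + s) ^ 2 * (1 + s / 6) ^ 3 - (1 + 5 * s / 6) ^ 3 =
              s ^ 3 * (5 / 54) + s ^ 4 * (5 / 54) + s ^ 5 * (1 / 216) := by ring
          rw [this]
          positivity
      _ ≤ (w ^ 3) ^ 2 := by gcongr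
      _ = (w ^ 2) ^ 3 := by ring
  have hkey : 2 * s / 3 ≤ (1 + 5 * s / 6) * (1 - 1 / w ^ 2) := by
    rw [div_le_iff₀ (by positivity)] at hw2
    have : (1 + 5 * s / 6) * (1 / w ^ 2) ≤ 1 + s / 6 := by
      rw [mul_one_div, div_le_iff₀ (by positivity)]
      linarith
    linarith
  have hpos : 0 ≤ 1 - 1 / w ^ 2 := by
    by_contra! hneg
    have := mul_neg_of_pos_of_neg (by positivity : 0 < 1 + 5 * s / 6) hneg
    linarith
  have hA' : 3 / (2 * c) * (1 + 5 * s / 6) ≤ A := le_trans (by gcongr) hA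
  calc 1 / u ^ 3 = 3 / (2 * c) * (2 * s / 3) / u ^ 2 := by rw [hcs]; field_simp
    _ ≤ 3 / (2 * c) * ((1 + 5 * s / 6) * (1 - 1 / w ^ 2)) / u ^ 2 := by gcongr
    _ = 3 / (2 * c) * (1 + 5 * s / 6) * (1 - 1 / w ^ 2) / u ^ 2 := by ring
    _ ≤ A * (1 - 1 / w ^ 2) / u ^ 2 := by gcongr
    _ = A * (1 / u ^ 2 - 1 / v ^ 2) := by rw [hvw]; field_simp

theorem exists_pos_cube_eq {y : ℝ} (hy : 0 < y) : ∃ u : ℝ, 0 < u ∧ u ^ 3 = y :=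
  ⟨y ^ ((3 : ℝ)⁻¹), by positivity, by
    rw [← Real.rpow_natCast, ← Real.rpow_mul hy.le]
    norm_num⟩

theorem sum_le_add_of_gaps {f g : ℕ → ℝ} (S : Finset ℕ) (hfg : ∀ x ∈ S, f x ≤ g x)
    (hgap : ∀ x ∈ S, ∀ y ∈ S, ∀ z ∈ S, x < y → y < z → f x ≤ g x - g z) :
    ∀ x ∈ S, ∀ h : ℝ, 0 ≤ h → (∀ y ∈ S, x ≤ y) → (∀ y ∈ S, x < y → g y ≤ h) →
      ∑ y ∈ S, f y ≤ g x + h := by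
  induction S using Finset.induction_on_min with
  | empty => simp
  | insert a s has ih =>
    intro x hx h h0 hmin hh
    have hxa : x = a := by
      rcases Finset.mem_insert.1 hx with rfl | hxs
      · rfl
      · exact absurd (hmin a (Finset.mem_insert_self a s)) (not_le.2 (has x hxs))
    subst hxa
    have hxs : x ∉ s := fun hc => (has x hc).false
    rw [Finset.sum_insert hxs]
    rcases s.eq_empty_or_nonempty with rfl | hne
    · simpa using add_le_add (hfg x (Finset.mem_insert_self _ _)) h0
    have sub : ∀ {y}, y ∈ s → y ∈ insert x s := fun hy => Finset.mem_insert_of_mem hy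
    obtain ⟨b, hb, hbmin⟩ := s.exists_min_image id hne
    have ih' := ih (fun y hy => hfg y (sub hy))
      (fun u hu v hv w hw => hgap u (sub hu) v (sub hv) w (sub hw)) b hb
    have hgb := hh b (sub hb) (has b hb)
    rcases (s.filter (b < ·)).eq_empty_or_nonempty with he | hne'
    · have h1 := ih' 0 le_rfl hbmin fun y hy hby =>
        absurd (Finset.mem_filter.2 ⟨hy, hby⟩) (he ▸ Finset.notMem_empty y)
      linarith [hfg x (Finset.mem_insert_self _ _)]
    · obtain ⟨c, hc, hcmax⟩ := (s.filter (b < ·)).exists_max_image g hne'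
      obtain ⟨hcs, hbc⟩ := Finset.mem_filter.1 hc
      have h2 := hgap x (Finset.mem_insert_self _ _) b (sub hb) c (sub hcs) (has b hb) hbc
      rcases le_or_gt 0 (g c) with h0 | h0
      · have h1 := ih' (g c) h0 hbmin fun y hy hby => hcmax y (Finset.mem_filter.2 ⟨hy, hby⟩)
        linarith
      · have h1 := ih' 0 le_rfl hbmin fun y hy hby =>
          (hcmax y (Finset.mem_filter.2 ⟨hy, hby⟩)).trans h0.le
        linarith [hfg x (Finset.mem_insert_self _ _)]

theorem sum_inv_le_of_gaps {Y κ : ℝ} (hY : 0 < Y) (hκ : 0 < κ) (S : Finset ℕ)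
    (hYS : ∀ x ∈ S, Y ≤ x)
    (hgap : ∀ x ∈ S, ∀ y ∈ S, ∀ z ∈ S, x < y → y < z →
      κ ^ 3 * (x : ℝ) ^ 2 ≤ Y ^ 2 * ((z : ℝ) - x) ^ 3) :
    ∑ x ∈ S, 1 / (x : ℝ) ≤ 3 / κ * (1 + 5 * (κ / Y) / 6) := by
  rcases S.eq_empty_or_nonempty with rfl | hne
  · simp only [Finset.sum_empty]
    positivity
  obtain ⟨U, hU, rfl⟩ := exists_pos_cube_eq hY
  obtain ⟨c, hc⟩ : ∃ c, c = κ / U ^ 2 := ⟨_, rfl⟩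
  have hc0 : 0 < c := by rw [hc]; positivity
  obtain ⟨A, hA⟩ : ∃ A, A = 3 / (2 * c) * (1 + 5 * (κ / U ^ 3) / 6) := ⟨_, rfl⟩
  have hA0 : 0 < A := by rw [hA]; positivity
  have root : ∀ n : ℕ, ∃ u : ℝ, 0 < n → 0 < u ∧ u ^ 3 = n := fun n => by
    rcases Nat.eq_zero_or_pos n with rfl | hn
    · exact ⟨0, by simp⟩
    · obtain ⟨u, hu⟩ := exists_pos_cube_eq (Nat.cast_pos.2 hn : (0 : ℝ) < n)
      exact ⟨u, fun _ => hu⟩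
  choose r hr using root
  have hr' : ∀ x ∈ S, 0 < r x ∧ r x ^ 3 = x := fun x hx =>
    hr x (Nat.cast_pos.1 (hY.trans_le (hYS x hx)))
  have hUr : ∀ x ∈ S, U ≤ r x := fun x hx =>
    le_of_pow_le_pow_left₀ (n := 3) (by norm_num) (hr' x hx).1.le
      ((hYS x hx).trans_eq (hr' x hx).2.symm)
  have key : ∀ x ∈ S, ∀ v : ℝ, 0 < v → r x ^ 3 + c * r x ^ 2 ≤ v ^ 3 →
      1 / (x : ℝ) ≤ A * (1 / r x ^ 2 - 1 / v ^ 2) := fun x hx v hv h => by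
    rw [← (hr' x hx).2]
    refine inv_cube_le_sub (s₀ := κ / U ^ 3) (hr' x hx).1 hv hc0 ?_ hA.ge h
    calc c = κ / U ^ 3 * U := by rw [hc]; field_simp
      _ ≤ κ / U ^ 3 * r x := by gcongr; exact hUr x hx
  have hfg : ∀ x ∈ S, 1 / (x : ℝ) ≤ A / r x ^ 2 := fun x hx => by
    have hrx := (hr' x hx).1
    obtain ⟨v, hv, hv3⟩ := exists_pos_cube_eq (by positivity : 0 < r x ^ 3 + c * r x ^ 2)
    have h1 := key x hx v hv hv3.ge
    have : 0 < A * (1 / v ^ 2) := by positivity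
    have e : A / r x ^ 2 = A * (1 / r x ^ 2) := by ring
    rw [e]
    linarith
  have hgap' : ∀ x ∈ S, ∀ y ∈ S, ∀ z ∈ S, x < y → y < z →
      1 / (x : ℝ) ≤ A / r x ^ 2 - A / r z ^ 2 := fun x hx y hy z hz hxy hyz => by
    have hrx := (hr' x hx).1
    have hzx : (0 : ℝ) ≤ z - x := sub_nonneg.2 (by exact_mod_cast (hxy.trans hyz).le)
    have h1 : c * r x ^ 2 ≤ z - x := by
      refine le_of_pow_le_pow_left₀ (n := 3) (by norm_num) hzx ?_
      have h2 := hgap x hx y hy z hz hxy hyz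
      rw [← div_le_iff₀' (by positivity)] at h2
      refine le_trans (le_of_eq ?_) h2
      rw [hc, ← (hr' x hx).2]
      field_simp
    have h2 := key x hx (r z) (hr' z hz).1 (by rw [(hr' x hx).2, (hr' z hz).2]; linarith)
    calc 1 / (x : ℝ) ≤ A * (1 / r x ^ 2 - 1 / r z ^ 2) := h2
      _ = A / r x ^ 2 - A / r z ^ 2 := by ring
  have hB : ∀ x ∈ S, A / r x ^ 2 ≤ A / U ^ 2 := fun x hx => by
    have := hUr x hx
    gcongr
  obtain ⟨b, hb, hbmin⟩ := S.exists_min_image id hne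
  calc ∑ x ∈ S, 1 / (x : ℝ) ≤ A / r b ^ 2 + A / U ^ 2 :=
        sum_le_add_of_gaps S hfg hgap' b hb _ (by positivity) hbmin fun y hy _ => hB y hy
    _ ≤ A / U ^ 2 + A / U ^ 2 := by gcongr; exact hUr b hb
    _ = 3 / κ * (1 + 5 * (κ / U ^ 3) / 6) := by
        rw [hA, hc]
        field_simp
        ring

/-! ### The product -/

theorem prod_div_sub_one_le_exp {S : Finset ℕ} {Y : ℕ} (hY : 2 ≤ Y) (hS : ∀ x ∈ S, Y ≤ x) :
    ∏ q ∈ S, (q : ℝ) / ((q : ℝ) - 1) ≤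
      Real.exp ((Y : ℝ) / (Y - 1) * ∑ x ∈ S, 1 / (x : ℝ)) := by
  rw [Finset.mul_sum, Real.exp_sum]
  have hY' : (2 : ℝ) ≤ Y := by exact_mod_cast hY
  have hx' : ∀ x ∈ S, (Y : ℝ) ≤ x := fun x hx => by exact_mod_cast hS x hx
  refine Finset.prod_le_prod (fun x hx => ?_) fun x hx => ?_
  · have := hx' x hx
    exact div_nonneg (by linarith) (by linarith)
  · have hx := hx' x hx
    have h1 : (x : ℝ) / (x - 1) = 1 / (x - 1) + 1 := by
      rw [div_add_one (by linarith)]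
      ring
    have h2 : 1 / ((x : ℝ) - 1) ≤ (Y : ℝ) / (Y - 1) * (1 / x) := by
      rw [div_mul_div_comm, div_le_div_iff₀ (by linarith) (by nlinarith)]
      nlinarith
    rw [h1]
    exact (Real.add_one_le_exp _).trans (Real.exp_le_exp.2 h2)

theorem prod_primes_div_sub_one_le {S : Finset ℕ}
    (hS : ∀ p ∈ S, p.Prime ∧ 127 ≤ p ∧ p < 3000) :
    ∏ p ∈ S, (p : ℝ) / ((p : ℝ) - 1) ≤ 1.641 := by
  let T : Finset ℕ := (Finset.Ico 127 3000).filter fun n => Nat.gcd n 32589158477190044730 = 1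
  have hST : S ⊆ T := fun p hp => by
    obtain ⟨pp, h1, h2⟩ := hS p hp
    refine Finset.mem_filter.2 ⟨Finset.mem_Ico.2 ⟨h1, h2⟩, ?_⟩
    rw [← Nat.coprime_iff_gcd_eq_one, pp.coprime_iff_not_dvd]
    have e : 32589158477190044730 = 2 * 3 * 5 * 7 * 11 * 13 * 17 * 19 * 23 * 29 * 31 * 37 * 41 *
      43 * 47 * 53 := by norm_num
    intro hd
    rw [e] at hd
    simp only [pp.dvd_mul] at hd
    have : ∀ n, 0 < n → n ≤ 53 → ¬ p ∣ n := fun n hn hn' hd => by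
      have := Nat.le_of_dvd hn hd
      omega
    rcases hd with (((((((((((((((h | h) | h) | h) | h) | h) | h) | h) | h) | h) | h) | h) | h) | h) | h) | h) <;>
      exact this _ (by norm_num) (by norm_num) h
  have hT : ∀ n ∈ T, (127 : ℝ) ≤ n := fun n hn => by
    exact_mod_cast (Finset.mem_Ico.1 (Finset.mem_filter.1 hn).1).1
  have hnat : 1000 * ∏ n ∈ T, n ≤ 1641 * ∏ n ∈ T, (n - 1) := by
    decide +kernel
  have hreal : 1000 * ∏ n ∈ T, (n : ℝ) ≤ 1641 * ∏ n ∈ T, ((n : ℝ) - 1) := by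
    have h1 : ∏ n ∈ T, ((n : ℝ) - 1) = ((∏ n ∈ T, (n - 1) : ℕ) : ℝ) := by
      rw [Nat.cast_prod]
      refine Finset.prod_congr rfl fun n hn => ?_
      have : 1 ≤ n := by exact_mod_cast (by linarith [hT n hn] : (1 : ℝ) ≤ n)
      push_cast [this]
      rfl
    rw [h1, ← Nat.cast_prod]
    exact_mod_cast hnat
  have hpos : 0 < ∏ n ∈ T, ((n : ℝ) - 1) := Finset.prod_pos fun n hn => by linarith [hT n hn]
  calc ∏ p ∈ S, (p : ℝ) / ((p : ℝ) - 1) ≤ ∏ p ∈ T, (p : ℝ) / ((p : ℝ) - 1) := by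
        refine Finset.prod_le_prod_of_subset_of_one_le hST (fun p hp => ?_) fun p hp _ => ?_
        · have := hT p (hST hp)
          exact div_nonneg (by linarith) (by linarith)
        · have := hT p hp
          rw [one_le_div (by linarith)]
          linarith
    _ ≤ 1.641 := by
        rw [Finset.prod_div_distrib, div_le_iff₀ hpos]
        linarith

theorem IsNSol.sum_inv_le {N Y : ℕ} {κ w : ℝ} {S : Finset ℕ} (hN : 2 ≤ N) (hY : 16 ≤ Y)
    (hS : ∀ x ∈ S, x % 2 = 1 ∧ Y ≤ x ∧ ∃ m, IsNSol N x m) (hκ : 0 < κ) (hw0 : 0 < w)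
    (hw : w ≤ Real.log Y) (h : κ ^ 3 * (w + 2) * Real.log N ≤ 32 * (Y : ℝ) ^ 2 * w ^ 3) :
    ∑ x ∈ S, 1 / (x : ℝ) ≤ 3 / κ * (1 + 5 * (κ / Y) / 6) := by
  have hY0 : (0 : ℝ) < Y := by
    have : 0 < Y := by omega
    exact_mod_cast this
  have hL : 0 < Real.log N := Real.log_pos (by exact_mod_cast hN)
  refine sum_inv_le_of_gaps hY0 hκ S (fun x hx => by exact_mod_cast (hS x hx).2.1)
    fun x hx y hy z hz hxy hyz => ?_
  obtain ⟨hx2, hYx, a, ha⟩ := hS x hx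
  obtain ⟨hy2, -, b, hb⟩ := hS y hy
  obtain ⟨hz2, -, c, hc⟩ := hS z hz
  have hgap := ha.gap_lower_bound hb hc hx2 hy2 hz2 hxy hyz (hY.trans hYx)
  have hW : w ≤ Real.log x := hw.trans (Real.log_le_log hY0 (by exact_mod_cast hYx))
  set W := Real.log x
  set D := ((z : ℝ) - x) ^ 3
  set L := Real.log N
  have hW0 : 0 < W := hw0.trans_le hW
  have hmono : w ^ 3 * (W + 2) ≤ W ^ 3 * (w + 2) := by
    have h1 : w ^ 2 ≤ W ^ 2 := by gcongr
    have h2 : w ^ 3 ≤ W ^ 3 := by gcongr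
    have h3 := mul_le_mul_of_nonneg_left h1 (mul_pos hw0 hW0).le
    nlinarith
  have hpos : 0 < L * (w + 2) * (W + 2) := by positivity
  refine le_of_mul_le_mul_left ?_ hpos
  calc L * (w + 2) * (W + 2) * (κ ^ 3 * (x : ℝ) ^ 2)
      = κ ^ 3 * (w + 2) * L * ((x : ℝ) ^ 2 * (W + 2)) := by ring
    _ ≤ 32 * (Y : ℝ) ^ 2 * w ^ 3 * ((x : ℝ) ^ 2 * (W + 2)) := by gcongr
    _ = 32 * (Y : ℝ) ^ 2 * (x : ℝ) ^ 2 * (w ^ 3 * (W + 2)) := by ring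
    _ ≤ 32 * (Y : ℝ) ^ 2 * (x : ℝ) ^ 2 * (W ^ 3 * (w + 2)) := by gcongr
    _ = (Y : ℝ) ^ 2 * (w + 2) * (32 * ((x : ℝ) ^ 2 * W ^ 3)) := by ring
    _ ≤ (Y : ℝ) ^ 2 * (w + 2) * (L * (W + 2) * D) := by gcongr
    _ = L * (w + 2) * (W + 2) * ((Y : ℝ) ^ 2 * D) := by ring

theorem le_log_of_127_le {y : ℝ} (hy : 127 ≤ y) : 4.8 ≤ Real.log y := by
  refine le_trans ?_ (Real.log_le_log (by norm_num) hy)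
  have h1 : Real.log 128 = 7 * Real.log 2 := by
    rw [show (128 : ℝ) = 2 ^ 7 by norm_num, Real.log_pow]
    norm_num
  have h2 : Real.log (128 / 127) ≤ 128 / 127 - 1 := Real.log_le_sub_one_of_pos (by norm_num)
  rw [Real.log_div (by norm_num) (by norm_num)] at h2
  have := Real.log_two_gt_d9
  linarith

theorem eight_le_log_3000 : 8 ≤ Real.log 3000 := by
  rw [Real.le_log_iff_exp_le (by norm_num)]
  calc Real.exp 8 = Real.exp 1 ^ 8 := by rw [← Real.exp_nat_mul]; norm_num
    _ ≤ 2.7182818286 ^ 8 := by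
        have := Real.exp_one_lt_d9
        have := Real.exp_pos 1
        gcongr
    _ ≤ 3000 := by norm_num

theorem prod_div_sub_one_lt_of_log_le {N q : ℕ} {S : Finset ℕ} (hN : 2 ≤ N) (hq : 127 ≤ q)
    (hS : ∀ x ∈ S, x % 2 = 1 ∧ q ≤ x ∧ ∃ m, IsNSol N x m)
    (hL : Real.log N ≤ (q * Real.log q) ^ 2 / 4) :
    ∏ x ∈ S, (x : ℝ) / ((x : ℝ) - 1) < 2.07913 := by
  have hq' : (127 : ℝ) ≤ q := by exact_mod_cast hq
  have hw := le_log_of_127_le hq'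
  have hsum : ∑ x ∈ S, 1 / (x : ℝ) ≤ 3 / 4.48 * (1 + 5 * (4.48 / q) / 6) := by
    refine IsNSol.sum_inv_le hN (by omega) hS (by norm_num) (by linarith) le_rfl ?_
    set w := Real.log q
    calc (4.48 : ℝ) ^ 3 * (w + 2) * Real.log N ≤ 4.48 ^ 3 * (w + 2) * ((q * w) ^ 2 / 4) := by
          gcongr
      _ = (q : ℝ) ^ 2 * w ^ 2 / 4 * (4.48 ^ 3 * (w + 2)) := by ring
      _ ≤ (q : ℝ) ^ 2 * w ^ 2 / 4 * (128 * w) := by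
          refine mul_le_mul_of_nonneg_left ?_ (by positivity)
          norm_num at hw ⊢
          linarith
      _ = 32 * (q : ℝ) ^ 2 * w ^ 3 := by ring
  have hsum' : ∑ x ∈ S, 1 / (x : ℝ) ≤ 0.69 := by
    have : 4.48 / (q : ℝ) ≤ 4.48 / 127 := by gcongr
    refine hsum.trans ?_
    calc 3 / 4.48 * (1 + 5 * (4.48 / (q : ℝ)) / 6) ≤ 3 / 4.48 * (1 + 5 * (4.48 / 127) / 6) := by
          gcongr
      _ ≤ 0.69 := by norm_num
  refine (prod_div_sub_one_le_exp (Y := 127) (by norm_num) fun x hx =>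
    hq.trans (hS x hx).2.1).trans_lt ?_
  rw [← Real.lt_log_iff_exp_lt (by norm_num)]
  have h1 : Real.log 2.07913 = Real.log 2 + Real.log 1.039565 := by
    rw [← Real.log_mul (by norm_num) (by norm_num)]
    norm_num
  have h2 : 0.69 * (127 / 126 : ℝ) < 0.6956 := by norm_num
  have h3 : 1 - (1.039565 : ℝ)⁻¹ ≤ Real.log 1.039565 := Real.one_sub_inv_le_log_of_pos (by norm_num)
  have h4 : (0.03 : ℝ) ≤ 1 - (1.039565 : ℝ)⁻¹ := by norm_num
  have h5 := Real.log_two_gt_d9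
  push_cast
  norm_num at hsum' h1 h2 h3 h4 ⊢
  linarith

theorem prod_div_sub_one_lt_of_log_le_const {N : ℕ} {S : Finset ℕ} (hN : 2 ≤ N)
    (hS : ∀ x ∈ S, x.Prime ∧ 127 ≤ x ∧ ∃ m, IsNSol N x m) (hL : Real.log N ≤ 4500000) :
    ∏ x ∈ S, (x : ℝ) / ((x : ℝ) - 1) < 2.07913 := by
  rw [← Finset.prod_filter_mul_prod_filter_not S (· < 3000)]
  have h1 : ∏ x ∈ S.filter (· < 3000), (x : ℝ) / ((x : ℝ) - 1) ≤ 1.641 :=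
    prod_primes_div_sub_one_le fun p hp => by
      obtain ⟨hp, h3⟩ := Finset.mem_filter.1 hp
      exact ⟨(hS p hp).1, (hS p hp).2.1, h3⟩
  have hS' : ∀ x ∈ S.filter (¬ · < 3000), x % 2 = 1 ∧ 3000 ≤ x ∧ ∃ m, IsNSol N x m := fun x hx => by
    obtain ⟨hx, h3⟩ := Finset.mem_filter.1 hx
    obtain ⟨hp, h127, hm⟩ := hS x hx
    exact ⟨hp.eq_two_or_odd.resolve_left (by omega), by omega, hm⟩
  have hsum : ∑ x ∈ S.filter (¬ · < 3000), 1 / (x : ℝ) ≤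
      3 / 14.85 * (1 + 5 * (14.85 / (3000 : ℕ)) / 6) := by
    refine IsNSol.sum_inv_le (w := 8) hN (by norm_num) hS' (by norm_num) (by norm_num)
      (by exact_mod_cast eight_le_log_3000) ?_
    push_cast
    norm_num
    linarith
  have h2 := prod_div_sub_one_le_exp (Y := 3000) (by norm_num) fun x hx => (hS' x hx).2.1
  have h3 : ((3000 : ℕ) : ℝ) / ((3000 : ℕ) - 1) * ∑ x ∈ S.filter (¬ · < 3000), 1 / (x : ℝ) ≤
      0.21 := by
    calc _ ≤ ((3000 : ℕ) : ℝ) / ((3000 : ℕ) - 1) *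
          (3 / 14.85 * (1 + 5 * (14.85 / (3000 : ℕ)) / 6)) := by
          have : (0 : ℝ) ≤ ((3000 : ℕ) : ℝ) / ((3000 : ℕ) - 1) := by norm_num
          gcongr
      _ ≤ 0.21 := by norm_num
  have h4 : Real.exp 0.21 ≤ 1.26 := by
    have := Real.abs_exp_sub_one_sub_id_le (x := 0.21) (by rw [abs_of_pos] <;> norm_num)
    have := (abs_le.1 this).2
    norm_num at this ⊢
    linarith
  have h5 := h2.trans ((Real.exp_le_exp.2 h3).trans h4)
  calc _ ≤ (1.641 : ℝ) * 1.26 := by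
        refine mul_le_mul h1 h5 (Finset.prod_nonneg fun x hx => ?_) (by norm_num)
        have : (3000 : ℝ) ≤ x := by exact_mod_cast (hS' x hx).2.1
        exact div_nonneg (by linarith) (by linarith)
    _ < 2.07913 := by norm_num

open scoped Classical in
theorem stmt3 (N q₁ m₁ : ℕ) (hN : 2 ≤ N) (hq₁ : q₁.Prime) (h₁ : IsNSol N q₁ m₁)
    (hmin : ∀ q m : ℕ, q.Prime → IsNSol N q m → q₁ ≤ q) :
    ∏ q ∈ (Finset.range (N + 1)).filter (fun q => q₁ < q ∧ q.Prime ∧ ∃ m, IsNSol N q m),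
      (q : ℝ) / ((q : ℝ) - 1) < 2.07913 := by
  obtain ⟨S, hSdef⟩ : ∃ S, S = (Finset.range (N + 1)).filter
    (fun q => q₁ < q ∧ q.Prime ∧ ∃ m, IsNSol N q m) := ⟨_, rfl⟩
  rw [← hSdef]
  have hS : ∀ q ∈ S, q₁ < q ∧ q.Prime ∧ ∃ m, IsNSol N q m := fun q hq => by
    rw [hSdef] at hq
    exact (Finset.mem_filter.1 hq).2
  rcases S.eq_empty_or_nonempty with rfl | hne
  · norm_num
  by_cases h5 : q₁ = 2 ∧ 5 ∈ S
  · obtain ⟨rfl, h5⟩ := h5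
    obtain ⟨-, -, n, hn⟩ := hS 5 h5
    have hN31 := eq_31_of_isNSol_two_five h₁ hn
    have hS5 : S = {5} := by
      refine Finset.eq_singleton_iff_unique_mem.2 ⟨h5, fun q hq => ?_⟩
      obtain ⟨hlt, pq, k, hk⟩ := hS q hq
      by_contra hq5
      exact not_isNSol_of_lt_127 hq₁ pq hlt (by have := hk.lt_self; omega) (by tauto) h₁ hk
    rw [hS5]
    norm_num
  · have h127 : ∀ q ∈ S, 127 ≤ q := fun q hq => by
      obtain ⟨hlt, pq, k, hk⟩ := hS q hq
      by_contra! hq127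
      refine not_isNSol_of_lt_127 hq₁ pq hlt hq127 ?_ h₁ hk
      rintro ⟨h2, rfl⟩
      exact h5 ⟨h2, hq⟩
    obtain ⟨q, hq, hqmin⟩ := S.exists_min_image id hne
    obtain ⟨hlt, pq, k, hk⟩ := hS q hq
    rcases le_or_gt (Real.log N) ((q * Real.log q) ^ 2 / 4) with hL | hL
    · refine prod_div_sub_one_lt_of_log_le hN (h127 q hq) (fun x hx => ?_) hL
      have := h127 x hx
      exact ⟨(hS x hx).2.1.eq_two_or_odd.resolve_left (by omega), hqmin x hx, (hS x hx).2.2⟩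
    · exact prod_div_sub_one_lt_of_log_le_const hN
        (fun x hx => ⟨(hS x hx).2.1, h127 x hx, (hS x hx).2.2⟩)
        (h₁.log_le hk hq₁ pq hlt (h127 q hq) hL)
end

section
/- Let k ≥ 1 be an integer, M > 0 a real number, and f a k-times continuously differentiable real function on [M, 2M]. Assume there exist real constants λ > 0 and c ≥ 1 such that λ ≤ |f^{(k)}(x)| ≤ cλ for all x ∈ [M, 2M]. Put α = 2k·(2c)^{2/(k² + k)}. If δ > 0 satisfies (k+1)!·δ < λ, then the number of integers x with M ≤ x ≤ 2M and ‖f(x)‖ < δ is at most α·M·λ^{2/(k² + k)} + 4k. -/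
/-- Iterated Rolle: if `F 0` vanishes at `n + 1` points, then its `n`-th derivative `F n` vanishes
somewhere. -/
theorem exists_iterated_deriv_eq_zero {a b : ℝ} (n : ℕ) (F : ℕ → ℝ → ℝ)
    (hc : ∀ j < n, ContinuousOn (F j) (Set.Icc a b))
    (hd : ∀ j < n, ∀ x ∈ Set.Ioo a b, HasDerivAt (F j) (F (j + 1) x) x)
    (y : ℕ → ℝ) (hy : ∀ i < n, y i < y (i + 1)) (hmem : ∀ i ≤ n, y i ∈ Set.Icc a b)
    (h0 : ∀ i ≤ n, F 0 (y i) = 0) : ∃ ξ ∈ Set.Icc a b, F n ξ = 0 := by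
  induction n generalizing F y with
  | zero => exact ⟨y 0, hmem 0 le_rfl, h0 0 le_rfl⟩
  | succ n ih =>
    have key : ∀ i, ∃ z, i ≤ n → z ∈ Set.Ioo (y i) (y (i + 1)) ∧ F 1 z = 0 := by
      intro i
      by_cases hi : i ≤ n
      · have h1 := hmem i (by lia)
        have h2 := hmem (i + 1) (by lia)
        obtain ⟨z, hz, hz0⟩ := exists_hasDerivAt_eq_zero (f := F 0) (f' := F 1) (hy i (by lia))
          ((hc 0 (by lia)).mono (Set.Icc_subset_Icc h1.1 h2.2))
          (by rw [h0 i (by lia), h0 (i + 1) (by lia)])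
          (fun x hx => hd 0 (by lia) x ⟨h1.1.trans_lt hx.1, hx.2.trans_le h2.2⟩)
        exact ⟨z, fun _ => ⟨hz, hz0⟩⟩
      · exact ⟨0, fun h => absurd h hi⟩
    choose z hz using key
    refine ih (fun j => F (j + 1)) (fun j hj => hc _ (by lia)) (fun j hj => hd _ (by lia)) z
      (fun i hi => (hz i hi.le).1.2.trans (hz (i + 1) hi).1.1) (fun i hi => ?_)
      (fun i hi => (hz i hi).2)
    have h1 := (hz i hi).1
    exact ⟨(hmem i (by lia)).1.trans h1.1.le, h1.2.le.trans (hmem (i + 1) (by lia)).2⟩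

open Polynomial in
/-- Mean value theorem for divided differences. -/
theorem exists_iteratedDerivWithin_eq_divided_difference {a b : ℝ} (hab : a < b) {k : ℕ}
    {f : ℝ → ℝ} (hf : ContDiffOn ℝ k f (Set.Icc a b)) (y : ℕ → ℝ)
    (hy : ∀ i j, i < j → j ≤ k → y i < y j) (hmem : ∀ i ≤ k, y i ∈ Set.Icc a b) :
    ∃ ξ ∈ Set.Icc a b, iteratedDerivWithin k f (Set.Icc a b) ξ =
      k.factorial * ∑ i ∈ Finset.range (k + 1),
        f (y i) / ∏ j ∈ (Finset.range (k + 1)).erase i, (y i - y j) := by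
  have hinj : Set.InjOn y (Finset.range (k + 1)) := by
    intro i hi j hj h
    simp only [Finset.coe_range, Set.mem_Iio] at hi hj
    rcases lt_trichotomy i j with h1 | h1 | h1
    · exact absurd h (hy i j h1 (by lia)).ne
    · exact h1
    · exact absurd h (hy j i h1 (by lia)).ne'
  set P := Lagrange.interpolate (Finset.range (k + 1)) y (fun i => f (y i)) with hP
  have hs : UniqueDiffOn ℝ (Set.Icc a b) := uniqueDiffOn_Icc hab
  obtain ⟨ξ, hξ, h⟩ := exists_iterated_deriv_eq_zero (a := a) (b := b) k
    (fun j x => iteratedDerivWithin j f (Set.Icc a b) x - (derivative^[j] P).eval x)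
    (fun j hj => (hf.continuousOn_iteratedDerivWithin (by exact_mod_cast hj.le) hs).sub
      (Polynomial.continuous _).continuousOn)
    (fun j hj x hx => by
      have hd := hf.differentiableOn_iteratedDerivWithin (m := j) (by exact_mod_cast hj) hs x
        (Set.Ioo_subset_Icc_self hx)
      have hn : Set.Icc a b ∈ nhds x := Icc_mem_nhds hx.1 hx.2
      rw [iteratedDerivWithin_succ, Function.iterate_succ_apply']
      exact (hd.hasDerivWithinAt.hasDerivAt hn).sub (Polynomial.hasDerivAt _ _))
    y (fun i hi => hy i (i + 1) (by lia) (by lia)) hmem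
    (fun i hi => by
      have := Lagrange.eval_interpolate_at_node (fun i => f (y i)) hinj
        (Finset.mem_range.2 (Nat.lt_succ_of_le hi))
      simp only [iteratedDerivWithin_zero, Function.iterate_zero, id_eq, hP, this, sub_self])
  refine ⟨ξ, hξ, ?_⟩
  rw [sub_eq_zero.1 h, hP, Lagrange.iterate_derivative_interpolate _ hinj (by simp)]
  simp [eval_finsetSum]

theorem prod_erase_sub_dvd_prod_sub (y : ℕ → ℤ) (k i : ℕ) (hi : i ≤ k) :
    ∏ j ∈ (Finset.range (k + 1)).erase i, (y i - y j) ∣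
      ∏ a ∈ Finset.range (k + 1), ∏ b ∈ Finset.range a, (y a - y b) := by
  induction k with
  | zero =>
    obtain rfl : i = 0 := by lia
    simp
  | succ k ih =>
    rw [Finset.prod_range_succ _ (k + 1)]
    rcases eq_or_lt_of_le hi with rfl | h
    · have : (Finset.range (k + 1 + 1)).erase (k + 1) = Finset.range (k + 1) := by grind
      rw [this]
      exact dvd_mul_left _ _
    · have : (Finset.range (k + 1 + 1)).erase i =
          insert (k + 1) ((Finset.range (k + 1)).erase i) := by grind
      rw [this, Finset.prod_insert (by simp), mul_comm]
      refine mul_dvd_mul (ih (by lia)) (dvd_trans ?_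
        (Finset.dvd_prod_of_mem _ (Finset.mem_range.2 (h : i < k + 1))))
      rw [← neg_dvd, neg_sub]

/-- A nonzero integral combination of divided-difference weights is at least the reciprocal of the
corresponding power of the span of the nodes. -/
theorem one_le_abs_sum_mul_span_pow (k : ℕ) (y n : ℕ → ℤ)
    (hy : ∀ i j, i < j → j ≤ k → y i < y j)
    (h0 : ∑ i ∈ Finset.range (k + 1),
      (n i : ℝ) / ∏ j ∈ (Finset.range (k + 1)).erase i, ((y i : ℝ) - y j) ≠ 0) :
    1 ≤ |∑ i ∈ Finset.range (k + 1),
      (n i : ℝ) / ∏ j ∈ (Finset.range (k + 1)).erase i, ((y i : ℝ) - y j)| *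
        ((y k - y 0 : ℤ) : ℝ) ^ (∑ a ∈ Finset.range (k + 1), a) := by
  set D := ∑ i ∈ Finset.range (k + 1),
      (n i : ℝ) / ∏ j ∈ (Finset.range (k + 1)).erase i, ((y i : ℝ) - y j) with hD
  set V : ℤ := ∏ a ∈ Finset.range (k + 1), ∏ b ∈ Finset.range a, (y a - y b) with hV
  have hVpos : 0 < V := Finset.prod_pos fun a ha => Finset.prod_pos fun b hb => by
    simp only [Finset.mem_range] at ha hb
    linarith [hy b a hb (by lia)]
  have hmono : ∀ i j, i ≤ j → j ≤ k → y i ≤ y j := fun i j hij hj => by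
    rcases hij.eq_or_lt with rfl | h
    · exact le_rfl
    · exact (hy i j h hj).le
  have hVle : V ≤ (y k - y 0) ^ (∑ a ∈ Finset.range (k + 1), a) := by
    rw [hV, ← Finset.prod_pow_eq_pow_sum]
    refine Finset.prod_le_prod (fun a ha => Finset.prod_nonneg fun b hb => ?_) fun a ha => ?_
    · simp only [Finset.mem_range] at ha hb
      linarith [hy b a hb (by lia)]
    · simp only [Finset.mem_range] at ha
      calc ∏ b ∈ Finset.range a, (y a - y b) ≤ ∏ b ∈ Finset.range a, (y k - y 0) := by
            refine Finset.prod_le_prod (fun b hb => ?_) fun b hb => ?_ <;>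
              simp only [Finset.mem_range] at hb
            · linarith [hy b a hb (by lia)]
            · linarith [hmono a k (by lia) le_rfl, hmono 0 b (by lia) (by lia)]
        _ = _ := by simp
  have hint : ∃ m : ℤ, D * V = m := by
    choose q hq using fun i : ℕ => fun hi : i ≤ k => prod_erase_sub_dvd_prod_sub y k i hi
    refine ⟨∑ i ∈ (Finset.range (k + 1)).attach,
      n i * q i (Nat.lt_succ_iff.1 (Finset.mem_range.1 i.2)), ?_⟩
    rw [hD, Finset.sum_mul, ← Finset.sum_attach]
    push_cast
    refine Finset.sum_congr rfl fun i _ => ?_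
    have hi : (i : ℕ) ≤ k := Nat.lt_succ_iff.1 (Finset.mem_range.1 i.2)
    have hVi := hq i hi
    rw [← hV] at hVi
    have hne : (∏ j ∈ (Finset.range (k + 1)).erase i, (y i - y j)) ≠ 0 := by
      intro h
      rw [h, zero_mul] at hVi
      exact hVpos.ne' hVi
    have hne' : ((∏ j ∈ (Finset.range (k + 1)).erase i, (y i - y j) : ℤ) : ℝ) ≠ 0 := by
      exact_mod_cast hne
    have hVr : (V : ℝ) = ((∏ j ∈ (Finset.range (k + 1)).erase i, (y i - y j) : ℤ) : ℝ) *
        q i hi := by exact_mod_cast hVi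
    rw [hVr]
    push_cast at hne' ⊢
    field_simp
  obtain ⟨m, hm⟩ := hint
  have hVr : (0 : ℝ) < V := by exact_mod_cast hVpos
  have hm0 : m ≠ 0 := by
    rintro rfl
    rw [Int.cast_zero] at hm
    exact (mul_ne_zero h0 hVr.ne') hm
  have h1 : (1 : ℝ) ≤ |(m : ℝ)| := by exact_mod_cast Int.one_le_abs hm0
  calc (1 : ℝ) ≤ |D| * |(V : ℝ)| := by rwa [← abs_mul, hm]
    _ = |D| * V := by rw [abs_of_pos hVr]
    _ ≤ _ := mul_le_mul_of_nonneg_left (by exact_mod_cast hVle) (abs_nonneg _)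

theorem card_le_of_span_ge (k : ℕ) (hk : 1 ≤ k) {M a : ℝ} (hM : 0 ≤ M) (ha : 0 < a) (S : Finset ℤ)
    (hS : ∀ x ∈ S, M ≤ x ∧ (x : ℝ) ≤ 2 * M)
    (hspan : ∀ y : ℕ → ℤ, (∀ i j, i < j → j ≤ k → y i < y j) → (∀ i ≤ k, y i ∈ S) →
      a ≤ ((y k - y 0 : ℤ) : ℝ)) :
    (S.card : ℝ) ≤ k * (M / a) + k := by
  rcases Nat.eq_zero_or_pos S.card with h | hN
  · rw [h]
    have : 0 ≤ M / a := by positivity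
    push_cast
    positivity
  set N := S.card with hNdef
  let y : ℕ → ℤ := fun i => if h : i < N then S.orderEmbOfFin rfl ⟨i, h⟩ else 0
  have hylt : ∀ i j, i < j → j < N → y i < y j := by
    intro i j hij hj
    simp only [y, hj, hij.trans hj, dif_pos]
    exact (S.orderEmbOfFin rfl).strictMono hij
  have hymem : ∀ i < N, y i ∈ S := by
    intro i hi
    simp only [y, hi, dif_pos]
    exact S.orderEmbOfFin_mem rfl _
  have hstep : ∀ j : ℕ, j * k < N → (j : ℝ) * a ≤ ((y (j * k) - y 0 : ℤ) : ℝ) := by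
    intro j
    induction j with
    | zero => simp
    | succ j ih =>
      intro hj
      have hj' : j * k + k < N := by rwa [Nat.succ_mul] at hj
      have h1 := ih (by lia)
      have h2 := hspan (fun i => y (j * k + i)) (fun i i' h h' => hylt _ _ (by lia) (by lia))
        (fun i hi => hymem _ (by lia))
      rw [Nat.succ_mul]
      push_cast at h1 h2 ⊢
      simp only [add_zero] at h2
      linarith
  have hq : (N - 1) / k * k < N := by
    have := Nat.div_mul_le_self (N - 1) k
    lia
  have h1 := hstep _ hq
  have h2 := (hS _ (hymem _ hq)).2
  have h3 := (hS _ (hymem 0 hN)).1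
  have h4 : (((N - 1) / k : ℕ) : ℝ) ≤ M / a := by
    rw [le_div_iff₀ ha]
    push_cast at h1
    linarith
  have h5 : N ≤ k * ((N - 1) / k) + k := by
    have := Nat.div_add_mod (N - 1) k
    have := Nat.mod_lt (N - 1) hk
    lia
  calc (N : ℝ) ≤ k * (((N - 1) / k : ℕ) : ℝ) + k := by exact_mod_cast h5
    _ ≤ _ := by gcongr

/-- Integer points close to which a function with controlled `k`-th derivative is nearly integral
are spread out: `k + 1` of them span a long interval. -/
theorem one_le_mul_span_pow_of_near_integers {a b : ℝ} (hab : a < b) {k : ℕ} {f : ℝ → ℝ}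
    (hf : ContDiffOn ℝ k f (Set.Icc a b)) {lam c δ : ℝ}
    (hder : ∀ x ∈ Set.Icc a b, lam ≤ |iteratedDerivWithin k f (Set.Icc a b) x| ∧
      |iteratedDerivWithin k f (Set.Icc a b) x| ≤ c * lam)
    (hfact : (Nat.factorial (k + 1) : ℝ) * δ < lam) (y : ℕ → ℤ)
    (hy : ∀ i j, i < j → j ≤ k → y i < y j) (hmem : ∀ i ≤ k, (y i : ℝ) ∈ Set.Icc a b)
    (hnear : ∀ i ≤ k, |f (y i) - round (f (y i))| < δ) :
    1 ≤ 2 * c * lam * ((y k - y 0 : ℤ) : ℝ) ^ (∑ a ∈ Finset.range (k + 1), a) := by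
  obtain ⟨ξ, hξ, h⟩ := exists_iteratedDerivWithin_eq_divided_difference hab hf (fun i => (y i : ℝ))
    (fun i j hij hj => by exact_mod_cast hy i j hij hj) hmem
  obtain ⟨hl, hu⟩ := hder ξ hξ
  rw [h, abs_mul, Nat.abs_cast] at hl hu
  have hsplit : ∑ i ∈ Finset.range (k + 1),
        f (y i) / ∏ j ∈ (Finset.range (k + 1)).erase i, ((y i : ℝ) - y j) =
      ∑ i ∈ Finset.range (k + 1), (round (f (y i)) : ℝ) /
          ∏ j ∈ (Finset.range (k + 1)).erase i, ((y i : ℝ) - y j) +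
        ∑ i ∈ Finset.range (k + 1), (f (y i) - round (f (y i))) /
          ∏ j ∈ (Finset.range (k + 1)).erase i, ((y i : ℝ) - y j) := by
    rw [← Finset.sum_add_distrib]
    exact Finset.sum_congr rfl fun i _ => by ring
  have hε : |∑ i ∈ Finset.range (k + 1), (f (y i) - round (f (y i))) /
      ∏ j ∈ (Finset.range (k + 1)).erase i, ((y i : ℝ) - y j)| ≤ (k + 1) * δ := by
    refine (Finset.abs_sum_le_sum_abs _ _).trans ?_
    refine (Finset.sum_le_card_nsmul _ _ δ fun i hi => ?_).trans (by simp)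
    rw [Finset.mem_range, Nat.lt_succ_iff] at hi
    rw [abs_div]
    refine (div_le_self (abs_nonneg _) ?_).trans (hnear i hi).le
    have hne : ∏ j ∈ (Finset.range (k + 1)).erase i, (y i - y j) ≠ 0 := by
      rw [Finset.prod_ne_zero_iff]
      intro j hj
      rw [Finset.mem_erase, Finset.mem_range, Nat.lt_succ_iff] at hj
      rcases lt_or_gt_of_ne hj.1 with h1 | h1
      · exact sub_ne_zero.2 (hy j i h1 hi).ne'
      · exact sub_ne_zero.2 (hy i j h1 hj.2).ne
    exact_mod_cast Int.one_le_abs hne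
  rw [hsplit] at hl hu
  set D := ∑ i ∈ Finset.range (k + 1), (round (f (y i)) : ℝ) /
          ∏ j ∈ (Finset.range (k + 1)).erase i, ((y i : ℝ) - y j) with hD
  set E := ∑ i ∈ Finset.range (k + 1), (f (y i) - round (f (y i))) /
      ∏ j ∈ (Finset.range (k + 1)).erase i, ((y i : ℝ) - y j)
  have hk1 : (1 : ℝ) ≤ k.factorial := by exact_mod_cast Nat.factorial_pos k
  have hE : (k.factorial : ℝ) * |E| < lam := by
    refine lt_of_le_of_lt ?_ hfact
    rw [Nat.factorial_succ]
    push_cast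
    nlinarith
  have hlam : 0 < lam := lt_of_le_of_lt (by positivity) hE
  have hD0 : D ≠ 0 := by
    intro h0
    rw [h0, zero_add] at hl
    linarith
  have hDle : |D| ≤ 2 * c * lam := by
    have h1 : |D| ≤ |D + E| + |E| := by simpa using abs_sub (D + E) E
    have h2 : (k.factorial : ℝ) * |D| ≤ c * lam + lam := by nlinarith
    nlinarith [abs_nonneg D]
  have hspan : 0 ≤ ((y k - y 0 : ℤ) : ℝ) := by
    rcases Nat.eq_zero_or_pos k with rfl | hk
    · simp
    · exact_mod_cast sub_nonneg.2 (hy 0 k hk le_rfl).le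
  exact (one_le_abs_sum_mul_span_pow k y _ hy hD0).trans (by gcongr)

open scoped Classical in
theorem stmt4 (k : ℕ) (hk : 1 ≤ k) (M : ℝ) (hM : 0 < M) (f : ℝ → ℝ)
    (hf : ContDiffOn ℝ k f (Set.Icc M (2 * M)))
    (lam c : ℝ) (hlam : 0 < lam) (hc : 1 ≤ c)
    (hder : ∀ x ∈ Set.Icc M (2 * M),
      lam ≤ |iteratedDerivWithin k f (Set.Icc M (2 * M)) x| ∧
        |iteratedDerivWithin k f (Set.Icc M (2 * M)) x| ≤ c * lam)
    (δ : ℝ) (hδ : 0 < δ) (hfact : (Nat.factorial (k + 1) : ℝ) * δ < lam) :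
    (((Finset.Icc ⌈M⌉ ⌊2 * M⌋).filter
        (fun x : ℤ => |f (x : ℝ) - round (f (x : ℝ))| < δ)).card : ℝ)
      ≤ 2 * (k : ℝ) * (2 * c) ^ ((2 : ℝ) / ((k : ℝ) ^ 2 + k)) * M
          * lam ^ ((2 : ℝ) / ((k : ℝ) ^ 2 + k)) + 4 * k := by
  have he : (0 : ℝ) < (k : ℝ) ^ 2 + k := by positivity
  set e : ℝ := (2 : ℝ) / ((k : ℝ) ^ 2 + k) with hedef
  have hA : 0 < 2 * c * lam := by positivity
  have ha : 0 < ((2 * c * lam) ^ e)⁻¹ := by positivity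
  have hcard := card_le_of_span_ge k hk hM.le ha ((Finset.Icc ⌈M⌉ ⌊2 * M⌋).filter
        (fun x : ℤ => |f (x : ℝ) - round (f (x : ℝ))| < δ))
    (fun x hx => by
      rw [Finset.mem_filter, Finset.mem_Icc, Int.ceil_le, Int.le_floor] at hx
      exact hx.1)
    (fun y hy hmem => by
      simp only [Finset.mem_filter, Finset.mem_Icc, Int.ceil_le, Int.le_floor] at hmem
      have h := one_le_mul_span_pow_of_near_integers (by linarith) hf hder hfact y hy
        (fun i hi => (hmem i hi).1) (fun i hi => (hmem i hi).2)
      have hL : 0 ≤ ((y k - y 0 : ℤ) : ℝ) := by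
        exact_mod_cast sub_nonneg.2 (hy 0 k hk le_rfl).le
      have hsum : ((∑ a ∈ Finset.range (k + 1), a : ℕ) : ℝ) * e = 1 := by
        have h1 : (((∑ a ∈ Finset.range (k + 1), a) * 2 : ℕ) : ℝ) = ((k + 1) * k : ℕ) := by
          rw [Finset.sum_range_id_mul_two, Nat.add_sub_cancel]
        rw [hedef, mul_div_assoc', div_eq_one_iff_eq he.ne']
        push_cast at h1 ⊢
        linarith
      have h2 := Real.one_le_rpow h (z := e) (by positivity)
      rw [Real.mul_rpow hA.le (by positivity), ← Real.rpow_natCast, ← Real.rpow_mul hL, hsum,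
        Real.rpow_one] at h2
      rw [inv_le_iff_one_le_mul₀' (by positivity)]
      exact h2)
  have hB : 0 ≤ (k : ℝ) * (M * (2 * c * lam) ^ e) := by positivity
  rw [div_inv_eq_mul] at hcard
  have hrw : 2 * (k : ℝ) * (2 * c) ^ e * M * lam ^ e = 2 * (k * (M * (2 * c * lam) ^ e)) := by
    rw [Real.mul_rpow (by positivity) hlam.le]
    ring
  rw [hrw]
  have hk0 : (0 : ℝ) ≤ k := by positivity
  linarith
end

section
/- Let N ≥ 2 and let (x, m) be an N-solution, i.e., integers x ≥ 2, m ≥ 2 with (x^m − 1)/(x − 1) = N. Then 0 < m − f_N(x) < 1/((x^m − 1)·log x) ≤ 1/(N·log x), where f_N(x) = (log N + log(x − 1))/log x. -/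
theorem Real.log_sub_log_sub_one_lt {y : ℝ} (hy : 1 < y) :
    Real.log y - Real.log (y - 1) < 1 / (y - 1) := by
  have h1 : 0 < y - 1 := sub_pos.mpr hy
  have h0 : 0 < y := by linarith
  rw [← Real.log_div h0.ne' h1.ne']
  have hne : y / (y - 1) ≠ 1 := by
    rw [Ne, div_eq_one_iff_eq h1.ne']
    linarith
  calc Real.log (y / (y - 1)) < y / (y - 1) - 1 :=
        Real.log_lt_sub_one_of_pos (div_pos h0 h1) hne
    _ = 1 / (y - 1) := by
        field_simp
        ring

theorem stmt7 (N x m : ℕ) (hN : 2 ≤ N) (h : IsNSol N x m) :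
    0 < (m : ℝ) - (Real.log N + Real.log ((x : ℝ) - 1)) / Real.log x ∧
    (m : ℝ) - (Real.log N + Real.log ((x : ℝ) - 1)) / Real.log x
      < 1 / (((x : ℝ) ^ m - 1) * Real.log x) ∧
    1 / (((x : ℝ) ^ m - 1) * Real.log x) ≤ 1 / ((N : ℝ) * Real.log x) := by
  obtain ⟨hx, hm, hsum⟩ := h
  have hx2 : (2 : ℝ) ≤ x := by exact_mod_cast hx
  have hN0 : (0 : ℝ) < N := by exact_mod_cast (by omega : 0 < N)
  have hlog : 0 < Real.log x := Real.log_pos (by linarith)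
  have hgeom : (N : ℝ) * ((x : ℝ) - 1) = (x : ℝ) ^ m - 1 := by
    rw [← hsum]
    push_cast
    exact geom_sum_mul (x : ℝ) m
  have hy : 1 < (x : ℝ) ^ m := one_lt_pow₀ (by linarith) (by omega)
  have hdiff : (m : ℝ) - (Real.log N + Real.log ((x : ℝ) - 1)) / Real.log x =
      (Real.log ((x : ℝ) ^ m) - Real.log ((x : ℝ) ^ m - 1)) / Real.log x := by
    rw [← Real.log_mul hN0.ne' (by linarith), hgeom, Real.log_pow]
    field_simp
  refine ⟨?_, ?_, ?_⟩
  · rw [hdiff]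
    exact div_pos (sub_pos.mpr (Real.log_lt_log (by linarith) (by linarith))) hlog
  · rw [hdiff, ← div_div]
    exact div_lt_div_of_pos_right (Real.log_sub_log_sub_one_lt hy) hlog
  · have hle : (N : ℝ) ≤ (x : ℝ) ^ m - 1 := by
      rw [← hgeom]
      exact le_mul_of_one_le_right hN0.le (by linarith)
    gcongr
end
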